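/- (Frobenius formula for σ^qW.) Let β ∈ 𝒫_{n,e} and 0 ≤ b < e, put w = w_β(b), and assume w ∈ σ^q W (i.e. Δ(β) ≡ q mod p). Then 𝐩_{β,b}(x) = Σ_{(α,φ) ∈ 𝒫̃^q_W} χ̃^{α,φ}(w)·𝐬_{α,φ}(x), the sum over the parameter set 𝒫̃^q_W of σ^q-stable irreducible characters of W. -/

import Mathlib

/-!
Common framework for formalizing T. Shoji, "Green functions associated to
complex reflection groups, II" (arXiv:math/0105053).

We model:
* `e`-partitions of `n` as functions `ZMod e → Multiset ℕ`;
* the complex reflection group `W̃ = G(e,1,n)` as the semidirect product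
  `(Fin n → Multiplicative (ZMod e)) ⋊ Equiv.Perm (Fin n)`, and
  `W = G(e,p,n)` as the kernel of the mod-`p` sum character;
* the tensor space `V^{⊗n}` concretely via matrices indexed by
  `Fin n → (Σ k : ZMod e, Fin (m k))`;
* symmetric functions in the (finitely many, `m k ≥ n`) variables
  `x_i^{(k)}` in evaluated form, i.e. as functions of an assignment
  `xv : (Σ k : ZMod e, Fin (m k)) → ℂ`.
-/

open scoped BigOperators

attribute [local instance] Classical.propDecidable

namespace GreenII

/-! ## Combinatorics of e-partitions -/

/-- An `e`-partition of `n`: a tuple of partitions (multisets of positive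
integers) indexed by `ZMod e`, with total size `n`. -/
def IsEPartition (e : ℕ) [NeZero e] (n : ℕ) (α : ZMod e → Multiset ℕ) : Prop :=
  (∀ k, ∀ x ∈ α k, 0 < x) ∧ (∑ k : ZMod e, (α k).sum) = n

/-- The shift operator `θ = θ_p`, `θ(α)^{(k)} = α^{(k-d)}`. -/
def theta (e : ℕ) [NeZero e] (d : ℕ) (α : ZMod e → Multiset ℕ) : ZMod e → Multiset ℕ :=
  fun k => α (k - (d : ZMod e))

/-- `c_{α,p}`: the size of the `θ`-orbit of `α`. -/
noncomputable def csize (e : ℕ) [NeZero e] (d : ℕ) (α : ZMod e → Multiset ℕ) : ℕ :=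
  Function.minimalPeriod (theta e d) α

/-- `Δ(α) = ∑_k k · l(α^{(k)})`. -/
def Delta (e : ℕ) [NeZero e] (α : ZMod e → Multiset ℕ) : ℕ :=
  ∑ k : ZMod e, k.val * (α k).card

/-- `l(α) = ∑_k l(α^{(k)})`, the total number of parts. -/
def lenE (e : ℕ) [NeZero e] (α : ZMod e → Multiset ℕ) : ℕ :=
  ∑ k : ZMod e, (α k).card

/-- `α` and `β` lie in the same `θ`-orbit. -/
def SameOrbit (e : ℕ) [NeZero e] (d : ℕ) (α β : ZMod e → Multiset ℕ) : Prop :=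
  ∃ i, (theta e d)^[i] α = β

/-! ## The groups `W̃ = G(e,1,n)` and `W = G(e,p,n)` -/

/-- The "diagonal" part of `G(e,1,n)`. -/
abbrev NC (e n : ℕ) := Fin n → Multiplicative (ZMod e)

/-- The permutation action of `𝔖_n` on the diagonal part. -/
def permAut (e n : ℕ) (x : Equiv.Perm (Fin n)) : NC e n ≃* NC e n where
  toFun f := f ∘ ⇑x.symm
  invFun f := f ∘ ⇑x
  left_inv f := by funext i; simp
  right_inv f := by funext i; simp
  map_mul' f g := rfl

def permHom (e n : ℕ) : Equiv.Perm (Fin n) →* MulAut (NC e n) where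
  toFun x := permAut e n x
  map_one' := rfl
  map_mul' x y := rfl

/-- `W̃ = G(e,1,n) ≅ (ℤ/eℤ)^n ⋊ 𝔖_n`, with `w = x(a_1,…,a_n)` recorded as
`⟨(a_i), x⟩`. -/
abbrev Wt (e n : ℕ) := NC e n ⋊[permHom e n] Equiv.Perm (Fin n)

noncomputable instance WtFintype (e n : ℕ) [NeZero e] : Fintype (Wt e n) :=
  Fintype.ofEquiv (NC e n × Equiv.Perm (Fin n))
    { toFun := fun x => ⟨x.1, x.2⟩
      invFun := fun x => (x.left, x.right)
      left_inv := fun _ => rfl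
      right_inv := fun _ => rfl }

/-- The character `w ↦ ∑ a_i mod p` of `W̃`. -/
noncomputable def wsumHom (e p n : ℕ) (hp : p ∣ e) : Wt e n →* Multiplicative (ZMod p) where
  toFun w := Multiplicative.ofAdd (∑ i, ZMod.castHom hp (ZMod p) (w.left i).toAdd)
  map_one' := by simp
  map_mul' w w' := by
    have h : ∀ i, ((w * w').left i).toAdd
        = (w.left i).toAdd + (w'.left (w.right.symm i)).toAdd := fun _ => rfl
    simp only [h, map_add, Finset.sum_add_distrib, ofAdd_add]
    congr 2
    exact Equiv.sum_comp w.right.symm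
      (fun i => ZMod.castHom hp (ZMod p) ((w'.left i).toAdd))

/-- `W = G(e,p,n)`: the subgroup of `W̃` on which `∑ a_i ≡ 0 (mod p)`. -/
noncomputable def Wgrp (e p n : ℕ) (hp : p ∣ e) : Subgroup (Wt e n) :=
  (wsumHom e p n hp).ker

/-- `σ = t_1 ∈ W̃`. -/
def sigmaElt (e n : ℕ) [NeZero n] : Wt e n :=
  SemidirectProduct.inl (fun i => Multiplicative.ofAdd (if i = (0 : Fin n) then (1 : ZMod e) else 0))

/-- membership in the coset `σ^q W`. -/
def inCoset (e p n : ℕ) [NeZero n] (hp : p ∣ e) (q : ℕ) (w : Wt e n) : Prop :=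
  ∃ u ∈ Wgrp e p n hp, w = (sigmaElt e n) ^ q * u

/-- conjugacy under `W`. -/
def IsConjW (e p n : ℕ) (hp : p ∣ e) (w w' : Wt e n) : Prop :=
  ∃ u ∈ Wgrp e p n hp, u * w * u⁻¹ = w'

/-- The `e`-partition recording the conjugacy class of `w ∈ W̃`:
a `k`-cycle of length `l` (a cycle of the underlying permutation whose
accumulated `ZMod e`-color is `k`, fixed points counting as `1`-cycles)
contributes a part `l` to the `k`-th component. -/
noncomputable def classOf (e n : ℕ) [NeZero e] (w : Wt e n) : ZMod e → Multiset ℕ := fun k =>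
  ((w.right.cycleFactorsFinset.val.filter
      (fun c => (∑ i ∈ c.support, (w.left i).toAdd) = k)).map fun c => c.support.card)
    + Multiset.replicate
        ((Finset.univ.filter fun i : Fin n => w.right i = i ∧ (w.left i).toAdd = k).card) 1

/-! ### The standard class representative `w_α(b)` -/

/-- The list of (part, color) pairs of an `e`-partition. -/
noncomputable def partsList (e : ℕ) [NeZero e] (α : ZMod e → Multiset ℕ) : List (ℕ × ZMod e) :=
  (Finset.univ : Finset (ZMod e)).toList.flatMap fun k => (α k).toList.map fun r => (r, k)

/-- the color datum of `w_α(b)`: each cycle carries its color at its first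
point, except the first (exceptional) cycle, which carries `k - b` at its
first point and `b` at its last point. -/
noncomputable def aexc (e : ℕ) [NeZero e] (L : List (ℕ × ZMod e)) (b : ZMod e) :
    (Σ i : Fin L.length, Fin (L.get i).1) → ZMod e := fun x =>
  if (x.1 : ℕ) = 0 then
    (if (x.2 : ℕ) = 0 then (L.get x.1).2 - b else 0)
      + (if (x.2 : ℕ) = (L.get x.1).1 - 1 then b else 0)
  else if (x.2 : ℕ) = 0 then (L.get x.1).2 else 0

/-- The standard representative `w_α(b) ∈ W̃` of the paper, 2.6: a product of
disjoint cycles matching `α`, of the form `t_{i_1}^k z` except for one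
exceptional cycle `t_{i_1}^{k-b} t_{i_m}^{b} z`. -/
noncomputable def wrep (e n : ℕ) [NeZero e] (α : ZMod e → Multiset ℕ) (b : ZMod e) : Wt e n :=
  if hcard : Fintype.card (Σ i : Fin (partsList e α).length, Fin ((partsList e α).get i).1) = n then
    let φ := Fintype.equivFinOfCardEq hcard
    ⟨fun t => Multiplicative.ofAdd (aexc e (partsList e α) b (φ.symm t)),
      φ.symm.trans ((Equiv.sigmaCongrRight fun _ => finRotate _).trans φ)⟩
  else 1

/-! ## The tensor space `V^{⊗n}` -/

/-- Basis index of `V = ⊕_k V_k`, `dim V_k = m k`. -/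
abbrev BIdx (e : ℕ) [NeZero e] (m : ZMod e → ℕ) := Σ k : ZMod e, Fin (m k)

/-- Basis index of `V^{⊗n}`. -/
abbrev TIdx (e n : ℕ) [NeZero e] (m : ZMod e → ℕ) := Fin n → BIdx e m

/-- `ζ` raised to a `ZMod e` exponent. -/
noncomputable def zmpow (e : ℕ) [NeZero e] (ζ : ℂ) (c : ZMod e) : ℂ := ζ ^ c.val

/-- the matrix of `w ∈ W̃` on `V^{⊗n}` (𝔖_n permutes the factors, and
`t_k` multiplies by `ζ^j` if the `k`-th factor lies in `V_j`). -/
noncomputable def rhoMat (e n : ℕ) [NeZero e] (ζ : ℂ) (m : ZMod e → ℕ) (w : Wt e n) :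
    Matrix (TIdx e n m) (TIdx e n m) ℂ := fun b' b =>
  if b' = b ∘ ⇑w.right.symm then ∏ s, ζ ^ (((w.left s).toAdd.val) * (b' s).1.val) else 0

/-- The operator `D` (multiplication by `x_{i_1} ⋯ x_{i_n}`), with the
variables evaluated via `xv`. -/
noncomputable def Dmat (e n : ℕ) [NeZero e] (m : ZMod e → ℕ) (xv : BIdx e m → ℂ) :
    Matrix (TIdx e n m) (TIdx e n m) ℂ :=
  Matrix.diagonal fun b => ∏ s, xv (b s)

/-- `τ` on the basis of `V`: `v_j^{(k)} ↦ v_j^{(k+d)}` (uses `m (k+d) = m k`). -/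
def tauB (e : ℕ) [NeZero e] (d : ℕ) (m : ZMod e → ℕ) (hm : ∀ k, m (k + (d : ZMod e)) = m k) :
    BIdx e m → BIdx e m := fun b => ⟨b.1 + (d : ZMod e), Fin.cast (hm b.1).symm b.2⟩

/-- `g ↦ g^{⊗ n}`: the matrix of `g ∈ End V` acting diagonally on `V^{⊗n}`. -/
noncomputable def tensorPow (e n : ℕ) [NeZero e] (m : ZMod e → ℕ)
    (g : Matrix (BIdx e m) (BIdx e m) ℂ) : Matrix (TIdx e n m) (TIdx e n m) ℂ :=
  Matrix.of fun b' b => ∏ s, g (b' s) (b s)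

/-- the matrix of `τ` on `V`. -/
noncomputable def tauV (e : ℕ) [NeZero e] (d : ℕ) (m : ZMod e → ℕ)
    (hm : ∀ k, m (k + (d : ZMod e)) = m k) : Matrix (BIdx e m) (BIdx e m) ℂ :=
  fun b' b => if b' = tauB e d m hm b then 1 else 0

/-- the matrix of `τ` on `V^{⊗n}`. -/
noncomputable def tauMat (e n : ℕ) [NeZero e] (d : ℕ) (m : ZMod e → ℕ)
    (hm : ∀ k, m (k + (d : ZMod e)) = m k) : Matrix (TIdx e n m) (TIdx e n m) ℂ :=
  tensorPow e n m (tauV e d m hm)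

/-- a member of `G = GL_{m_0} × ⋯ × GL_{m_{e-1}}` (as an endomorphism of V,
invertibility stated separately). -/
def IsBlockDiag (e : ℕ) [NeZero e] (m : ZMod e → ℕ) (g : Matrix (BIdx e m) (BIdx e m) ℂ) : Prop :=
  ∀ b b' : BIdx e m, b.1 ≠ b'.1 → g b b' = 0

/-- a block upper unitriangular matrix (product of root subgroups for the
positive roots of `G`). -/
def IsUpperUni (e : ℕ) [NeZero e] (m : ZMod e → ℕ) (g : Matrix (BIdx e m) (BIdx e m) ℂ) : Prop :=
  (∀ b, g b b = 1) ∧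
    ∀ b b' : BIdx e m, b ≠ b' → ¬(b.1 = b'.1 ∧ b.2.val < b'.2.val) → g b b' = 0

/-! ## Symmetric functions (evaluated form) -/

/-- value of the variable `x_i^{(k)}` under the assignment `xv` (junk `0` out
of range). -/
noncomputable def xval (e : ℕ) [NeZero e] (m : ZMod e → ℕ) (xv : BIdx e m → ℂ)
    (k : ZMod e) (i : ℕ) : ℂ :=
  if h : i < m k then xv ⟨k, ⟨i, h⟩⟩ else 0

/-- `h_j`: the order of the image of `j` in `ℤ/pℤ`. -/
noncomputable def hOrd (p j : ℕ) : ℕ := addOrderOf ((j : ZMod p))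

/-- `j₁ d` where `j₁ = p / h_j`: the number of components of the variable
system `𝒳_j`. -/
noncomputable def Esys (p d j : ℕ) : ℕ := (p / hOrd p j) * d

/-- the variable `X_i^{(k)} = x_i^{(k)} x_i^{(k+jd)} ⋯ x_i^{(k+(h_j-1)jd)}`
of the system `𝒳_j`. -/
noncomputable def Xvar (e : ℕ) [NeZero e] (p d : ℕ) (m : ZMod e → ℕ) (xv : BIdx e m → ℂ)
    (j k i : ℕ) : ℂ :=
  ∏ s ∈ Finset.range (hOrd p j), xval e m xv (((k + s * j * d : ℕ) : ZMod e)) i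

/-- number of variables in the `k`-th component of any of the systems `𝒳_j`. -/
noncomputable def mmX (e : ℕ) [NeZero e] (m : ZMod e → ℕ) : ℕ → ℕ := fun k => m ((k : ℕ) : ZMod e)

/-- The variables of the system `𝒳_j`, as a doubly indexed family. -/
noncomputable def vvX (e : ℕ) [NeZero e] (p d : ℕ) (m : ZMod e → ℕ) (xv : BIdx e m → ℂ)
    (j : ℕ) : ℕ → ℕ → ℂ := fun k i => Xvar e p d m xv j k i

/-- complete homogeneous symmetric polynomial `h_r` in `N` variables. -/
noncomputable def hcomp (N r : ℕ) (v : ℕ → ℂ) : ℂ :=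
  ∑ c ∈ Finset.Nat.antidiagonalTuple N r, ∏ i : Fin N, v i ^ c i

/-- the parts of a partition in decreasing order (`0` beyond the length). -/
noncomputable def lamOf (μ : Multiset ℕ) (i : ℕ) : ℕ := ((μ.sort (· ≤ ·)).reverse).getD i 0

/-- Schur polynomial in `N` variables (Jacobi–Trudi). -/
noncomputable def schurFin (N : ℕ) (μ : Multiset ℕ) (v : ℕ → ℂ) : ℂ :=
  Matrix.det (Matrix.of fun i j : Fin N =>
    if h : (0 : ℤ) ≤ (lamOf μ i + j : ℤ) - i then hcomp N ((lamOf μ i + j : ℤ) - i).toNat v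
    else 0)

/-- monomial symmetric polynomial in `N` variables. -/
noncomputable def monoFin (N : ℕ) (μ : Multiset ℕ) (v : ℕ → ℂ) : ℂ :=
  ∑ c ∈ (Finset.Nat.antidiagonalTuple N μ.sum).filter
      (fun c => ((List.ofFn c : List ℕ) : Multiset ℕ).filter (fun x => 0 < x) = μ),
    ∏ i : Fin N, v i ^ c i

/-! ### generic families for a variable system with `E` components -/

/-- `p_r^{(i)} = ∑_{k<E} u^{ik} p_r(x^{(k)})` (formula (2.2.2)/(2.4.2), with
`u` a primitive `E`-th root of unity), for the system of variables
`vv k i` (`k < E`, `i < mm k`); `p_0^{(i)} = 1`. -/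
noncomputable def pGenSys (u : ℂ) (E : ℕ) (mm : ℕ → ℕ) (vv : ℕ → ℕ → ℂ) (i r : ℕ) : ℂ :=
  if r = 0 then 1 else ∑ k ∈ Finset.range E, u ^ (i * k) * ∑ s ∈ Finset.range (mm k), vv k s ^ r

/-- the power sum `p_γ` of an `E`-tuple of partitions (2.2.1). -/
noncomputable def pAlphaSys (u : ℂ) (E : ℕ) (mm : ℕ → ℕ) (vv : ℕ → ℕ → ℂ)
    (γ : ℕ → Multiset ℕ) : ℂ :=
  ∏ k ∈ Finset.range E, ((γ k).map fun r => pGenSys u E mm vv k r).prod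

/-- the Schur function `s_γ` of an `E`-tuple of partitions. -/
noncomputable def sAlphaSys (E : ℕ) (mm : ℕ → ℕ) (vv : ℕ → ℕ → ℂ) (γ : ℕ → Multiset ℕ) : ℂ :=
  ∏ k ∈ Finset.range E, schurFin (mm k) (γ k) (vv k)

/-- the monomial symmetric function `m_γ` of an `E`-tuple of partitions. -/
noncomputable def mAlphaSys (E : ℕ) (mm : ℕ → ℕ) (vv : ℕ → ℕ → ℂ) (γ : ℕ → Multiset ℕ) : ℂ :=
  ∏ k ∈ Finset.range E, monoFin (mm k) (γ k) (vv k)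

/-- the function `q_{r,±}^{(k)}(x;t)` of [S], (3.1.1). -/
noncomputable def qGenSys (t : ℂ) (E : ℕ) (mm : ℕ → ℕ) (vv : ℕ → ℕ → ℂ)
    (sgn : Bool) (k r : ℕ) : ℂ :=
  if r = 0 then 1 else
    let k' := if sgn then (k + 1) % E else (k + E - 1) % E
    ∑ i ∈ Finset.range (mm k),
      vv k i ^ ((r : ℤ) + (mm k : ℤ) - 1 - (mm k' : ℤ)) *
        (∏ jj ∈ Finset.range (mm k'), (vv k i - t * vv k' jj)) /
        ∏ jj ∈ (Finset.range (mm k)).erase i, (vv k i - vv k jj)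

/-- the function `q_{γ,±}(x;t)` of [S], (3.1.2). -/
noncomputable def qAlphaSys (t : ℂ) (E : ℕ) (mm : ℕ → ℕ) (vv : ℕ → ℕ → ℂ)
    (sgn : Bool) (γ : ℕ → Multiset ℕ) : ℂ :=
  ∏ k ∈ Finset.range E, ((γ k).map fun r => qGenSys t E mm vv sgn k r).prod

/-- `z_β = ∏ i^{n_i} n_i!` for a partition `β = (1^{n_1} 2^{n_2} ⋯)`. -/
noncomputable def zPart (μ : Multiset ℕ) : ℂ :=
  ∏ i ∈ μ.toFinset, (i : ℂ) ^ (μ.count i) * (Nat.factorial (μ.count i) : ℂ)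

/-- `z_γ(t) = z_γ ∏_{k,j} (1 - u^k t^{γ_j^{(k)}})⁻¹` for an `E`-tuple of
partitions `γ` (`u` the `E`-th root of unity), cf. (3.1.3). -/
noncomputable def zClassSys (u t : ℂ) (E : ℕ) (γ : ℕ → Multiset ℕ) : ℂ :=
  ((E : ℂ) ^ (∑ k ∈ Finset.range E, (γ k).card)) * (∏ k ∈ Finset.range E, zPart (γ k)) *
    (∏ k ∈ Finset.range E, ((γ k).map fun r => (1 - u ^ k * t ^ r)).prod)⁻¹

/-! ### the `j`-th pieces attached to an e-partition -/

/-- the truncation `α{j} = (α^{(0)},…,α^{(j₁d-1)})` (used when `c_{α,p} ∣ j`). -/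
noncomputable def braceF (e : ℕ) [NeZero e] (p d : ℕ) (j : ℕ) (α : ZMod e → Multiset ℕ) :
    ℕ → Multiset ℕ :=
  fun k => if k < Esys p d j then α ((k : ℕ) : ZMod e) else 0

/-- the `j₁d`-partition `α[j]` of `n/h` (condition (2.6.1)): component `k/h`
has parts `α_i^{(k)}/h`. -/
noncomputable def bracketF (e : ℕ) [NeZero e] (p d : ℕ) (j : ℕ) (α : ZMod e → Multiset ℕ) :
    ℕ → Multiset ℕ :=
  fun k' => if k' < Esys p d j then (α (((hOrd p j * k' : ℕ) : ZMod e))).map (fun r => r / hOrd p j)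
  else 0

/-- condition (2.6.1): `h_j` divides all parts `α_i^{(k)}`, and `h_j ∣ k`
whenever `α^{(k)} ≠ ∅`. -/
def Cond261 (e : ℕ) [NeZero e] (p j : ℕ) (α : ZMod e → Multiset ℕ) : Prop :=
  (∀ k, ∀ r ∈ α k, hOrd p j ∣ r) ∧ ∀ k : ZMod e, α k ≠ 0 → hOrd p j ∣ k.val

/-- `s_{α{j}}(𝒳_j)`. -/
noncomputable def schurBrace (e : ℕ) [NeZero e] (p d : ℕ) (m : ZMod e → ℕ) (xv : BIdx e m → ℂ)
    (j : ℕ) (α : ZMod e → Multiset ℕ) : ℂ :=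
  sAlphaSys (Esys p d j) (mmX e m) (vvX e p d m xv j) (braceF e p d j α)

/-- `p_{α[j]}(𝒳_j)` (2.6; the root of unity for the system `𝒳_j` is `ζ^h`). -/
noncomputable def pBracket (e : ℕ) [NeZero e] (p d : ℕ) (ζ : ℂ) (m : ZMod e → ℕ)
    (xv : BIdx e m → ℂ) (j : ℕ) (α : ZMod e → Multiset ℕ) : ℂ :=
  pAlphaSys (ζ ^ hOrd p j) (Esys p d j) (mmX e m) (vvX e p d m xv j) (bracketF e p d j α)

/-- `l(α[j])`. -/
noncomputable def lenBracket (e : ℕ) [NeZero e] (p d : ℕ) (j : ℕ)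
    (α : ZMod e → Multiset ℕ) : ℕ :=
  ∑ k ∈ Finset.range (Esys p d j), (bracketF e p d j α k).card

/-! ### Schur functions and power sums for `σ^q W` (2.10) -/

/-- the `j`-th component `s^j_{α,φ}` of the Schur function `𝐬_{α,φ}` for
`σ^q W` (2.10.1); the character `φ = φ_r` of `Γ_α = ⟨τ^c⟩ ≅ ℤ/(p/c)ℤ` is
encoded by `r`, via `φ_r(τ^j) = ζ^{drj}` for `c ∣ j`. -/
noncomputable def sTuple (e : ℕ) [NeZero e] (p d q : ℕ) (ζ : ℂ) (m : ZMod e → ℕ)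
    (xv : BIdx e m → ℂ) (α : ZMod e → Multiset ℕ) (r : ℕ) (j : ℕ) : ℂ :=
  if csize e d α ∣ j then
    ζ ^ (d * r * j) *
      ∑ i ∈ Finset.range (csize e d α),
        ζ ^ (q * i * d) * schurBrace e p d m xv j ((theta e d)^[i] α)
  else 0

/-- the `j`-th component `p^j_{β,b}` of the power sum `𝐩_{β,b}` for `σ^q W`
(2.10.2). -/
noncomputable def pTuple (e : ℕ) [NeZero e] (p d : ℕ) (ζ : ℂ) (m : ZMod e → ℕ)
    (xv : BIdx e m → ℂ) (β : ZMod e → Multiset ℕ) (b : ZMod e) (j : ℕ) : ℂ :=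
  if Cond261 e p j β then
    (hOrd p j : ℂ) ^ (lenBracket e p d j β) *
      zmpow e ζ (-(((Delta e β : ZMod e) + b) * ((j * d : ℕ) : ZMod e))) *
      pBracket e p d ζ m xv j β
  else 0

/-! ## The model for (extensions of) the irreducible characters of `W` -/

/-- trace of `f` on a subspace (junk `0` if not invariant). -/
noncomputable def traceOn {V : Type*} [AddCommGroup V] [Module ℂ V]
    (S : Submodule ℂ V) (f : V →ₗ[ℂ] V) : ℂ :=
  if h : ∀ v ∈ S, f v ∈ S then LinearMap.trace ℂ S (f.restrict h) else 0

/-- the scalar by which the torus element `diag dv ∈ G` acts on a highest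
weight vector of weight `α`. -/
noncomputable def weightOf (e : ℕ) [NeZero e] (m : ZMod e → ℕ) (α : ZMod e → Multiset ℕ)
    (dv : BIdx e m → ℂ) : ℂ :=
  ∏ b : BIdx e m, dv b ^ (lamOf (α b.1) b.2.val)

/-- the space of highest weight vectors of weight `α` in `V^{⊗n}`: the model
for the irreducible `W̃`-module `Z_α` (1.3.1, 1.4). -/
noncomputable def hwSubmodule (e n : ℕ) [NeZero e] (m : ZMod e → ℕ)
    (α : ZMod e → Multiset ℕ) : Submodule ℂ (TIdx e n m → ℂ) :=
  (⨅ g ∈ {g | IsUpperUni e m g},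
      Module.End.eigenspace (Matrix.mulVecLin (tensorPow e n m g)) 1) ⊓
    ⨅ dv : BIdx e m → ℂ,
      Module.End.eigenspace (Matrix.mulVecLin (tensorPow e n m (Matrix.diagonal dv)))
        (weightOf e m α dv)

/-- the model for the irreducible `W`-module `Z_{α,φ_r}`: the
`φ_r(τ^c)`-eigenspace of `τ^c` on `Z_α`, where `c = c_{α,p}` and
`φ_r(τ^c) = ζ^{cdr}`. -/
noncomputable def ZSub (e n : ℕ) [NeZero e] (d : ℕ) (m : ZMod e → ℕ)
    (hm : ∀ k, m (k + (d : ZMod e)) = m k) (ζ : ℂ) (α : ZMod e → Multiset ℕ) (r : ℕ) :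
    Submodule ℂ (TIdx e n m → ℂ) :=
  hwSubmodule e n m α ⊓
    Module.End.eigenspace (Matrix.mulVecLin ((tauMat e n d m hm) ^ (csize e d α)))
      (ζ ^ (csize e d α * d * r))

/-- The model for the irreducible character `χ^{α,φ_r}` of `W` and for its
chosen extension `χ̃^{α,φ_r}` to `⟨σ^q⟩ ⋉ W`: the trace of `w` on the model
`Z_{α,φ_r} ⊆ V^{⊗n}`. -/
noncomputable def charExt (e n : ℕ) [NeZero e] (d : ℕ) (m : ZMod e → ℕ)
    (hm : ∀ k, m (k + (d : ZMod e)) = m k) (ζ : ℂ) (α : ZMod e → Multiset ℕ) (r : ℕ)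
    (w : Wt e n) : ℂ :=
  traceOn (ZSub e n d m hm ζ α r) (Matrix.mulVecLin (rhoMat e n ζ m w))

/-! ## symbols, a-function, similarity; the reflection representation -/

/-- the multiset of entries of the symbol `Λ(α) = α + Λ⁰` of type `(r,0)`. -/
noncomputable def entriesSym (e : ℕ) [NeZero e] (m : ZMod e → ℕ) (rsym : ℕ)
    (α : ZMod e → Multiset ℕ) : Multiset ℕ :=
  (Finset.univ : Finset (BIdx e m)).val.map fun b =>
    lamOf (α b.1) b.2.val + rsym * (m b.1 - 1 - b.2.val)

noncomputable def pairMinSum (M : Multiset ℕ) : ℕ :=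
  (M.bind fun a => M.map fun b => min a b).sum

/-- the `a`-function (3.5.2) on symbols of type `(rsym, 0)`. -/
noncomputable def aVal (e : ℕ) [NeZero e] (m : ZMod e → ℕ) (rsym : ℕ)
    (α : ZMod e → Multiset ℕ) : ℕ :=
  pairMinSum (entriesSym e m rsym α) - pairMinSum (entriesSym e m rsym (fun _ => 0))

/-- similarity of symbols: equality of entries with multiplicities. -/
def SimSym (e : ℕ) [NeZero e] (m : ZMod e → ℕ) (rsym : ℕ) (α β : ZMod e → Multiset ℕ) : Prop :=
  entriesSym e m rsym α = entriesSym e m rsym β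

/-- the reflection representation `M = ℂ^n` of `W̃` (`w(e_i) = ζ^{a_i} e_{x(i)}`). -/
noncomputable def refMat (e n : ℕ) [NeZero e] (ζ : ℂ) (w : Wt e n) :
    Matrix (Fin n) (Fin n) ℂ :=
  fun i' i => if i' = w.right i then zmpow e ζ (w.left i').toAdd else 0

/-- The functional `R_q(f)` of (4.2.1), for a function `f` on the coset `σ^q W`. -/
noncomputable def Rq (e p d n : ℕ) [NeZero e] [NeZero n] (hp : p ∣ e) (ζ t : ℂ) (q : ℕ)
    (f : Wt e n → ℂ) : ℂ :=
  (ζ ^ (q * d) * t ^ (d * n) - 1) * (∏ i ∈ Finset.Icc 1 (n - 1), (t ^ (e * i) - 1)) *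
    (Nat.card (Wgrp e p n hp) : ℂ)⁻¹ *
    ∑ w ∈ Finset.univ.filter (fun w => inCoset e p n hp q w),
      (refMat e n ζ w).det * f w / (t • (1 : Matrix (Fin n) (Fin n) ℂ) - refMat e n ζ w).det

/-- `N^*`: the number of reflections in `W`. -/
noncomputable def Nstar (e p n : ℕ) [NeZero e] (hp : p ∣ e) (ζ : ℂ) : ℕ :=
  Nat.card {w : Wt e n // w ∈ Wgrp e p n hp ∧ w ≠ 1 ∧ (refMat e n ζ w - 1).rank = 1}

end GreenII

open scoped BigOperators
set_option linter.unusedSectionVars false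
namespace GreenII

/-! ### Part A: projections and traces -/

open Matrix in
lemma exists_proj {X : Type*} [Fintype X] (S : Submodule ℂ (X → ℂ)) :
    ∃ Q : Matrix X X ℂ, Q * Q = Q ∧ Qᴴ = Q ∧ ∀ v, v ∈ S ↔ Q *ᵥ v = v := by
  let E := EuclideanSpace ℂ X
  let L : E ≃ₗ[ℂ] (X → ℂ) := WithLp.linearEquiv 2 ℂ (X → ℂ)
  let S' : Submodule ℂ E := S.comap L.toLinearMap
  let P : E →L[ℂ] E := S'.starProjection
  let f : (X → ℂ) →ₗ[ℂ] (X → ℂ) := L.toLinearMap ∘ₗ P.toLinearMap ∘ₗ L.symm.toLinearMap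
  have hf : ∀ v, f v = L (P (L.symm v)) := fun v => rfl
  have hQ : ∀ v, (LinearMap.toMatrix' f) *ᵥ v = f v := fun v => by
    rw [← Matrix.toLin'_apply, Matrix.toLin'_toMatrix']
  have hmem : ∀ v, v ∈ S ↔ f v = v := by
    intro v
    have h1 : v ∈ S ↔ L.symm v ∈ S' := by simp [S']
    rw [h1, hf, ← Submodule.starProjection_eq_self_iff]
    exact ⟨fun h => by rw [show P (L.symm v) = _ from h]; simp, fun h => by
      have := congrArg L.symm h; simpa using this⟩
  refine ⟨LinearMap.toMatrix' f, ?_, ?_, ?_⟩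
  · rw [← LinearMap.toMatrix'_comp]
    congr 1
    ext1 v
    apply LinearMap.ext
    intro w
    have : f (f (LinearMap.single ℂ (fun _ => ℂ) v w)) = f (LinearMap.single ℂ (fun _ => ℂ) v w) := by
      rw [← hmem]
      have : P (L.symm (LinearMap.single ℂ (fun _ => ℂ) v w)) ∈ S' := Submodule.starProjection_apply_mem _ _
      exact this
    simpa using this
  · ext a b
    rw [Matrix.conjTranspose_apply, LinearMap.toMatrix'_apply, LinearMap.toMatrix'_apply]
    have key : ∀ x y : E, inner ℂ (P x) y = inner ℂ x (P y) := fun x y =>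
      Submodule.inner_starProjection_left_eq_right S' x y
    have h := key (EuclideanSpace.single a 1) (EuclideanSpace.single b 1)
    rw [EuclideanSpace.inner_single_left, EuclideanSpace.inner_single_right] at h
    simp only [map_one, one_mul] at h
    have e1 : ∀ a : X, L.symm (Pi.single a (1:ℂ)) = EuclideanSpace.single a 1 := fun a => rfl
    have e2 : ∀ a b : X, f (Pi.single a 1) b = P (EuclideanSpace.single a 1) b := by
      intro a b
      rw [hf, e1]; rfl
    simp only [e2]
    exact h
  · intro v; rw [hQ, hmem]

section Proj
open Matrix
variable {X : Type*} [Fintype X]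

lemma proj_mul_of_fix {Q : Matrix X X ℂ} {S : Submodule ℂ (X → ℂ)}
    (hQ2 : Q * Q = Q) (hS : ∀ v, v ∈ S ↔ Q *ᵥ v = v) (v : X → ℂ) : Q *ᵥ v ∈ S := by
  rw [hS, Matrix.mulVec_mulVec, hQ2]

lemma mat_ext_mulVec {A B : Matrix X X ℂ} (h : ∀ v, A *ᵥ v = B *ᵥ v) : A = B := by
  apply Matrix.toLin'.injective
  apply LinearMap.ext
  intro v
  simpa using h v

/-- uniqueness of Hermitian projectors -/
lemma proj_unique {Q Q' : Matrix X X ℂ} {S : Submodule ℂ (X → ℂ)}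
    (hQ2 : Q * Q = Q) (hQh : Qᴴ = Q) (hS : ∀ v, v ∈ S ↔ Q *ᵥ v = v)
    (hQ2' : Q' * Q' = Q') (hQh' : Q'ᴴ = Q') (hS' : ∀ v, v ∈ S ↔ Q' *ᵥ v = v) : Q = Q' := by
  have h1 : Q * Q' = Q' := mat_ext_mulVec fun v => by
    rw [← Matrix.mulVec_mulVec, ← hS, hS', Matrix.mulVec_mulVec, hQ2']
  have h2 : Q' * Q = Q := mat_ext_mulVec fun v => by
    rw [← Matrix.mulVec_mulVec, ← hS', hS, Matrix.mulVec_mulVec, hQ2]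
  have h3 := congrArg Matrix.conjTranspose h1
  rw [Matrix.conjTranspose_mul, hQh, hQh', h2] at h3
  exact h3

lemma preserve_mul {Q A : Matrix X X ℂ} {S : Submodule ℂ (X → ℂ)}
    (hQ2 : Q * Q = Q) (hS : ∀ v, v ∈ S ↔ Q *ᵥ v = v)
    (hA : ∀ v ∈ S, A *ᵥ v ∈ S) : Q * (A * Q) = A * Q := mat_ext_mulVec fun v => by
  rw [← Matrix.mulVec_mulVec, ← hS, ← Matrix.mulVec_mulVec]
  apply hA
  rw [hS, Matrix.mulVec_mulVec, hQ2]

lemma preserve_comm {Q A : Matrix X X ℂ} {S : Submodule ℂ (X → ℂ)}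
    (hQ2 : Q * Q = Q) (hQh : Qᴴ = Q) (hS : ∀ v, v ∈ S ↔ Q *ᵥ v = v)
    (hA : ∀ v ∈ S, A *ᵥ v ∈ S) (hA' : ∀ v ∈ S, Aᴴ *ᵥ v ∈ S) : A * Q = Q * A := by
  have h1 := preserve_mul hQ2 hS hA
  have h2 := congrArg Matrix.conjTranspose (preserve_mul hQ2 hS hA')
  simp only [Matrix.conjTranspose_mul, hQh, Matrix.conjTranspose_conjTranspose] at h2
  rw [← h1, ← h2, Matrix.mul_assoc]

lemma traceOn_eq {Q A : Matrix X X ℂ} {S : Submodule ℂ (X → ℂ)}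
    (hQ2 : Q * Q = Q) (hS : ∀ v, v ∈ S ↔ Q *ᵥ v = v)
    (hA : ∀ v ∈ S, A *ᵥ v ∈ S) : traceOn S (Matrix.mulVecLin A) = Matrix.trace (A * Q) := by
  have hA1 : ∀ v ∈ S, Matrix.mulVecLin A v ∈ S := hA
  unfold traceOn
  rw [dif_pos hA1]
  let toS : (X → ℂ) →ₗ[ℂ] S := LinearMap.codRestrict S (Matrix.mulVecLin Q) (fun v => by
    rw [hS]; simp [hQ2])
  have h1 : (Matrix.mulVecLin A).restrict hA1 = toS ∘ₗ ((Matrix.mulVecLin A) ∘ₗ S.subtype) := by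
    apply LinearMap.ext
    intro v
    apply Subtype.ext
    simp only [LinearMap.coe_restrict_apply, LinearMap.comp_apply, toS, LinearMap.codRestrict_apply]
    exact ((hS _).1 (hA1 v v.2)).symm
  rw [h1, LinearMap.trace_comp_comm']
  have h2 : ((Matrix.mulVecLin A) ∘ₗ S.subtype) ∘ₗ toS = Matrix.toLin' (A * Q) := by
    apply LinearMap.ext
    intro v
    simp [toS]
  rw [h2, Matrix.trace_toLin'_eq]

end Proj
end GreenII

namespace GreenII

/-! ### Part B: basic matrices on the tensor space -/

section Basic
open Matrix
variable {e n d : ℕ} [NeZero e] {m : ZMod e → ℕ}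

lemma bidx_ext {b b' : BIdx e m} (h1 : b.1 = b'.1) (h2 : b.2.val = b'.2.val) : b = b' := by
  obtain ⟨k, i⟩ := b
  obtain ⟨k', i'⟩ := b'
  obtain rfl : k = k' := h1
  congr 1
  exact Fin.ext h2

lemma tauB_inj (hm : ∀ k, m (k + (d : ZMod e)) = m k) : Function.Injective (tauB e d m hm) := by
  intro b b' h
  have h1 := congrArg (fun x : BIdx e m => x.1) h
  have h2 := congrArg (fun x : BIdx e m => x.2.val) h
  simp [tauB] at h1 h2
  exact bidx_ext h1 h2

/-- `τ` as a permutation of the basis -/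
noncomputable def tE (e d : ℕ) [NeZero e] (m : ZMod e → ℕ)
    (hm : ∀ k, m (k + (d : ZMod e)) = m k) : Equiv.Perm (BIdx e m) :=
  Equiv.ofBijective _ (Finite.injective_iff_bijective.1 (tauB_inj hm))

lemma tE_fst (hm : ∀ k, m (k + (d : ZMod e)) = m k) (b : BIdx e m) :
    (tE e d m hm b).1 = b.1 + (d : ZMod e) := rfl

lemma tE_snd (hm : ∀ k, m (k + (d : ZMod e)) = m k) (b : BIdx e m) :
    (tE e d m hm b).2.val = b.2.val := rfl

lemma tE_pow_fst (hm : ∀ k, m (k + (d : ZMod e)) = m k) (j : ℕ) (b : BIdx e m) :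
    ((tE e d m hm ^ j) b).1 = b.1 + ((j * d : ℕ) : ZMod e) := by
  induction j generalizing b with
  | zero => simp
  | succ j ih => rw [pow_succ, Equiv.Perm.mul_apply, ih, tE_fst]; push_cast; ring

lemma tE_pow_snd (hm : ∀ k, m (k + (d : ZMod e)) = m k) (j : ℕ) (b : BIdx e m) :
    ((tE e d m hm ^ j) b).2.val = b.2.val := by
  induction j generalizing b with
  | zero => rfl
  | succ j ih => rw [pow_succ, Equiv.Perm.mul_apply, ih, tE_snd]

/-- the permutation matrix of `f` acting diagonally -/
noncomputable def permT (n : ℕ) (f : Equiv.Perm (BIdx e m)) :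
    Matrix (TIdx e n m) (TIdx e n m) ℂ := fun b' b => if b' = f ∘ b then 1 else 0

lemma permT_mul_apply (f : Equiv.Perm (BIdx e m)) (A : Matrix (TIdx e n m) (TIdx e n m) ℂ) (b' b) :
    (permT n f * A) b' b = A (f.symm ∘ b') b := by
  rw [Matrix.mul_apply, Finset.sum_eq_single (f.symm ∘ b')]
  · simp [permT, ← Function.comp_assoc]
  · intro c _ hc
    rw [permT, if_neg, zero_mul]
    rintro rfl
    exact hc (by simp [← Function.comp_assoc])
  · simp

lemma mul_permT_apply (f : Equiv.Perm (BIdx e m)) (A : Matrix (TIdx e n m) (TIdx e n m) ℂ) (b' b) :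
    (A * permT n f) b' b = A b' (f ∘ b) := by
  rw [Matrix.mul_apply, Finset.sum_eq_single (f ∘ b)]
  · simp [permT]
  · intro c _ hc
    rw [permT, if_neg hc, mul_zero]
  · simp

lemma permT_mulVec (f : Equiv.Perm (BIdx e m)) (v : TIdx e n m → ℂ) (b') :
    (permT n f *ᵥ v) b' = v (f.symm ∘ b') := by
  rw [Matrix.mulVec, dotProduct, Finset.sum_eq_single (f.symm ∘ b')]
  · simp [permT, ← Function.comp_assoc]
  · intro c _ hc
    rw [permT, if_neg, zero_mul]
    rintro rfl
    exact hc (by simp [← Function.comp_assoc])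
  · simp

lemma permT_mul (f g : Equiv.Perm (BIdx e m)) : permT n (f * g) = permT n f * permT n g := by
  ext b' b
  rw [permT_mul_apply]
  unfold permT
  congr 1
  apply propext
  constructor
  · rintro rfl; funext s; simp
  · intro h; funext s; have := congrFun h s; simp at this; rw [Equiv.symm_apply_eq] at this; exact this

lemma permT_one : permT n (1 : Equiv.Perm (BIdx e m)) = 1 := by
  ext b' b
  simp [permT, Matrix.one_apply]

lemma permT_pow (f : Equiv.Perm (BIdx e m)) (j : ℕ) : permT n (f ^ j) = permT n f ^ j := by
  induction j with
  | zero => simp [permT_one]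
  | succ j ih => rw [pow_succ, pow_succ, permT_mul, ih]

lemma permT_conj (f : Equiv.Perm (BIdx e m)) : (permT n f)ᴴ = permT n f⁻¹ := by
  ext b' b
  rw [Matrix.conjTranspose_apply]
  unfold permT
  have : (b = f ∘ b') ↔ (b' = ⇑(f⁻¹) ∘ b) := by
    constructor
    · rintro rfl; funext s; simp
    · rintro rfl; funext s; simp
  simp only [this]
  split_ifs <;> simp

lemma permT_inv_mul (f : Equiv.Perm (BIdx e m)) : permT n f⁻¹ * permT n f = 1 := by
  rw [← permT_mul]; simp [permT_one]

lemma permT_mul_inv (f : Equiv.Perm (BIdx e m)) : permT n f * permT n f⁻¹ = 1 := by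
  rw [← permT_mul]; simp [permT_one]

lemma tauMat_eq (hm : ∀ k, m (k + (d : ZMod e)) = m k) :
    tauMat e n d m hm = permT n (tE e d m hm) := by
  ext b' b
  unfold tauMat tensorPow permT tauV
  rw [Matrix.of_apply, Finset.prod_ite_zero]
  simp only [Finset.mem_univ, true_imp_iff, Finset.prod_const_one, funext_iff]
  rfl

lemma tensorPow_mul (g h : Matrix (BIdx e m) (BIdx e m) ℂ) :
    tensorPow e n m (g * h) = tensorPow e n m g * tensorPow e n m h := by
  ext b' b
  simp only [tensorPow, Matrix.of_apply, Matrix.mul_apply]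
  rw [Finset.prod_univ_sum]
  simp only [Fintype.piFinset_univ, Finset.prod_mul_distrib]

lemma tensorPow_one : tensorPow e n m (1 : Matrix (BIdx e m) (BIdx e m) ℂ) = 1 := by
  ext b' b
  simp only [tensorPow, Matrix.of_apply, Matrix.one_apply]
  rw [Finset.prod_ite_zero]
  simp [funext_iff]

lemma tensorPow_conj (g : Matrix (BIdx e m) (BIdx e m) ℂ) :
    (tensorPow e n m g)ᴴ = tensorPow e n m gᴴ := by
  ext b' b
  simp [tensorPow, Matrix.conjTranspose_apply]

lemma tensorPow_diag_apply (dv : BIdx e m → ℂ) :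
    tensorPow e n m (Matrix.diagonal dv) = Matrix.diagonal fun b => ∏ s, dv (b s) := by
  ext b' b
  simp only [tensorPow, Matrix.of_apply, Matrix.diagonal_apply]
  rw [Finset.prod_ite_zero]
  simp [funext_iff]

/-- the monomial coefficient of `w` -/
noncomputable def chi (ζ : ℂ) (w : Wt e n) (b : TIdx e n m) : ℂ :=
  ∏ s, ζ ^ (((w.left s).toAdd.val) * (b s).1.val)

lemma rho_mul_apply (ζ : ℂ) (w : Wt e n) (A : Matrix (TIdx e n m) (TIdx e n m) ℂ) (b' b) :
    (rhoMat e n ζ m w * A) b' b = chi ζ w b' * A (b' ∘ w.right) b := by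
  rw [Matrix.mul_apply, Finset.sum_eq_single (b' ∘ w.right)]
  · rw [rhoMat, if_pos]; rfl
    funext s; simp
  · intro c _ hc
    rw [rhoMat, if_neg, zero_mul]
    rintro rfl
    exact hc (by funext s; simp)
  · simp

lemma mul_rho_apply (ζ : ℂ) (w : Wt e n) (A : Matrix (TIdx e n m) (TIdx e n m) ℂ) (b' b) :
    (A * rhoMat e n ζ m w) b' b = A b' (b ∘ w.right.symm) * chi ζ w (b ∘ w.right.symm) := by
  rw [Matrix.mul_apply, Finset.sum_eq_single (b ∘ w.right.symm)]
  · rw [rhoMat, if_pos rfl]; rfl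
  · intro c _ hc
    rw [rhoMat, if_neg hc, mul_zero]
  · simp

lemma star_mul_self_root {ζ : ℂ} (hζ : IsPrimitiveRoot ζ e) (k : ℕ) : star (ζ ^ k) * ζ ^ k = 1 := by
  have h1 : ‖ζ ^ k‖ = 1 := by
    rw [norm_pow, hζ.norm'_eq_one (NeZero.ne e), one_pow]
  rw [mul_comm]
  have := Complex.mul_conj (ζ ^ k)
  rw [Complex.normSq_eq_norm_sq, h1] at this
  simpa using this

lemma chi_star_mul {ζ : ℂ} (hζ : IsPrimitiveRoot ζ e) (w : Wt e n) (b : TIdx e n m) :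
    star (chi ζ w b) * chi ζ w b = 1 := by
  unfold chi
  rw [star_prod, ← Finset.prod_mul_distrib]
  exact Finset.prod_eq_one fun s _ => star_mul_self_root hζ _

lemma rho_unitary {ζ : ℂ} (hζ : IsPrimitiveRoot ζ e) (w : Wt e n) :
    (rhoMat e n ζ m w)ᴴ * rhoMat e n ζ m w = 1 := by
  ext b' b
  rw [mul_rho_apply, Matrix.conjTranspose_apply, rhoMat]
  by_cases h : b' = b
  · subst h
    rw [if_pos rfl]
    simp only [Matrix.one_apply_eq]
    exact chi_star_mul hζ w _
  · rw [if_neg]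
    · simp [h]
    · intro h'
      apply h
      have := congrArg (fun f => f ∘ w.right) h'
      simpa [Function.comp_assoc] using this.symm

lemma rho_unitary' {ζ : ℂ} (hζ : IsPrimitiveRoot ζ e) (w : Wt e n) :
    rhoMat e n ζ m w * (rhoMat e n ζ m w)ᴴ = 1 :=
  mul_eq_one_comm.1 (rho_unitary hζ w)

lemma rho_comm_tensorPow (ζ : ℂ) (w : Wt e n) {g : Matrix (BIdx e m) (BIdx e m) ℂ}
    (hg : IsBlockDiag e m g) :
    rhoMat e n ζ m w * tensorPow e n m g = tensorPow e n m g * rhoMat e n ζ m w := by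
  ext b' b
  rw [rho_mul_apply, mul_rho_apply]
  simp only [tensorPow, Matrix.of_apply]
  have h1 : ∏ s, g ((b' ∘ ⇑w.right) s) (b s) = ∏ s, g (b' s) ((b ∘ ⇑w.right.symm) s) := by
    rw [← Equiv.prod_comp w.right (fun s => g (b' s) ((b ∘ ⇑w.right.symm) s))]
    simp
  rw [h1]
  by_cases h : ∀ s, (b' s).1 = ((b ∘ w.right.symm) s).1
  · have : chi ζ w b' = chi ζ w (b ∘ w.right.symm) := by
      unfold chi
      exact Finset.prod_congr rfl fun s _ => by rw [h s]
    rw [this, mul_comm]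
  · push Not at h
    obtain ⟨s, hs⟩ := h
    rw [Finset.prod_eq_zero (Finset.mem_univ s) (hg _ _ hs)]
    simp

/-- the total colour of `w` -/
def tot (w : Wt e n) : ℕ := ∑ s, (w.left s).toAdd.val

lemma root_pow_congr {ζ : ℂ} (hζ : IsPrimitiveRoot ζ e) {a c : ℕ}
    (h : (a : ZMod e) = (c : ZMod e)) : ζ ^ a = ζ ^ c := by
  rw [← pow_mod_orderOf ζ a, ← pow_mod_orderOf ζ c, ← hζ.eq_orderOf]
  congr 1
  exact (ZMod.natCast_eq_natCast_iff _ _ _).1 h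

lemma pow_val_add {ζ : ℂ} (hζ : IsPrimitiveRoot ζ e) (a k : ZMod e) (c : ℕ) :
    ζ ^ (a.val * (k + (c : ZMod e)).val) = ζ ^ (a.val * c) * ζ ^ (a.val * k.val) := by
  rw [← pow_add]
  apply root_pow_congr hζ
  push_cast
  simp
  ring

lemma rho_tau {ζ : ℂ} (hζ : IsPrimitiveRoot ζ e) (hm : ∀ k, m (k + (d : ZMod e)) = m k)
    (w : Wt e n) (j : ℕ) :
    rhoMat e n ζ m w * permT n (tE e d m hm ^ j)
      = ζ ^ (tot w * (j * d)) • (permT n (tE e d m hm ^ j) * rhoMat e n ζ m w) := by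
  ext b' b
  rw [rho_mul_apply, Matrix.smul_apply, permT_mul_apply]
  simp only [permT, rhoMat, smul_eq_mul]
  by_cases h : b' = ⇑(tE e d m hm ^ j) ∘ b ∘ ⇑w.right.symm
  · rw [if_pos, if_pos]
    · rw [mul_one]
      unfold chi tot
      rw [Finset.sum_mul, ← Finset.prod_pow_eq_pow_sum, ← Finset.prod_mul_distrib]
      refine Finset.prod_congr rfl fun s _ => ?_
      have h2 : b' s = (tE e d m hm ^ j) (((tE e d m hm ^ j).symm ∘ b') s) := by simp
      rw [h2, tE_pow_fst, pow_val_add hζ]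
    · rw [h]; funext s; simp
    · rw [h]; funext s; simp
  · rw [if_neg, if_neg]
    · simp
    · intro h'; apply h
      rw [← h']; funext s; simp
    · intro h'; apply h
      have := congrArg (fun f => f ∘ w.right.symm) h'
      simp only [Function.comp_assoc] at this
      rw [← this]; funext s; simp

/-- block-diagonal unipotent/diagonal facts -/
lemma IsUpperUni.block {g : Matrix (BIdx e m) (BIdx e m) ℂ} (hg : IsUpperUni e m g) :
    IsBlockDiag e m g := fun b b' h =>
  hg.2 b b' (fun h' => h (by rw [h'])) (fun h' => h h'.1)

end Basic
end GreenII

namespace GreenII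

/-! ### Part C: averaging and orthogonality -/

section Avg
open Matrix
variable {e n d : ℕ} [NeZero e] {m : ZMod e → ℕ}

lemma sum_wt (F : Wt e n → ℂ) : ∑ w, F w = ∑ a : NC e n, ∑ x : Equiv.Perm (Fin n), F ⟨a, x⟩ := by
  rw [← Fintype.sum_prod_type']
  symm
  apply Fintype.sum_bijective (fun y : NC e n × Equiv.Perm (Fin n) => (⟨y.1, y.2⟩ : Wt e n))
  · constructor
    · rintro ⟨a, x⟩ ⟨a', x'⟩ h
      simpa [SemidirectProduct.ext_iff] using h
    · rintro ⟨a, x⟩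
      exact ⟨(a, x), rfl⟩
  · intro y; rfl

lemma root_orth {ζ : ℂ} (hζ : IsPrimitiveRoot ζ e) (k k' : ZMod e) :
    ∑ a : ZMod e, ζ ^ (a.val * k.val) * star (ζ ^ (a.val * k'.val)) = if k = k' then (e : ℂ) else 0 := by
  split_ifs with h
  · subst h
    have h0 : ∀ a : ZMod e, ζ ^ (a.val * k.val) * star (ζ ^ (a.val * k.val)) = 1 := by
      intro a
      rw [mul_comm]
      exact star_mul_self_root hζ _
    rw [Finset.sum_congr rfl fun a _ => h0 a]
    simp [ZMod.card]
  · have h1 : ∀ a : ZMod e, ζ ^ (a.val * k.val) * star (ζ ^ (a.val * k'.val)) = (ζ ^ ((k - k').val)) ^ a.val := by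
      intro a
      have : ζ ^ (a.val * k.val) = ζ ^ ((k - k').val * a.val) * ζ ^ (a.val * k'.val) := by
        rw [← pow_add]
        apply root_pow_congr hζ
        push_cast; simp; ring
      rw [this, mul_assoc, mul_comm _ (star _), star_mul_self_root hζ, mul_one, pow_mul]
    rw [Finset.sum_congr rfl fun a _ => h1 a]
    have h2 : ∑ a : ZMod e, (ζ ^ ((k - k').val)) ^ a.val = ∑ i ∈ Finset.range e, (ζ ^ ((k - k').val)) ^ i := by
      rw [← Fin.sum_univ_eq_sum_range]
      obtain ⟨e', rfl⟩ := Nat.exists_eq_succ_of_ne_zero (NeZero.ne e)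
      rfl
    rw [h2]
    have h3 : ζ ^ ((k - k').val) ≠ 1 := by
      intro h4
      rw [hζ.pow_eq_one_iff_dvd] at h4
      have h5 := ZMod.val_lt (k - k')
      have h6 := Nat.eq_zero_of_dvd_of_lt h4 h5
      rw [ZMod.val_eq_zero, sub_eq_zero] at h6
      exact h h6
    have h4 := mul_geom_sum (ζ ^ ((k - k').val)) e
    rw [← pow_mul, mul_comm _ e, pow_mul, hζ.pow_eq_one, one_pow, sub_self] at h4
    exact (mul_eq_zero.1 h4).resolve_left (sub_ne_zero.2 h3)

lemma chi_orth {ζ : ℂ} (hζ : IsPrimitiveRoot ζ e) (x : Equiv.Perm (Fin n)) (b c : TIdx e n m) :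
    ∑ a : NC e n, chi ζ (⟨a, x⟩ : Wt e n) b * star (chi ζ (⟨a, x⟩ : Wt e n) c)
      = if ∀ s, (b s).1 = (c s).1 then (e : ℂ) ^ n else 0 := by
  have h1 : ∀ a : NC e n, chi ζ (⟨a, x⟩ : Wt e n) b * star (chi ζ (⟨a, x⟩ : Wt e n) c)
      = ∏ s, (fun (s : Fin n) (a : Multiplicative (ZMod e)) =>
          ζ ^ (a.toAdd.val * (b s).1.val) * star (ζ ^ (a.toAdd.val * (c s).1.val))) s (a s) := by
    intro a
    unfold chi
    rw [star_prod, ← Finset.prod_mul_distrib]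
  rw [Finset.sum_congr rfl fun a _ => h1 a]
  have h2 := (Finset.prod_univ_sum (fun _ : Fin n => (Finset.univ : Finset (Multiplicative (ZMod e))))
    (fun (s : Fin n) (a : Multiplicative (ZMod e)) =>
          ζ ^ (a.toAdd.val * (b s).1.val) * star (ζ ^ (a.toAdd.val * (c s).1.val)))).symm
  rw [Fintype.piFinset_univ] at h2
  rw [h2]
  have h3 : ∀ s : Fin n, ∑ a : Multiplicative (ZMod e),
      ζ ^ (a.toAdd.val * (b s).1.val) * star (ζ ^ (a.toAdd.val * (c s).1.val))
      = if (b s).1 = (c s).1 then (e : ℂ) else 0 := by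
    intro s
    rw [← root_orth hζ]
    exact Fintype.sum_equiv Multiplicative.toAdd _ _ (fun _ => rfl)
  rw [Finset.prod_congr rfl fun s _ => h3 s, Finset.prod_ite_zero]
  simp

/-- the commutant of `W̃`, described explicitly -/
def InComm (C : Matrix (TIdx e n m) (TIdx e n m) ℂ) : Prop :=
  (∀ b c, ¬ (∀ s, (b s).1 = (c s).1) → C b c = 0) ∧
    ∀ (x : Equiv.Perm (Fin n)) b c, C (b ∘ x) (c ∘ x) = C b c

noncomputable def avg (ζ : ℂ) (Y : Matrix (TIdx e n m) (TIdx e n m) ℂ) :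
    Matrix (TIdx e n m) (TIdx e n m) ℂ :=
  ∑ w : Wt e n, rhoMat e n ζ m w * Y * (rhoMat e n ζ m w)ᴴ

lemma conj_rho_apply (ζ : ℂ) (w : Wt e n) (Y : Matrix (TIdx e n m) (TIdx e n m) ℂ) (b c) :
    (rhoMat e n ζ m w * Y * (rhoMat e n ζ m w)ᴴ) b c
      = chi ζ w b * star (chi ζ w c) * Y (b ∘ w.right) (c ∘ w.right) := by
  have h : (rhoMat e n ζ m w * Y * (rhoMat e n ζ m w)ᴴ) b c
      = star ((rhoMat e n ζ m w * (rhoMat e n ζ m w * Y)ᴴ) c b) := by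
    rw [← Matrix.conjTranspose_apply, Matrix.conjTranspose_mul, Matrix.conjTranspose_conjTranspose]
  rw [h, rho_mul_apply, Matrix.conjTranspose_apply, rho_mul_apply]
  simp
  ring

lemma avg_apply {ζ : ℂ} (hζ : IsPrimitiveRoot ζ e) (Y : Matrix (TIdx e n m) (TIdx e n m) ℂ) (b c) :
    avg ζ Y b c = (if ∀ s, (b s).1 = (c s).1 then (e : ℂ) ^ n else 0) *
      ∑ x : Equiv.Perm (Fin n), Y (b ∘ x) (c ∘ x) := by
  unfold avg
  rw [Matrix.sum_apply]
  simp only [conj_rho_apply]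
  rw [sum_wt, Finset.sum_comm, Finset.mul_sum]
  refine Finset.sum_congr rfl fun x _ => ?_
  rw [← chi_orth hζ x, Finset.sum_mul]

lemma avg_inComm {ζ : ℂ} (hζ : IsPrimitiveRoot ζ e) (Y : Matrix (TIdx e n m) (TIdx e n m) ℂ) :
    InComm (avg ζ Y) := by
  constructor
  · intro b c h
    rw [avg_apply hζ, if_neg h, zero_mul]
  · intro x b c
    rw [avg_apply hζ, avg_apply hζ]
    congr 1
    · congr 1
      apply propext
      constructor
      · intro h s; simpa using h (x.symm s)
      · intro h s; exact h _
    · rw [← Equiv.sum_comp (Equiv.mulLeft x) (fun y : Equiv.Perm (Fin n) => Y (b ∘ y) (c ∘ y))]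
      rfl

lemma trace_avg_mul {ζ : ℂ} (hζ : IsPrimitiveRoot ζ e) (Y Q : Matrix (TIdx e n m) (TIdx e n m) ℂ)
    (hQ : ∀ w : Wt e n, rhoMat e n ζ m w * Q = Q * rhoMat e n ζ m w) :
    Matrix.trace (avg ζ Y * Q) = (Fintype.card (Wt e n) : ℂ) * Matrix.trace (Y * Q) := by
  unfold avg
  rw [Finset.sum_mul, Matrix.trace_sum]
  rw [Finset.sum_congr rfl (g := fun _ => Matrix.trace (Y * Q))]
  · simp [Finset.card_univ]
  · intro w _
    have : rhoMat e n ζ m w * Y * (rhoMat e n ζ m w)ᴴ * Q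
      = rhoMat e n ζ m w * (Y * ((rhoMat e n ζ m w)ᴴ * Q)) := by simp only [Matrix.mul_assoc]
    rw [this, Matrix.trace_mul_comm, Matrix.mul_assoc, Matrix.mul_assoc, ← hQ w,
      ← Matrix.mul_assoc _ (rhoMat e n ζ m w) Q, rho_unitary hζ, Matrix.one_mul]

lemma single_mid {ι : Type*} [Fintype ι] [DecidableEq ι] (M N : Matrix ι ι ℂ) (x y : ι) :
    (M * Matrix.single x y (1:ℂ) * N) x y = M x x * N y y := by
  rw [Matrix.mul_assoc, Matrix.mul_apply, Finset.sum_eq_single x]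
  · rw [Matrix.single_mul_apply_same]; simp
  · intro z _ hz
    rw [Matrix.single_mul_apply_of_ne]; simp
    exact hz
  · simp

/-- twisted inner product -/
noncomputable def ip (φ ψ : Wt e n → ℂ) : ℂ := ∑ w, φ w * star (ψ w)

lemma ip_trace {ζ : ℂ} (P Q T : Matrix (TIdx e n m) (TIdx e n m) ℂ) (hQ : Qᴴ = Q) :
    ip (fun w => Matrix.trace (P * (rhoMat e n ζ m w * T)))
       (fun w => Matrix.trace (Q * (rhoMat e n ζ m w * T)))
      = ∑ x : TIdx e n m, ∑ y : TIdx e n m, (P * avg ζ (T * Matrix.single x y (1:ℂ) * Tᴴ) * Q : Matrix (TIdx e n m) (TIdx e n m) ℂ) x y := by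
  have h1 : ∀ w : Wt e n, Matrix.trace (P * (rhoMat e n ζ m w * T)) *
      star (Matrix.trace (Q * (rhoMat e n ζ m w * T)))
      = ∑ x : TIdx e n m, ∑ y : TIdx e n m, (P * (rhoMat e n ζ m w * (T * Matrix.single x y (1:ℂ) * Tᴴ) * (rhoMat e n ζ m w)ᴴ) * Q : Matrix (TIdx e n m) (TIdx e n m) ℂ) x y := by
    intro w
    rw [← Matrix.trace_conjTranspose, Matrix.conjTranspose_mul, Matrix.conjTranspose_mul, hQ,
      Matrix.trace, Matrix.trace, Finset.sum_mul_sum]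
    refine Finset.sum_congr rfl fun x _ => Finset.sum_congr rfl fun y _ => ?_
    have h2 : P * (rhoMat e n ζ m w * (T * Matrix.single x y (1:ℂ) * Tᴴ) * (rhoMat e n ζ m w)ᴴ) * Q
      = (P * (rhoMat e n ζ m w * T)) * Matrix.single x y 1 * (Tᴴ * (rhoMat e n ζ m w)ᴴ * Q) := by
      simp only [Matrix.mul_assoc]
    rw [h2, single_mid]
    rw [← Matrix.mul_assoc]
    rfl
  unfold ip
  rw [Finset.sum_congr rfl fun w _ => h1 w, Finset.sum_comm]
  refine Finset.sum_congr rfl fun x _ => ?_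
  rw [Finset.sum_comm]
  refine Finset.sum_congr rfl fun y _ => ?_
  unfold avg
  rw [Finset.mul_sum, Finset.sum_mul, Matrix.sum_apply]

lemma ip_trace_zero {ζ : ℂ} (hζ : IsPrimitiveRoot ζ e)
    (P Q T : Matrix (TIdx e n m) (TIdx e n m) ℂ) (hQ : Qᴴ = Q)
    (h : ∀ C, InComm C → P * C * Q = 0) :
    ip (fun w => Matrix.trace (P * (rhoMat e n ζ m w * T)))
       (fun w => Matrix.trace (Q * (rhoMat e n ζ m w * T))) = 0 := by
  rw [ip_trace P Q T hQ]
  refine Finset.sum_eq_zero fun x _ => Finset.sum_eq_zero fun y _ => ?_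
  rw [h _ (avg_inComm hζ _)]
  rfl

lemma ip_trace_one {ζ : ℂ} (hζ : IsPrimitiveRoot ζ e)
    (P Q T : Matrix (TIdx e n m) (TIdx e n m) ℂ) (hQ : Qᴴ = Q) (hQ2 : Q * Q = Q)
    (hPQ : Q * P = Q) (hQ0 : Matrix.trace Q ≠ 0)
    (hQU : ∀ w : Wt e n, rhoMat e n ζ m w * Q = Q * rhoMat e n ζ m w)
    (hTQ : T * Q = Q * T) (hT : Tᴴ * T = 1)
    (h : ∀ C, InComm C → P * C * Q = (Matrix.trace (P * C * Q) / Matrix.trace Q) • Q) :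
    ip (fun w => Matrix.trace (P * (rhoMat e n ζ m w * T)))
       (fun w => Matrix.trace (Q * (rhoMat e n ζ m w * T))) = Fintype.card (Wt e n) := by
  rw [ip_trace P Q T hQ]
  have h1 : ∀ C, InComm C → Matrix.trace (P * C * Q) = Matrix.trace (C * Q) := by
    intro C hC
    have h2 := congrArg (fun M => Matrix.trace (Q * M)) (h C hC)
    simp only [Matrix.mul_smul, Matrix.trace_smul, hQ2, smul_eq_mul, div_mul_cancel₀ _ hQ0] at h2
    rw [← h2, ← Matrix.mul_assoc, ← Matrix.mul_assoc, hPQ, Matrix.trace_mul_comm, ← Matrix.mul_assoc, hQ2,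
      Matrix.trace_mul_comm]
  have h3 : ∀ x y : TIdx e n m, (P * avg ζ (T * Matrix.single x y (1:ℂ) * Tᴴ) * Q : Matrix (TIdx e n m) (TIdx e n m) ℂ) x y
      = (Fintype.card (Wt e n) : ℂ) / Matrix.trace Q * (Q y x * Q x y) := by
    intro x y
    rw [h _ (avg_inComm hζ _), h1 _ (avg_inComm hζ _), trace_avg_mul hζ _ _ hQU]
    have h4 : Matrix.trace (T * Matrix.single x y (1:ℂ) * Tᴴ * Q) = Q y x := by
      have hTQ' : Tᴴ * Q = Q * Tᴴ := by
        have := congrArg Matrix.conjTranspose hTQ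
        simpa [Matrix.conjTranspose_mul, hQ] using this.symm
      rw [Matrix.mul_assoc, hTQ', Matrix.mul_assoc, Matrix.trace_mul_comm, Matrix.mul_assoc,
        Matrix.mul_assoc, hT, Matrix.mul_one, Matrix.trace_mul_comm, Matrix.trace_mul_single]
      simp
    rw [h4, Matrix.smul_apply, smul_eq_mul]
    ring
  simp only [h3, ← Finset.mul_sum]
  have h5 : ∑ x, ∑ y, Q y x * Q x y = Matrix.trace Q := by
    conv_rhs => rw [← hQ2]
    rw [Matrix.trace]
    simp only [Matrix.diag_apply, Matrix.mul_apply]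
    exact Finset.sum_congr rfl fun x _ => Finset.sum_congr rfl fun y _ => mul_comm _ _
  rw [h5, div_mul_cancel₀ _ hQ0]

end Avg
end GreenII

namespace GreenII

/-! ### Part D: density of `LDU` products -/
section Dens
open Matrix
open scoped ComplexOrder

lemma ldl_fin (N : ℕ) (S : Matrix (Fin N) (Fin N) ℂ) (hS : S.PosDef) :
    ∃ (L : Matrix (Fin N) (Fin N) ℂ) (dv : Fin N → ℂ),
      (∀ i, L i i = 1) ∧ (∀ i j, i < j → L i j = 0) ∧ S = L * Matrix.diagonal dv * Lᴴ := by
  have h0 := LDL.lower_conj_diag hS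
  have hI : (LDL.lowerInv hS).BlockTriangular OrderDual.toDual := by
    intro i j hij
    exact LDL.lowerInv_triangular hS hij
  have hL : (LDL.lower hS).BlockTriangular OrderDual.toDual :=
    Matrix.blockTriangular_inv_of_blockTriangular hI
  have hu : IsUnit (LDL.lower hS) := by
    unfold LDL.lower
    exact isUnit_of_invertible _
  have hdet : (LDL.lower hS).det ≠ 0 := by
    rw [Matrix.isUnit_iff_isUnit_det] at hu
    exact hu.ne_zero
  rw [Matrix.det_of_isLowerTriangular _ hL, Finset.prod_ne_zero_iff] at hdet
  set K := LDL.lower hS with hK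
  set D1 : Matrix (Fin N) (Fin N) ℂ := Matrix.diagonal fun i => K i i
  set D1' : Matrix (Fin N) (Fin N) ℂ := Matrix.diagonal fun i => (K i i)⁻¹
  have hDD : D1' * D1 = 1 := by
    rw [Matrix.diagonal_mul_diagonal, ← Matrix.diagonal_one]
    congr 1; funext i
    exact inv_mul_cancel₀ (hdet i (Finset.mem_univ _))
  refine ⟨K * D1', fun i => K i i * LDL.diagEntries hS i * star (K i i), ?_, ?_, ?_⟩
  · intro i
    rw [Matrix.mul_diagonal]
    exact mul_inv_cancel₀ (hdet i (Finset.mem_univ _))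
  · intro i j hij
    rw [Matrix.mul_diagonal, hL hij, zero_mul]
  · have h1 : (Matrix.diagonal fun i => K i i * LDL.diagEntries hS i * star (K i i))
      = D1 * LDL.diag hS * D1ᴴ := by
      unfold LDL.diag
      rw [Matrix.diagonal_conjTranspose, Matrix.diagonal_mul_diagonal, Matrix.diagonal_mul_diagonal]
      rfl
    have h2 : K * D1' * (D1 * LDL.diag hS * D1ᴴ) * (K * D1')ᴴ
       = K * (D1' * D1) * LDL.diag hS * (K * (D1' * D1))ᴴ := by
      simp only [Matrix.conjTranspose_mul, Matrix.mul_assoc]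
    rw [h1, h2, hDD, Matrix.mul_one, h0]

lemma posDef_shift {N : ℕ} (H : Matrix (Fin N) (Fin N) ℂ) (hH : H.IsHermitian) :
    ∃ K : ℝ, ∀ c : ℝ, K < c → ((c : ℂ) • (1 : Matrix (Fin N) (Fin N) ℂ) + H).PosDef := by
  refine ⟨∑ i, |hH.eigenvalues i|, fun c hc => ?_⟩
  have h1 := hH.spectral_theorem
  rw [Unitary.conjStarAlgAut_apply] at h1
  set U := hH.eigenvectorUnitary
  have h2 : (c : ℂ) • (1 : Matrix (Fin N) (Fin N) ℂ) + H
      = (U : Matrix (Fin N) (Fin N) ℂ) * Matrix.diagonal (fun i => ((c + hH.eigenvalues i : ℝ) : ℂ)) * star (U : Matrix (Fin N) (Fin N) ℂ) := by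
    have h3 : Matrix.diagonal (fun i => ((c + hH.eigenvalues i : ℝ) : ℂ))
      = (c : ℂ) • (1 : Matrix (Fin N) (Fin N) ℂ) + Matrix.diagonal (RCLike.ofReal ∘ hH.eigenvalues) := by
      rw [Matrix.smul_one_eq_diagonal, Matrix.diagonal_add]
      congr 1; funext i; simp
    rw [h3, Matrix.mul_add, Matrix.add_mul, ← h1]
    congr 1
    rw [Matrix.mul_smul, Matrix.mul_one, Matrix.smul_mul]
    simp
  rw [h2, Matrix.IsUnit.posDef_star_right_conjugate_iff (Unitary.isUnit_coe)]
  apply Matrix.PosDef.diagonal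
  intro i
  have h4 : |hH.eigenvalues i| ≤ ∑ i, |hH.eigenvalues i| :=
    Finset.single_le_sum (f := fun i => |hH.eigenvalues i|) (fun _ _ => abs_nonneg _) (Finset.mem_univ i)
  have h5 := neg_abs_le (hH.eigenvalues i)
  have : 0 < c + hH.eigenvalues i := by linarith
  exact_mod_cast this

end Dens
end GreenII

namespace GreenII
section Dens2
open Matrix
open scoped ComplexOrder
variable {e n d : ℕ} [NeZero e] {m : ZMod e → ℕ}

lemma lin_expand {X : Type*} [Fintype X] (ℓ : Matrix X X ℂ →ₗ[ℂ] ℂ) (M : Matrix X X ℂ) :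
    ℓ M = ∑ x, ∑ y, M x y * ℓ (Matrix.single x y 1) := by
  conv_lhs => rw [Matrix.matrix_eq_sum_single M]
  simp only [map_sum]
  refine Finset.sum_congr rfl fun x _ => Finset.sum_congr rfl fun y _ => ?_
  rw [← smul_eq_mul, ← map_smul, Matrix.smul_single, smul_eq_mul, mul_one]

lemma poly_line (ℓ : Matrix (TIdx e n m) (TIdx e n m) ℂ →ₗ[ℂ] ℂ) (A Y : Matrix (BIdx e m) (BIdx e m) ℂ)
    (s : Set ℂ) (hs : s.Infinite) (h : ∀ c ∈ s, ℓ (tensorPow e n m (c • A + Y)) = 0) (c : ℂ) :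
    ℓ (tensorPow e n m (c • A + Y)) = 0 := by
  let P : Polynomial ℂ := ∑ x : TIdx e n m, ∑ y : TIdx e n m,
    (∏ t, (Polynomial.X * Polynomial.C (A (x t) (y t)) + Polynomial.C (Y (x t) (y t)))) * Polynomial.C (ℓ (Matrix.single x y 1))
  have hP : ∀ c, P.eval c = ℓ (tensorPow e n m (c • A + Y)) := by
    intro c
    rw [lin_expand]
    simp only [P, Polynomial.eval_finsetSum, Polynomial.eval_mul, Polynomial.eval_prod,
      Polynomial.eval_add, Polynomial.eval_X, Polynomial.eval_C]
    refine Finset.sum_congr rfl fun x _ => Finset.sum_congr rfl fun y _ => ?_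
    congr 1
    congr!
  have : P = 0 := Polynomial.eq_zero_of_infinite_isRoot P (hs.mono fun c hc => by
    rw [Set.mem_ofPred_eq, Polynomial.IsRoot, hP, h c hc])
  rw [← hP, this, Polynomial.eval_zero]

lemma infinite_gt (K : ℝ) : Set.Infinite {c : ℂ | ∃ x : ℝ, K < x ∧ c = x} := by
  have h1 : (Set.Ioi K).Infinite := Set.Ioi_infinite K
  have h2 := h1.image (f := fun x : ℝ => (x : ℂ)) (fun x _ y _ h => by simpa using h)
  refine h2.mono ?_
  rintro _ ⟨x, hx, rfl⟩
  exact ⟨x, hx, rfl⟩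

lemma conj_upper {l : Matrix (BIdx e m) (BIdx e m) ℂ} (h1 : ∀ b, l b b = 1)
  (h2 : ∀ b b' : BIdx e m, b ≠ b' → ¬(b.1 = b'.1 ∧ b'.2.val < b.2.val) → l b b' = 0) : IsUpperUni e m lᴴ := by
  constructor
  · intro b; rw [Matrix.conjTranspose_apply, h1, star_one]
  · intro b b' hb h
    rw [Matrix.conjTranspose_apply, h2 _ _ hb.symm, star_zero]
    intro h3
    exact h ⟨h3.1.symm, h3.2⟩

/-- vanishing principle, dense part -/
lemma vanish_block (ℓ : Matrix (TIdx e n m) (TIdx e n m) ℂ →ₗ[ℂ] ℂ)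
    (h : ∀ (u l : Matrix (BIdx e m) (BIdx e m) ℂ) (dv : BIdx e m → ℂ), IsUpperUni e m u → IsUpperUni e m lᴴ →
      ℓ (tensorPow e n m (l * Matrix.diagonal dv * u)) = 0)
    (g : ∀ k : ZMod e, Matrix (Fin (m k)) (Fin (m k)) ℂ) :
    ℓ (tensorPow e n m (Matrix.blockDiagonal' g)) = 0 := by
  -- positive definite case
  have hpos : ∀ g : ∀ k : ZMod e, Matrix (Fin (m k)) (Fin (m k)) ℂ, (∀ k, (g k).PosDef) →
      ℓ (tensorPow e n m (Matrix.blockDiagonal' g)) = 0 := by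
    intro g hg
    choose L dv hL1 hL2 hL3 using fun k => ldl_fin (m k) (g k) (hg k)
    have h1 : Matrix.blockDiagonal' g = Matrix.blockDiagonal' L * Matrix.diagonal (fun b : BIdx e m => dv b.1 b.2)
        * (Matrix.blockDiagonal' L)ᴴ := by
      have h2 : g = fun k => L k * Matrix.diagonal (dv k) * (L k)ᴴ := funext hL3
      rw [h2, Matrix.blockDiagonal'_mul, Matrix.blockDiagonal'_mul, Matrix.blockDiagonal'_conjTranspose,
        Matrix.blockDiagonal'_diagonal]
    have hup : IsUpperUni e m (Matrix.blockDiagonal' L)ᴴ := by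
      apply conj_upper
      · rintro ⟨k, i⟩; rw [Matrix.blockDiagonal'_apply_eq, hL1]
      · rintro ⟨k, i⟩ ⟨k', i'⟩ hne hlt
        by_cases hk : k = k'
        · subst hk
          rw [Matrix.blockDiagonal'_apply_eq]
          apply hL2
          simp at hlt hne
          exact lt_of_le_of_ne hlt hne
        · exact Matrix.blockDiagonal'_apply_ne _ _ _ hk
    rw [h1]
    exact h _ _ _ hup hup
  -- hermitian case
  have hherm : ∀ g : ∀ k : ZMod e, Matrix (Fin (m k)) (Fin (m k)) ℂ, (∀ k, (g k).IsHermitian) →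
      ℓ (tensorPow e n m (Matrix.blockDiagonal' g)) = 0 := by
    intro g hg
    choose K hK using fun k => posDef_shift (g k) (hg k)
    have h1 := poly_line ℓ 1 (Matrix.blockDiagonal' g) _ (infinite_gt (∑ k, |K k|)) (by
      rintro _ ⟨x, hx, rfl⟩
      have h2 : (x : ℂ) • (1 : Matrix (BIdx e m) (BIdx e m) ℂ) + Matrix.blockDiagonal' g
        = Matrix.blockDiagonal' (fun k => (x : ℂ) • (1 : Matrix (Fin (m k)) (Fin (m k)) ℂ) + g k) := by
        have h3 := Matrix.blockDiagonal'_add (fun k => (x : ℂ) • (1 : Matrix (Fin (m k)) (Fin (m k)) ℂ)) g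
        have h4 := Matrix.blockDiagonal'_smul (x : ℂ) (fun k => (1 : Matrix (Fin (m k)) (Fin (m k)) ℂ))
        have h5 := Matrix.blockDiagonal'_one (α := ℂ) (m' := fun k : ZMod e => Fin (m k))
        exact ((h3.trans (by congr 1; exact h4.trans (by congr 1)))).symm
      rw [h2]
      apply hpos
      intro k
      apply hK
      refine lt_of_le_of_lt ?_ hx
      exact (le_abs_self _).trans (Finset.single_le_sum (f := fun k => |K k|) (fun _ _ => abs_nonneg _) (Finset.mem_univ k))) 0
    simpa using h1
  -- general case
  have h1 := poly_line ℓ (Matrix.blockDiagonal' fun k => ((1/2 : ℂ) * (-Complex.I)) • (g k - (g k)ᴴ))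
    (Matrix.blockDiagonal' fun k => (1/2 : ℂ) • (g k + (g k)ᴴ)) _ (infinite_gt 0) (by
      rintro _ ⟨x, hx, rfl⟩
      rw [← Matrix.blockDiagonal'_smul, ← Matrix.blockDiagonal'_add]
      apply hherm
      intro k
      unfold Matrix.IsHermitian
      ext a b
      simp
      ring) Complex.I
  rw [← Matrix.blockDiagonal'_smul, ← Matrix.blockDiagonal'_add] at h1
  rw [← h1]
  congr 3
  funext k
  ext a b
  simp
  linear_combination (1/2)* (g k a b - (starRingEnd ℂ) (g k b a)) * Complex.I_mul_I

end Dens2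
end GreenII

namespace GreenII

/-! ### Part E: types of words, commutant -/
section Types
variable {n : ℕ} {P : Type*}

/-- the type (content) of a word -/
noncomputable def ty (c : Fin n → P) : P →₀ ℕ := ∑ s, Finsupp.single (c s) 1

lemma ty_apply (c : Fin n → P) (p : P) : ty c p = (Finset.univ.filter fun s => c s = p).card := by
  unfold ty
  rw [Finsupp.finsetSum_apply, Finset.card_filter]
  refine Finset.sum_congr rfl fun s _ => ?_
  rw [Finsupp.single_apply]

lemma ty_comp (c : Fin n → P) (π : Equiv.Perm (Fin n)) : ty (c ∘ π) = ty c :=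
  Equiv.sum_comp π fun s => Finsupp.single (c s) 1

lemma exists_perm_of_ty {c c' : Fin n → P} (h : ty c = ty c') : ∃ π : Equiv.Perm (Fin n), c' ∘ π = c := by
  have h1 : ∀ p, Nonempty ({s // c s = p} ≃ {s // c' s = p}) := by
    intro p
    have := DFunLike.congr_fun h p
    rw [ty_apply, ty_apply, ← Fintype.card_subtype, ← Fintype.card_subtype] at this
    exact ⟨Fintype.equivOfCardEq this⟩
  let E : ∀ p, {s // c s = p} ≃ {s // c' s = p} := fun p => Classical.choice (h1 p)
  refine ⟨Equiv.ofFiberEquiv E, ?_⟩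
  funext s
  exact Equiv.ofFiberEquiv_map E s

lemma prod_ty [Fintype P] (c : Fin n → P) (x : P → ℂ) : ∏ s, x (c s) = ∏ p, x p ^ (ty c p) := by
  simp only [ty_apply]
  rw [← Finset.prod_fiberwise_of_maps_to (s := Finset.univ) (t := Finset.univ) (g := c) (fun _ _ => Finset.mem_univ _)]
  refine Finset.prod_congr rfl fun p _ => ?_
  rw [Finset.prod_congr rfl (g := fun _ => x p), Finset.prod_const]
  intro s hs
  rw [(Finset.mem_filter.1 hs).2]

end Types

section Comm
open Matrix
variable {e n d : ℕ} [NeZero e] {m : ZMod e → ℕ}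

/-- pairs of basis indices of the same colour -/
abbrev Pr (e : ℕ) [NeZero e] (m : ZMod e → ℕ) := {ab : BIdx e m × BIdx e m // ab.1.1 = ab.2.1}

lemma sum_pairs (F : TIdx e n m → TIdx e n m → ℂ)
    (hF : ∀ b c, ¬ (∀ s, (b s).1 = (c s).1) → F b c = 0) :
    ∑ b, ∑ c, F b c = ∑ c : Fin n → Pr e m, F (fun s => (c s).1.1) (fun s => (c s).1.2) := by
  rw [← Fintype.sum_prod_type']
  symm
  apply Fintype.sum_of_injective (fun c : Fin n → Pr e m => ((fun s => (c s).1.1, fun s => (c s).1.2) : TIdx e n m × TIdx e n m))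
  · intro c c' h
    simp only [Prod.mk.injEq, funext_iff] at h
    funext s
    apply Subtype.ext
    apply Prod.ext
    · exact h.1 s
    · exact h.2 s
  · rintro ⟨b, c⟩ hi
    apply hF
    intro h
    exact hi ⟨fun s => ⟨(b s, c s), h s⟩, rfl⟩
  · intro c; rfl

lemma comm_vanish (ℓ : Matrix (TIdx e n m) (TIdx e n m) ℂ →ₗ[ℂ] ℂ)
    (h : ∀ g : ∀ k : ZMod e, Matrix (Fin (m k)) (Fin (m k)) ℂ, ℓ (tensorPow e n m (Matrix.blockDiagonal' g)) = 0)
    (C : Matrix (TIdx e n m) (TIdx e n m) ℂ) (hC : InComm C) : ℓ C = 0 := by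
  let L : (Fin n → Pr e m) → ℂ := fun c => ℓ (Matrix.single (fun s => (c s).1.1) (fun s => (c s).1.2) 1)
  have key : ∀ M : Matrix (TIdx e n m) (TIdx e n m) ℂ, (∀ b c, ¬ (∀ s, (b s).1 = (c s).1) → M b c = 0) →
      ℓ M = ∑ c : Fin n → Pr e m, M (fun s => (c s).1.1) (fun s => (c s).1.2) * L c := by
    intro M hM
    rw [lin_expand, sum_pairs]
    · refine Finset.sum_congr rfl fun c _ => ?_
      simp only [L]
      congr!
    · intro b c h; rw [hM b c h, zero_mul]
  let Φ : MvPolynomial (Pr e m) ℂ := ∑ c : Fin n → Pr e m, MvPolynomial.monomial (ty c) (L c)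
  have hΦ : Φ = 0 := by
    apply MvPolynomial.funext
    intro x
    rw [map_zero]
    have h1 := h (fun k => Matrix.of fun i i' => x ⟨(⟨k, i⟩, ⟨k, i'⟩), rfl⟩)
    rw [key] at h1
    · rw [← h1]
      simp only [Φ, map_sum]
      refine Finset.sum_congr rfl fun c _ => ?_
      rw [MvPolynomial.eval_monomial, mul_comm]
      congr 1
      rw [Finsupp.prod_fintype _ _ (by simp), ← prod_ty]
      unfold tensorPow
      rw [Matrix.of_apply]
      refine Finset.prod_congr rfl fun s _ => ?_
      have hgen : ∀ z : Pr e m, x z = Matrix.blockDiagonal' (fun k => Matrix.of fun i i' =>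
          x ⟨((⟨k, i⟩ : BIdx e m), (⟨k, i'⟩ : BIdx e m)), rfl⟩) z.1.1 z.1.2 := by
        rintro ⟨⟨⟨k, i⟩, ⟨k', i'⟩⟩, hk⟩
        obtain rfl : k = k' := hk
        rw [Matrix.blockDiagonal'_apply_eq]
        rfl
      exact hgen (c s)
    · intro b c hbc
      push Not at hbc
      obtain ⟨s, hs⟩ := hbc
      unfold tensorPow
      rw [Matrix.of_apply]
      apply Finset.prod_eq_zero (Finset.mem_univ s)
      generalize b s = z at hs
      generalize c s = z' at hs
      obtain ⟨k, i⟩ := z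
      obtain ⟨k', i'⟩ := z'
      exact Matrix.blockDiagonal'_apply_ne _ _ _ hs
  have hcoef : ∀ t : Pr e m →₀ ℕ, ∑ c ∈ Finset.univ.filter (fun c : Fin n → Pr e m => ty c = t), L c = 0 := by
    intro t
    have := congrArg (MvPolynomial.coeff t) hΦ
    simp only [Φ, MvPolynomial.coeff_sum, MvPolynomial.coeff_monomial, MvPolynomial.coeff_zero] at this
    rw [Finset.sum_filter]
    exact this
  rw [key C hC.1]
  rw [← Finset.sum_fiberwise_of_maps_to (s := Finset.univ) (t := Finset.univ.image (fun c : Fin n → Pr e m => ty c))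
    (g := fun c => ty c) (fun c _ => Finset.mem_image_of_mem _ (Finset.mem_univ _))]
  refine Finset.sum_eq_zero fun t ht => ?_
  obtain ⟨c0, -, rfl⟩ := Finset.mem_image.1 ht
  rw [Finset.sum_congr rfl (g := fun c => C (fun s => (c0 s).1.1) (fun s => (c0 s).1.2) * L c), ← Finset.mul_sum,
    hcoef, mul_zero]
  intro c hc
  obtain ⟨π, hπ⟩ := exists_perm_of_ty (Finset.mem_filter.1 hc).2
  congr 1
  rw [← hC.2 π (fun s => (c0 s).1.1), ← hπ]
  rfl

lemma ltu_vanish (ℓ : Matrix (TIdx e n m) (TIdx e n m) ℂ →ₗ[ℂ] ℂ)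
    (h : ∀ (u l : Matrix (BIdx e m) (BIdx e m) ℂ) (dv : BIdx e m → ℂ), IsUpperUni e m u → IsUpperUni e m lᴴ →
      ℓ (tensorPow e n m (l * Matrix.diagonal dv * u)) = 0)
    (C : Matrix (TIdx e n m) (TIdx e n m) ℂ) (hC : InComm C) : ℓ C = 0 :=
  comm_vanish ℓ (vanish_block ℓ h) C hC

/-- abstract multiplicity-one lemma -/
lemma hom_lemma (P Q : Matrix (TIdx e n m) (TIdx e n m) ℂ) (κ : ℂ) (wt : (BIdx e m → ℂ) → ℂ)
    (hu : ∀ u, IsUpperUni e m u → tensorPow e n m u * Q = Q)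
    (ht : ∀ dv, tensorPow e n m (Matrix.diagonal dv) * Q = wt dv • Q)
    (hl : ∀ l, IsUpperUni e m lᴴ → P * tensorPow e n m l * Q = κ • Q)
    (C : Matrix (TIdx e n m) (TIdx e n m) ℂ) (hC : InComm C) :
    Matrix.trace Q • (P * C * Q) = Matrix.trace (P * C * Q) • Q ∧ (κ = 0 → P * C * Q = 0) := by
  have key : ∀ (u l : Matrix (BIdx e m) (BIdx e m) ℂ) (dv : BIdx e m → ℂ), IsUpperUni e m u → IsUpperUni e m lᴴ →
      P * tensorPow e n m (l * Matrix.diagonal dv * u) * Q = (wt dv * κ) • Q := by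
    intro u l dv h1 h2
    rw [tensorPow_mul, tensorPow_mul]
    have : P * (tensorPow e n m l * tensorPow e n m (Matrix.diagonal dv) * tensorPow e n m u) * Q
      = P * tensorPow e n m l * (tensorPow e n m (Matrix.diagonal dv) * (tensorPow e n m u * Q)) := by
      simp only [Matrix.mul_assoc]
    rw [this, hu u h1, ht, Matrix.mul_smul, hl l h2, smul_smul]
  constructor
  · ext x y
    let ℓ : Matrix (TIdx e n m) (TIdx e n m) ℂ →ₗ[ℂ] ℂ :=
      { toFun := fun C => Matrix.trace Q * (P * C * Q) x y - Matrix.trace (P * C * Q) * Q x y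
        map_add' := by intro A B; simp only [Matrix.mul_add, Matrix.add_mul, Matrix.add_apply, Matrix.trace_add]; ring
        map_smul' := by
          intro c A
          simp only [Matrix.mul_smul, Matrix.smul_mul, Matrix.smul_apply, Matrix.trace_smul, smul_eq_mul, RingHom.id_apply]
          ring }
    have := ltu_vanish ℓ (by
      intro u l dv h1 h2
      change Matrix.trace Q * (P * (tensorPow e n m (l * Matrix.diagonal dv * u) : Matrix (TIdx e n m) (TIdx e n m) ℂ) * Q : Matrix (TIdx e n m) (TIdx e n m) ℂ) x y - Matrix.trace (P * (tensorPow e n m (l * Matrix.diagonal dv * u)) * Q) * Q x y = 0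
      rw [key u l dv h1 h2, Matrix.smul_apply, Matrix.trace_smul, smul_eq_mul, smul_eq_mul]
      ring) C hC
    exact sub_eq_zero.1 this
  · intro h0
    ext x y
    let ℓ : Matrix (TIdx e n m) (TIdx e n m) ℂ →ₗ[ℂ] ℂ :=
      { toFun := fun C => (P * C * Q) x y
        map_add' := by intro A B; simp only [Matrix.mul_add, Matrix.add_mul, Matrix.add_apply]
        map_smul' := by
          intro c A
          simp only [Matrix.mul_smul, Matrix.smul_mul, Matrix.smul_apply, smul_eq_mul, RingHom.id_apply] }
    exact ltu_vanish ℓ (by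
      intro u l dv h1 h2
      change (P * (tensorPow e n m (l * Matrix.diagonal dv * u) : Matrix (TIdx e n m) (TIdx e n m) ℂ) * Q : Matrix (TIdx e n m) (TIdx e n m) ℂ) x y = 0
      rw [key u l dv h1 h2, h0, mul_zero, zero_smul]
      rfl) C hC

end Comm
end GreenII

namespace GreenII

/-! ### Part F: highest weight spaces -/
section HW
open Matrix
variable {e n d : ℕ} [NeZero e] {m : ZMod e → ℕ}

/-- the weight of an `e`-partition as a function on the basis -/
noncomputable def wtA (m : ZMod e → ℕ) (α : ZMod e → Multiset ℕ) : BIdx e m → ℕ :=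
  fun b => lamOf (α b.1) b.2.val

lemma mem_hw (α : ZMod e → Multiset ℕ) (v : TIdx e n m → ℂ) : v ∈ hwSubmodule e n m α ↔
    (∀ u, IsUpperUni e m u → tensorPow e n m u *ᵥ v = v) ∧
    ∀ dv, tensorPow e n m (Matrix.diagonal dv) *ᵥ v = weightOf e m α dv • v := by
  unfold hwSubmodule
  simp only [Submodule.mem_inf, Submodule.mem_iInf, Module.End.mem_eigenspace_iff, one_smul]
  rfl

lemma rho_mem_hw (α : ZMod e → Multiset ℕ) (A : Matrix (TIdx e n m) (TIdx e n m) ℂ)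
    (hA : ∀ g, IsBlockDiag e m g → A * tensorPow e n m g = tensorPow e n m g * A)
    (v : TIdx e n m → ℂ) (hv : v ∈ hwSubmodule e n m α) : A *ᵥ v ∈ hwSubmodule e n m α := by
  rw [mem_hw] at hv ⊢
  constructor
  · intro u hu
    rw [Matrix.mulVec_mulVec, ← hA u hu.block, ← Matrix.mulVec_mulVec, hv.1 u hu]
  · intro dv
    have hb : IsBlockDiag e m (Matrix.diagonal dv) := by
      intro b b' h
      rw [Matrix.diagonal_apply_ne]
      rintro rfl; exact h rfl
    rw [Matrix.mulVec_mulVec, ← hA _ hb, ← Matrix.mulVec_mulVec, hv.2 dv, Matrix.mulVec_smul]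

lemma rhoH_comm {ζ : ℂ} (hζ : IsPrimitiveRoot ζ e) (w : Wt e n) {g : Matrix (BIdx e m) (BIdx e m) ℂ}
    (hg : IsBlockDiag e m g) :
    (rhoMat e n ζ m w)ᴴ * tensorPow e n m g = tensorPow e n m g * (rhoMat e n ζ m w)ᴴ := by
  have h1 := rho_comm_tensorPow ζ w hg
  have h2 : (rhoMat e n ζ m w)ᴴ * (rhoMat e n ζ m w * tensorPow e n m g) * (rhoMat e n ζ m w)ᴴ
    = (rhoMat e n ζ m w)ᴴ * (tensorPow e n m g * rhoMat e n ζ m w) * (rhoMat e n ζ m w)ᴴ := by rw [h1]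
  rw [← Matrix.mul_assoc, rho_unitary hζ, Matrix.one_mul, Matrix.mul_assoc, Matrix.mul_assoc, rho_unitary' hζ,
    Matrix.mul_one] at h2
  exact h2.symm

/-- a chosen Hermitian projector onto the highest weight space -/
noncomputable def Qp (e n : ℕ) [NeZero e] (m : ZMod e → ℕ) (α : ZMod e → Multiset ℕ) :
    Matrix (TIdx e n m) (TIdx e n m) ℂ := (exists_proj (hwSubmodule e n m α)).choose

lemma Qp_idem (α : ZMod e → Multiset ℕ) : Qp e n m α * Qp e n m α = Qp e n m α :=
  (exists_proj (hwSubmodule e n m α)).choose_spec.1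
lemma Qp_herm (α : ZMod e → Multiset ℕ) : (Qp e n m α)ᴴ = Qp e n m α :=
  (exists_proj (hwSubmodule e n m α)).choose_spec.2.1
lemma Qp_mem (α : ZMod e → Multiset ℕ) (v) : v ∈ hwSubmodule e n m α ↔ Qp e n m α *ᵥ v = v :=
  (exists_proj (hwSubmodule e n m α)).choose_spec.2.2 v

lemma Qp_rho {ζ : ℂ} (hζ : IsPrimitiveRoot ζ e) (α : ZMod e → Multiset ℕ) (w : Wt e n) :
    rhoMat e n ζ m w * Qp e n m α = Qp e n m α * rhoMat e n ζ m w :=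
  preserve_comm (Qp_idem α) (Qp_herm α) (Qp_mem α)
    (rho_mem_hw α _ fun _ hg => rho_comm_tensorPow ζ w hg)
    (rho_mem_hw α _ fun _ hg => rhoH_comm hζ w hg)

lemma Qp_upper (α : ZMod e → Multiset ℕ) (u) (hu : IsUpperUni e m u) :
    tensorPow e n m u * Qp e n m α = Qp e n m α := mat_ext_mulVec fun v => by
  rw [← Matrix.mulVec_mulVec]
  exact ((mem_hw α _).1 (proj_mul_of_fix (Qp_idem α) (Qp_mem α) v)).1 u hu

lemma Qp_diag (α : ZMod e → Multiset ℕ) (dv) :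
    tensorPow e n m (Matrix.diagonal dv) * Qp e n m α = weightOf e m α dv • Qp e n m α := mat_ext_mulVec fun v => by
  rw [← Matrix.mulVec_mulVec, Matrix.smul_mulVec]
  exact ((mem_hw α _).1 (proj_mul_of_fix (Qp_idem α) (Qp_mem α) v)).2 dv

lemma Qp_supp (α : ZMod e → Multiset ℕ) (b c : TIdx e n m) (h : Qp e n m α b c ≠ 0) (a : BIdx e m) :
    ty b a = wtA m α a := by
  have h1 := congrFun (congrFun (Qp_diag (n := n) α (fun a' => if a' = a then 2 else 1)) b) c
  rw [tensorPow_diag_apply, Matrix.diagonal_mul, Matrix.smul_apply, smul_eq_mul] at h1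
  have h2 := mul_right_cancel₀ h h1
  rw [prod_ty b (fun a' => if a' = a then (2:ℂ) else 1)] at h2
  unfold weightOf at h2
  have h3 : ∀ f : BIdx e m → ℕ, ∏ a', (if a' = a then (2:ℂ) else 1) ^ f a' = 2 ^ f a := by
    intro f
    rw [Finset.prod_eq_single a]
    · simp
    · intro x _ hx; simp [hx]
    · simp
  rw [h3 (fun a' => ty b a'), h3 (fun a' => lamOf (α a'.1) a'.2.val)] at h2
  have h4 : (2:ℕ) ^ ty b a = 2 ^ lamOf (α a.1) a.2.val := by exact_mod_cast h2
  exact Nat.pow_right_injective le_rfl h4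

/-- weight space projectors -/
noncomputable def Pw (e n : ℕ) [NeZero e] (m : ZMod e → ℕ) (ν : BIdx e m → ℤ) :
    Matrix (TIdx e n m) (TIdx e n m) ℂ :=
  Matrix.diagonal fun b => if ∀ a, (ty b a : ℤ) = ν a then 1 else 0

lemma Pw_herm (ν : BIdx e m → ℤ) : (Pw e n m ν)ᴴ = Pw e n m ν := by
  unfold Pw
  rw [Matrix.diagonal_conjTranspose]
  congr 1
  funext b
  simp only [Pi.star_apply]
  split_ifs <;> simp

lemma Pw_Qp (α : ZMod e → Multiset ℕ) : Pw e n m (fun a => wtA m α a) * Qp e n m α = Qp e n m α := by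
  ext b c
  unfold Pw
  rw [Matrix.diagonal_mul]
  by_cases h : Qp e n m α b c = 0
  · rw [h, mul_zero]
  · rw [if_pos, one_mul]
    intro a; exact congrArg Nat.cast (Qp_supp α b c h a)

lemma Qp_Pw (α : ZMod e → Multiset ℕ) : Qp e n m α * Pw e n m (fun a => wtA m α a) = Qp e n m α := by
  have := congrArg Matrix.conjTranspose (Pw_Qp (n := n) (m := m) α)
  rwa [Matrix.conjTranspose_mul, Qp_herm, Pw_herm] at this

noncomputable def height (ν : BIdx e m → ℤ) : ℤ := ∑ a, (a.2.val : ℤ) * ν a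

lemma height_ty (b : TIdx e n m) : height (fun a => (ty b a : ℤ)) = ∑ s, ((b s).2.val : ℤ) := by
  unfold height
  have h : ∀ a : BIdx e m, (a.2.val : ℤ) * (ty b a : ℤ) = ∑ s, if b s = a then (a.2.val : ℤ) else 0 := by
    intro a
    rw [ty_apply, Finset.card_filter, Nat.cast_sum, Finset.mul_sum]
    refine Finset.sum_congr rfl fun s _ => ?_
    split_ifs <;> simp
  simp only [h]
  rw [Finset.sum_comm]
  refine Finset.sum_congr rfl fun s _ => ?_
  simp

lemma lower_entry {l : Matrix (BIdx e m) (BIdx e m) ℂ} (hl : IsUpperUni e m lᴴ) (b b' : BIdx e m)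
    (h : l b b' ≠ 0) : b = b' ∨ b'.2.val < b.2.val := by
  by_contra hcon
  push Not at hcon
  apply h
  have h1 := hl.2 b' b (fun h => hcon.1 h.symm) (fun h => absurd h.2 (not_lt.2 hcon.2))
  rw [Matrix.conjTranspose_apply] at h1
  simpa using h1

lemma Pw_lower_zero (α : ZMod e → Multiset ℕ) (ν : BIdx e m → ℤ)
    (hν : height ν < height (fun a => (wtA m α a : ℤ))) (l) (hl : IsUpperUni e m lᴴ) :
    Pw e n m ν * tensorPow e n m l * Qp e n m α = (0:ℂ) • Qp e n m α := by
  rw [zero_smul, Matrix.mul_assoc]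
  ext b c
  unfold Pw
  rw [Matrix.diagonal_mul]
  split_ifs with hb
  · rw [one_mul, Matrix.mul_apply]
    refine Finset.sum_eq_zero fun x _ => ?_
    by_contra hne
    have h1 := left_ne_zero_of_mul hne
    have h2 := right_ne_zero_of_mul hne
    have h3 : ∀ s, ((x s).2.val : ℤ) ≤ (b s).2.val := by
      intro s
      have h4 : l (b s) (x s) ≠ 0 := by
        intro h0
        apply h1
        exact Finset.prod_eq_zero (Finset.mem_univ s) h0
      rcases lower_entry hl _ _ h4 with h5 | h5
      · rw [h5]
      · exact_mod_cast h5.le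
    have h6 := height_ty b
    have h7 := height_ty x
    have h8 : (fun a => (ty b a : ℤ)) = ν := funext hb
    have h9 : (fun a => (ty x a : ℤ)) = fun a => (wtA m α a : ℤ) :=
      funext fun a => by exact_mod_cast Qp_supp α x c h2 a
    rw [h8] at h6
    rw [h9] at h7
    have := Finset.sum_le_sum fun s (_ : s ∈ Finset.univ) => h3 s
    linarith
  · rw [zero_mul]; rfl

lemma Pw_lower_one (α : ZMod e → Multiset ℕ) (l) (hl : IsUpperUni e m lᴴ) :
    Pw e n m (fun a => wtA m α a) * tensorPow e n m l * Qp e n m α = (1:ℂ) • Qp e n m α := by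
  rw [one_smul, Matrix.mul_assoc]
  conv_rhs => rw [← Pw_Qp]
  ext b c
  unfold Pw
  rw [Matrix.diagonal_mul, Matrix.diagonal_mul]
  split_ifs with hb
  · rw [one_mul, one_mul, Matrix.mul_apply, Finset.sum_eq_single b]
    · have : tensorPow e n m l b b = 1 := by
        show ∏ s, l (b s) (b s) = 1
        apply Finset.prod_eq_one
        intro s _
        have := hl.1 (b s)
        rw [Matrix.conjTranspose_apply] at this
        simpa using congrArg star this
      rw [this, one_mul]
    · intro x _ hxb
      by_contra hne
      have h1 := left_ne_zero_of_mul hne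
      have h2 := right_ne_zero_of_mul hne
      have h3' : ∀ s, b s = x s ∨ (x s).2.val < (b s).2.val := by
        intro s
        apply lower_entry hl
        intro h0
        apply h1
        exact Finset.prod_eq_zero (Finset.mem_univ s) h0
      have h6 := height_ty b
      have h7 := height_ty x
      have h8 : (fun a => (ty b a : ℤ)) = fun a => (wtA m α a : ℤ) := funext hb
      have h9 : (fun a => (ty x a : ℤ)) = fun a => (wtA m α a : ℤ) :=
        funext fun a => by exact_mod_cast Qp_supp α x c h2 a
      rw [h8] at h6
      rw [h9] at h7
      apply hxb
      funext s
      rcases h3' s with h | h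
      · exact h.symm
      · exfalso
        have : ∑ s, ((x s).2.val : ℤ) < ∑ s, ((b s).2.val : ℤ) := by
          apply Finset.sum_lt_sum
          · intro t _
            rcases h3' t with h5 | h5
            · rw [h5]
            · exact_mod_cast h5.le
          · exact ⟨s, Finset.mem_univ s, by exact_mod_cast h⟩
        linarith
    · simp
  · rw [zero_mul, zero_mul]

lemma Qp_lower (β : ZMod e → Multiset ℕ) (l) (hl : IsUpperUni e m lᴴ) :
    Qp e n m β * tensorPow e n m l = Qp e n m β := by
  have := congrArg Matrix.conjTranspose (Qp_upper (n := n) β _ hl)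
  rwa [Matrix.conjTranspose_mul, Qp_herm, tensorPow_conj, Matrix.conjTranspose_conjTranspose] at this

lemma Qp_mul_ne (α β : ZMod e → Multiset ℕ) (h : wtA m α ≠ wtA m β) :
    Qp e n m β * Qp e n m α = 0 := by
  rw [← Pw_Qp α, ← Qp_Pw β]
  have : Pw e n m (fun a => wtA m β a) * Pw e n m (fun a => (wtA m α a : ℤ)) = 0 := by
    unfold Pw
    rw [Matrix.diagonal_mul_diagonal, ← Matrix.diagonal_zero]
    congr 1
    funext b
    by_contra hne
    have h1 := left_ne_zero_of_mul hne
    have h2 := right_ne_zero_of_mul hne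
    have h3 : ∀ a, (ty b a : ℤ) = wtA m β a := by by_contra h'; exact h1 (if_neg h')
    have h4 : ∀ a, (ty b a : ℤ) = wtA m α a := by by_contra h'; exact h2 (if_neg h')
    apply h
    funext a
    have := (h4 a).symm.trans (h3 a)
    exact_mod_cast this
  have h5 : Qp e n m β * Pw e n m (fun a => wtA m β a) * (Pw e n m (fun a => (wtA m α a : ℤ)) * Qp e n m α)
    = Qp e n m β * (Pw e n m (fun a => wtA m β a) * Pw e n m (fun a => (wtA m α a : ℤ))) * Qp e n m α := by
    simp only [Matrix.mul_assoc]
  rw [h5, this, Matrix.mul_zero, Matrix.zero_mul]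

/-- twisted class functions -/
noncomputable def fW (ζ : ℂ) (T : Matrix (TIdx e n m) (TIdx e n m) ℂ) (ν : BIdx e m → ℤ) : Wt e n → ℂ :=
  fun w => Matrix.trace (Pw e n m ν * (rhoMat e n ζ m w * T))

noncomputable def zW (ζ : ℂ) (T : Matrix (TIdx e n m) (TIdx e n m) ℂ) (α : ZMod e → Multiset ℕ) : Wt e n → ℂ :=
  fun w => Matrix.trace (Qp e n m α * (rhoMat e n ζ m w * T))

section ips
variable {ζ : ℂ} (hζ : IsPrimitiveRoot ζ e) (T : Matrix (TIdx e n m) (TIdx e n m) ℂ) (α : ZMod e → Multiset ℕ)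
include hζ

lemma ip_f_z_zero (ν : BIdx e m → ℤ) (hν : height ν < height (fun a => (wtA m α a : ℤ))) :
    ip (fW ζ T ν) (zW ζ T α) = 0 :=
  ip_trace_zero hζ _ _ _ (Qp_herm α) fun C hC =>
    (hom_lemma _ _ 0 _ (Qp_upper α) (Qp_diag α) (Pw_lower_zero α ν hν) C hC).2 rfl

lemma ip_z_z_zero (β : ZMod e → Multiset ℕ) (h : wtA m α ≠ wtA m β) :
    ip (zW ζ T β) (zW ζ T α) = 0 :=
  ip_trace_zero hζ _ _ _ (Qp_herm α) fun C hC =>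
    (hom_lemma _ _ 0 _ (Qp_upper α) (Qp_diag α) (fun l hl => by
      rw [Qp_lower β l hl, Qp_mul_ne α β h, zero_smul]) C hC).2 rfl

lemma ip_one_aux (P : Matrix (TIdx e n m) (TIdx e n m) ℂ) (hPQ : Qp e n m α * P = Qp e n m α)
    (hl : ∀ l, IsUpperUni e m lᴴ → P * tensorPow e n m l * Qp e n m α = (1:ℂ) • Qp e n m α)
    (hQ0 : Matrix.trace (Qp e n m α) ≠ 0) (hTQ : T * Qp e n m α = Qp e n m α * T) (hT : Tᴴ * T = 1) :
    ip (fun w => Matrix.trace (P * (rhoMat e n ζ m w * T))) (zW ζ T α) = Fintype.card (Wt e n) :=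
  ip_trace_one hζ _ _ _ (Qp_herm α) (Qp_idem α) hPQ hQ0 (Qp_rho hζ α) hTQ hT fun C hC => by
    have := (hom_lemma _ _ 1 _ (Qp_upper α) (Qp_diag α) hl C hC).1
    rw [div_eq_inv_mul, ← smul_smul, ← this, smul_smul, inv_mul_cancel₀ hQ0, one_smul]

lemma ip_f_z_one (hQ0 : Matrix.trace (Qp e n m α) ≠ 0) (hTQ : T * Qp e n m α = Qp e n m α * T) (hT : Tᴴ * T = 1) :
    ip (fW ζ T (fun a => wtA m α a)) (zW ζ T α) = Fintype.card (Wt e n) :=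
  ip_one_aux hζ T α _ (Qp_Pw α) (Pw_lower_one α) hQ0 hTQ hT

lemma ip_z_z_one (hQ0 : Matrix.trace (Qp e n m α) ≠ 0) (hTQ : T * Qp e n m α = Qp e n m α * T) (hT : Tᴴ * T = 1) :
    ip (zW ζ T α) (zW ζ T α) = Fintype.card (Wt e n) :=
  ip_one_aux hζ T α _ (Qp_idem α) (fun l hl => by rw [Qp_lower α l hl, Qp_idem, one_smul]) hQ0 hTQ hT

end ips

open scoped ComplexOrder in
/-- trace of the projector does not vanish if the space is non zero -/
lemma Qp_trace_ne (α : ZMod e → Multiset ℕ) (v : TIdx e n m → ℂ) (hv : v ∈ hwSubmodule e n m α) (hv0 : v ≠ 0) :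
    Matrix.trace (Qp e n m α) ≠ 0 := by
  intro h
  have h1 : Matrix.trace ((Qp e n m α)ᴴ * Qp e n m α) = 0 := by rw [Qp_herm, Qp_idem, h]
  rw [Matrix.trace_conjTranspose_mul_self_eq_zero_iff] at h1
  rw [Qp_mem, h1, Matrix.zero_mulVec] at hv
  exact hv0 hv.symm

end HW
end GreenII

namespace GreenII

/-! ### Part G: the parts of a partition -/

lemma lamOf_antitone (μ : Multiset ℕ) : Antitone (lamOf μ) := by
  intro i j hij
  unfold lamOf
  have hs : ((μ.sort (· ≤ ·)).reverse).Pairwise (· ≥ ·) := by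
    rw [List.pairwise_reverse]
    exact Multiset.pairwise_sort μ (· ≤ ·)
  generalize (μ.sort (· ≤ ·)).reverse = L at hs
  by_cases hj : j < L.length
  · have hi : i < L.length := lt_of_le_of_lt hij hj
    rw [List.getD_eq_getElem _ _ hj, List.getD_eq_getElem _ _ hi]
    rcases hij.lt_or_eq with h | h
    · exact List.pairwise_iff_getElem.1 hs i j hi hj h
    · subst h; exact le_rfl
  · rw [List.getD_eq_default _ _ (not_lt.1 hj)]
    exact Nat.zero_le _

lemma lam_map (μ : Multiset ℕ) (N : ℕ) (h : μ.card ≤ N) :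
    (Finset.univ : Finset (Fin N)).val.map (fun i : Fin N => lamOf μ i) = μ + Multiset.replicate (N - μ.card) 0 := by
  unfold lamOf
  have hL : (((μ.sort (· ≤ ·)).reverse : List ℕ) : Multiset ℕ) = μ := by
    rw [Multiset.coe_reverse, Multiset.sort_eq]
  generalize (μ.sort (· ≤ ·)).reverse = L at hL
  subst hL
  rw [Multiset.coe_card] at h ⊢
  have h1 : List.ofFn (fun i : Fin N => L.getD i 0) = L ++ List.replicate (N - L.length) 0 := by
    apply List.ext_getElem
    · simp; omega
    · intro i h1 h2
      rw [List.getElem_ofFn]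
      by_cases hi : i < L.length
      · rw [List.getElem_append_left hi, List.getD_eq_getElem _ _ hi]
      · rw [List.getElem_append_right (not_lt.1 hi), List.getD_eq_default _ _ (not_lt.1 hi), List.getElem_replicate]
  rw [Fin.univ_val_map, h1]
  rfl

lemma lam_sum (μ : Multiset ℕ) (N : ℕ) (h : μ.card ≤ N) : ∑ i : Fin N, lamOf μ i = μ.sum := by
  have := congrArg Multiset.sum (lam_map μ N h)
  rw [Multiset.sum_add, Multiset.sum_replicate, smul_zero, add_zero] at this
  exact this

lemma lam_inj {μ ν : Multiset ℕ} (N : ℕ) (h : μ.card ≤ N) (h' : ν.card ≤ N) (hμ : ∀ x ∈ μ, 0 < x)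
    (hν : ∀ x ∈ ν, 0 < x) (heq : ∀ i : Fin N, lamOf μ i = lamOf ν i) : μ = ν := by
  have h1 := lam_map μ N h
  have h2 := lam_map ν N h'
  have h3 : (fun i : Fin N => lamOf μ i) = fun i : Fin N => lamOf ν i := funext heq
  rw [h3, h2] at h1
  have h4 := congrArg (Multiset.filter (fun x => 0 < x)) h1
  rw [Multiset.filter_add, Multiset.filter_add, Multiset.filter_eq_self.2 hμ, Multiset.filter_eq_self.2 hν] at h4
  have h5 : ∀ k, Multiset.filter (fun x => 0 < x) (Multiset.replicate k 0) = 0 := by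
    intro k
    rw [Multiset.filter_eq_nil]
    intro a ha
    rw [Multiset.eq_of_mem_replicate ha]; simp
  rw [h5, h5, add_zero, add_zero] at h4
  exact h4.symm

lemma card_le_sum {μ : Multiset ℕ} (hμ : ∀ x ∈ μ, 0 < x) : μ.card ≤ μ.sum := by
  have := Multiset.card_nsmul_le_sum (a := 1) (s := μ) (fun x hx => hμ x hx)
  simpa using this

section
variable {e n : ℕ} [NeZero e] {m : ZMod e → ℕ}

lemma IsEPartition.sum_le {α : ZMod e → Multiset ℕ} (hα : IsEPartition e n α) (k : ZMod e) : (α k).sum ≤ n := by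
  rw [← hα.2]
  exact Finset.single_le_sum (f := fun k => (α k).sum) (fun _ _ => Nat.zero_le _) (Finset.mem_univ k)

lemma IsEPartition.card_le {α : ZMod e → Multiset ℕ} (hα : IsEPartition e n α) (k : ZMod e) : (α k).card ≤ n :=
  (card_le_sum (hα.1 k)).trans (hα.sum_le k)

lemma wtA_sum (hmn : ∀ k, n ≤ m k) {α : ZMod e → Multiset ℕ} (hα : IsEPartition e n α) :
    ∑ b, wtA m α b = n := by
  rw [Fintype.sum_sigma, ← hα.2]
  refine Finset.sum_congr rfl fun k _ => ?_
  exact lam_sum (α k) (m k) ((hα.card_le k).trans (hmn k))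

lemma wtA_inj (hmn : ∀ k, n ≤ m k) {α β : ZMod e → Multiset ℕ} (hα : IsEPartition e n α)
    (hβ : IsEPartition e n β) (h : wtA m α = wtA m β) : α = β := by
  funext k
  refine lam_inj (m k) ((hα.card_le k).trans (hmn k)) ((hβ.card_le k).trans (hmn k)) (hα.1 k) (hβ.1 k) fun i => ?_
  exact congrFun h ⟨k, i⟩

lemma wtA_le (hmn : ∀ k, n ≤ m k) {α : ZMod e → Multiset ℕ} (hα : IsEPartition e n α) (b : BIdx e m) :
    wtA m α b ≤ n := by
  rw [← wtA_sum hmn hα]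
  exact Finset.single_le_sum (f := wtA m α) (fun _ _ => Nat.zero_le _) (Finset.mem_univ b)

/-! ### an explicit highest weight vector -/
open Matrix

abbrev ColT (m : ZMod e → ℕ) (n : ℕ) (α : ZMod e → Multiset ℕ) (y : ZMod e × Fin n) :=
  {i : Fin (m y.1) // y.2.val < lamOf (α y.1) i}

lemma box_prod (hmn : ∀ k, n ≤ m k) {α : ZMod e → Multiset ℕ} (hα : IsEPartition e n α) {M : Type*} [CommMonoid M] (g : BIdx e m → M) :
    ∏ y : ZMod e × Fin n, ∏ i : ColT m n α y, g ⟨y.1, i.1⟩ = ∏ b, g b ^ wtA m α b := by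
  rw [Fintype.prod_prod_type, Fintype.prod_sigma]
  refine Finset.prod_congr rfl fun k _ => ?_
  have h1 : ∀ c : Fin n, ∏ i : ColT m n α (k, c), g ⟨k, i.1⟩
      = ∏ i : Fin (m k), if c.val < lamOf (α k) i then g ⟨k, i⟩ else 1 := by
    intro c
    rw [← Finset.prod_filter]
    exact (Finset.prod_subtype _ (fun x => by simp) (fun i : Fin (m k) => g ⟨k, i⟩)).symm
  simp only [h1]
  rw [Finset.prod_comm]
  refine Finset.prod_congr rfl fun i _ => ?_
  rw [Finset.prod_ite, Finset.prod_const_one, mul_one, Finset.prod_const]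
  congr 1
  show _ = lamOf (α k) i
  have h2 : lamOf (α k) i ≤ n := wtA_le hmn hα ⟨k, i⟩
  calc _ = (Finset.univ.filter fun c : Fin n => c.val < lamOf (α k) i).card := by congr!
    _ = _ := by rw [Fin.card_filter_val_lt]; omega

lemma box_card (hmn : ∀ k, n ≤ m k) {α : ZMod e → Multiset ℕ} (hα : IsEPartition e n α) :
    Fintype.card (Σ y : ZMod e × Fin n, ColT m n α y) = n := by
  have h := box_prod hmn hα (M := Multiplicative ℕ) (fun _ => Multiplicative.ofAdd 1)
  have h2 := congrArg Multiplicative.toAdd h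
  rw [toAdd_prod, toAdd_prod] at h2
  simp only [toAdd_prod, toAdd_pow, toAdd_ofAdd, smul_eq_mul, mul_one, Finset.sum_const] at h2
  rw [wtA_sum hmn hα] at h2
  rw [Fintype.card_sigma]
  simpa using h2

/-- antisymmetrised vectors -/
noncomputable def hwv {α : ZMod e → Multiset ℕ} (φ : (Σ y : ZMod e × Fin n, ColT m n α y) ≃ Fin n)
    (u : Matrix (BIdx e m) (BIdx e m) ℂ) : TIdx e n m → ℂ := fun b =>
  ∑ σ : ∀ y : ZMod e × Fin n, Equiv.Perm (ColT m n α y),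
    (∏ y, ((Equiv.Perm.sign (σ y) : ℤ) : ℂ)) *
      ∏ z : (Σ y : ZMod e × Fin n, ColT m n α y), u (b (φ z)) ⟨z.1.1, (σ z.1 z.2).1⟩

lemma hwv_det {α : ZMod e → Multiset ℕ} (φ : (Σ y : ZMod e × Fin n, ColT m n α y) ≃ Fin n)
    (u : Matrix (BIdx e m) (BIdx e m) ℂ) (b : TIdx e n m) :
    hwv φ u b = ∏ y : ZMod e × Fin n, Matrix.det (Matrix.of fun i i' : ColT m n α y =>
      u (b (φ ⟨y, i⟩)) ⟨y.1, i'.1⟩) := by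
  have h : ∀ y : ZMod e × Fin n, Matrix.det (Matrix.of fun i i' : ColT m n α y =>
      u (b (φ ⟨y, i⟩)) ⟨y.1, i'.1⟩) = ∑ σ : Equiv.Perm (ColT m n α y), ((Equiv.Perm.sign σ : ℤ) : ℂ) *
        ∏ i, u (b (φ ⟨y, i⟩)) ⟨y.1, (σ i).1⟩ := by
    intro y
    rw [← Matrix.det_transpose, Matrix.det_apply']
    rfl
  simp only [h]
  rw [Finset.prod_univ_sum, Fintype.piFinset_univ]
  unfold hwv
  refine Finset.sum_congr rfl fun σ _ => ?_
  rw [Finset.prod_mul_distrib, Fintype.prod_sigma]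

lemma hwv_tensor {α : ZMod e → Multiset ℕ} (φ : (Σ y : ZMod e × Fin n, ColT m n α y) ≃ Fin n)
    (u : Matrix (BIdx e m) (BIdx e m) ℂ) : tensorPow e n m u *ᵥ hwv φ 1 = hwv φ u := by
  funext b
  rw [Matrix.mulVec, dotProduct]
  unfold hwv
  simp only [Finset.mul_sum]
  rw [Finset.sum_comm]
  refine Finset.sum_congr rfl fun σ _ => ?_
  let g : (Σ y : ZMod e × Fin n, ColT m n α y) → BIdx e m := fun z => ⟨z.1.1, (σ z.1 z.2).1⟩
  have hg : ∀ z, g (φ.symm (φ z)) = g z := fun z => by rw [Equiv.symm_apply_apply]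
  rw [Finset.sum_eq_single (fun s => g (φ.symm s))]
  · rw [Finset.prod_eq_one (s := Finset.univ) (f := fun z => (1 : Matrix (BIdx e m) (BIdx e m) ℂ) _ _), mul_one, mul_comm]
    · congr 1
      show ∏ s, u (b s) (g (φ.symm s)) = _
      rw [← Equiv.prod_comp φ]
      exact Finset.prod_congr rfl fun z _ => by rw [hg]
    · intro z _
      show (1 : Matrix (BIdx e m) (BIdx e m) ℂ) (g (φ.symm (φ z))) (g z) = 1
      rw [hg, Matrix.one_apply_eq]
  · intro b' _ hb'
    have : ∃ z, b' (φ z) ≠ ⟨z.1.1, (σ z.1 z.2).1⟩ := by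
      by_contra hcon
      push Not at hcon
      apply hb'
      funext s
      have := hcon (φ.symm s)
      rwa [Equiv.apply_symm_apply] at this
    obtain ⟨z, hz⟩ := this
    rw [Finset.prod_eq_zero (Finset.mem_univ z) (by exact Matrix.one_apply_ne hz), mul_zero, mul_zero]
  · simp

lemma hwv_upper {α : ZMod e → Multiset ℕ} (φ : (Σ y : ZMod e × Fin n, ColT m n α y) ≃ Fin n)
    (u : Matrix (BIdx e m) (BIdx e m) ℂ) (hu : IsUpperUni e m u) : hwv φ u = hwv φ 1 := by
  funext b
  rw [hwv_det, hwv_det]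
  refine Finset.prod_congr rfl fun y _ => ?_
  have h1 : (Matrix.of fun i i' : ColT m n α y => u (b (φ ⟨y, i⟩)) ⟨y.1, i'.1⟩)
    = (Matrix.of fun i i' : ColT m n α y => (1 : Matrix (BIdx e m) (BIdx e m) ℂ) (b (φ ⟨y, i⟩)) ⟨y.1, i'.1⟩)
      * (Matrix.of fun i i' : ColT m n α y => u ⟨y.1, i.1⟩ ⟨y.1, i'.1⟩) := by
    ext i i'
    rw [Matrix.mul_apply]
    simp only [Matrix.of_apply]
    by_cases hex : ∃ i'' : ColT m n α y, b (φ ⟨y, i⟩) = ⟨y.1, i''.1⟩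
    · obtain ⟨i'', hi''⟩ := hex
      rw [Finset.sum_eq_single i'', hi'', Matrix.one_apply_eq, one_mul]
      · intro x _ hx
        rw [hi'', Matrix.one_apply_ne, zero_mul]
        intro h
        apply hx
        apply Subtype.ext
        simpa using h.symm
      · simp
    · push Not at hex
      rw [Finset.sum_eq_zero]
      · by_contra hne
        by_cases hb : b (φ ⟨y, i⟩) = ⟨y.1, i'.1⟩
        · exact hex i' hb
        · have h2 : (b (φ ⟨y, i⟩)).1 = y.1 ∧ (b (φ ⟨y, i⟩)).2.val < i'.1.val := by
            by_contra h3
            exact hne (hu.2 _ _ hb h3)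
          have h4 : (b (φ ⟨y, i⟩)).2.val < m y.1 := h2.2.trans i'.1.2
          apply hex ⟨⟨(b (φ ⟨y, i⟩)).2.val, h4⟩, ?_⟩
          · exact bidx_ext h2.1 rfl
          · exact lt_of_lt_of_le i'.2 (lamOf_antitone _ h2.2.le)
      · intro x _
        rw [Matrix.one_apply_ne (hex x), zero_mul]
  rw [h1, Matrix.det_mul]
  have h2 : Matrix.det (Matrix.of fun i i' : ColT m n α y => u ⟨y.1, i.1⟩ ⟨y.1, i'.1⟩) = 1 := by
    rw [Matrix.det_of_isUpperTriangular]
    · exact Finset.prod_eq_one fun i _ => hu.1 _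
    · intro i i' hii
      apply hu.2
      · intro h
        simp at h
        exact absurd hii (by rw [id, id]; exact (lt_irrefl _ <| (Subtype.ext h : i = i') ▸ ·))
      · intro h
        have h3 : i'.1 < i.1 := hii
        exact absurd h.2 (not_lt.2 h3.le)
  rw [h2, mul_one]

lemma hwv_mem (hmn : ∀ k, n ≤ m k) {α : ZMod e → Multiset ℕ} (hα : IsEPartition e n α) (φ : (Σ y : ZMod e × Fin n, ColT m n α y) ≃ Fin n) :
    hwv φ 1 ∈ hwSubmodule e n m α := by
  rw [mem_hw]
  constructor
  · intro u hu
    rw [hwv_tensor, hwv_upper φ u hu]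
  · intro dv
    rw [hwv_tensor]
    funext b
    rw [Pi.smul_apply, smul_eq_mul]
    unfold hwv
    rw [Finset.mul_sum]
    refine Finset.sum_congr rfl fun σ _ => ?_
    rw [mul_left_comm]
    congr 1
    have h1 : ∀ z : (Σ y : ZMod e × Fin n, ColT m n α y), Matrix.diagonal dv (b (φ z)) ⟨z.1.1, (σ z.1 z.2).1⟩
      = dv ⟨z.1.1, (σ z.1 z.2).1⟩ * (1 : Matrix (BIdx e m) (BIdx e m) ℂ) (b (φ z)) ⟨z.1.1, (σ z.1 z.2).1⟩ := by
      intro z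
      rw [Matrix.diagonal_apply, Matrix.one_apply]
      split_ifs with h
      · rw [mul_one, h]
      · rw [mul_zero]
    simp only [h1]
    rw [Finset.prod_mul_distrib]
    congr 1
    rw [Fintype.prod_sigma]
    have h2 : ∀ y : ZMod e × Fin n, ∏ i : ColT m n α y, dv ⟨y.1, (σ y i).1⟩ = ∏ i : ColT m n α y, dv ⟨y.1, i.1⟩ :=
      fun y => Equiv.prod_comp (σ y) (fun i : ColT m n α y => dv ⟨y.1, i.1⟩)
    rw [Finset.prod_congr rfl fun y _ => h2 y]
    exact box_prod hmn hα dv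

lemma hwv_ne {α : ZMod e → Multiset ℕ} (φ : (Σ y : ZMod e × Fin n, ColT m n α y) ≃ Fin n) :
    hwv φ (1 : Matrix (BIdx e m) (BIdx e m) ℂ) ≠ 0 := by
  intro h
  let g : (Σ y : ZMod e × Fin n, ColT m n α y) → BIdx e m := fun z => ⟨z.1.1, z.2.1⟩
  have hg : ∀ z, g (φ.symm (φ z)) = g z := fun z => by rw [Equiv.symm_apply_apply]
  have h1 := congrFun h (fun s => g (φ.symm s))
  rw [hwv_det, Pi.zero_apply, Finset.prod_eq_one] at h1
  · exact one_ne_zero h1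
  · intro y _
    rw [← Matrix.det_one (n := ColT m n α y)]
    congr 1
    ext i i'
    simp only [Matrix.of_apply, hg, Matrix.one_apply]
    congr 1
    simp [g, Subtype.ext_iff]

lemma trace_Qp_ne (hmn : ∀ k, n ≤ m k) {α : ZMod e → Multiset ℕ} (hα : IsEPartition e n α) :
    Matrix.trace (Qp e n m α) ≠ 0 :=
  let φ := Fintype.equivFinOfCardEq (box_card hmn hα)
  Qp_trace_ne α _ (hwv_mem hmn hα φ) (hwv_ne φ)
end
end GreenII

namespace GreenII
section
open Matrix
variable {e n d : ℕ} [NeZero e] {m : ZMod e → ℕ}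

lemma tensorPow_permT (u : Matrix (BIdx e m) (BIdx e m) ℂ) (g : Equiv.Perm (BIdx e m)) :
    tensorPow e n m u * permT n g = permT n g * tensorPow e n m (u.submatrix g g) := by
  ext b' b
  rw [mul_permT_apply, permT_mul_apply]
  unfold tensorPow
  simp

lemma permT_hw (g : Equiv.Perm (BIdx e m)) (α β : ZMod e → Multiset ℕ)
    (h1 : ∀ b, (g b).2.val = b.2.val) (h2 : ∀ b b', (g b).1 = (g b').1 → b.1 = b'.1)
    (h3 : ∀ b, wtA m β (g b) = wtA m α b) (v : TIdx e n m → ℂ) (hv : v ∈ hwSubmodule e n m α) :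
    permT n g *ᵥ v ∈ hwSubmodule e n m β := by
  rw [mem_hw] at hv ⊢
  constructor
  · intro u hu
    rw [Matrix.mulVec_mulVec, tensorPow_permT, ← Matrix.mulVec_mulVec, hv.1]
    refine ⟨fun b => hu.1 _, fun b b' hbb h => ?_⟩
    apply hu.2 _ _ (fun h' => hbb (g.injective h'))
    rintro ⟨h4, h5⟩
    apply h
    rw [h1, h1] at h5
    exact ⟨h2 _ _ h4, h5⟩
  · intro dv
    have : (Matrix.diagonal dv).submatrix g g = Matrix.diagonal (dv ∘ g) := by
      ext b b'
      simp [Matrix.diagonal_apply]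
    rw [Matrix.mulVec_mulVec, tensorPow_permT, ← Matrix.mulVec_mulVec, this, hv.2, Matrix.mulVec_smul]
    congr 1
    unfold weightOf
    refine Eq.trans ?_ (Equiv.prod_comp g (fun b => dv b ^ lamOf (β b.1) b.2.val))
    refine Finset.prod_congr rfl fun b _ => ?_
    have := h3 b
    unfold wtA at this
    rw [this]; rfl

lemma wtA_theta (hm : ∀ k, m (k + (d : ZMod e)) = m k) (α : ZMod e → Multiset ℕ) (b : BIdx e m) :
    wtA m (theta e d α) (tE e d m hm b) = wtA m α b := by
  show lamOf (α (b.1 + (d : ZMod e) - (d : ZMod e))) b.2.val = lamOf (α b.1) b.2.val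
  rw [add_sub_cancel_right]

lemma permT_Qp_one (hm : ∀ k, m (k + (d : ZMod e)) = m k) (α : ZMod e → Multiset ℕ) :
    permT n (tE e d m hm) * Qp e n m α = Qp e n m (theta e d α) * permT n (tE e d m hm) := by
  set f := tE e d m hm with hf
  have key : Qp e n m (theta e d α) = permT n f * Qp e n m α * permT n f⁻¹ := by
    refine proj_unique (S := hwSubmodule e n m (theta e d α)) (Qp_idem _) (Qp_herm _) (Qp_mem _) ?_ ?_ ?_
    · calc permT n f * Qp e n m α * permT n f⁻¹ * (permT n f * Qp e n m α * permT n f⁻¹)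
          = permT n f * Qp e n m α * (permT n f⁻¹ * permT n f) * Qp e n m α * permT n f⁻¹ := by
            simp only [Matrix.mul_assoc]
        _ = _ := by rw [permT_inv_mul, Matrix.mul_one, Matrix.mul_assoc (permT n f), Qp_idem]
    · rw [Matrix.conjTranspose_mul, Matrix.conjTranspose_mul, Qp_herm, permT_conj, permT_conj, inv_inv, Matrix.mul_assoc]
    · intro v
      constructor
      · intro hv
        have h4 : permT n f⁻¹ *ᵥ v ∈ hwSubmodule e n m α := by
          apply permT_hw f⁻¹ (theta e d α) α _ _ _ v hv
          · intro b
            conv_rhs => rw [← f.apply_symm_apply b]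
            rw [hf, tE_snd]; rfl
          · intro b b' hbb
            rw [← f.apply_symm_apply b, ← f.apply_symm_apply b']
            rw [hf, tE_fst, tE_fst]
            congr 1
          · intro b
            conv_rhs => rw [← f.apply_symm_apply b]
            rw [hf, wtA_theta]; rfl
        rw [← Matrix.mulVec_mulVec, ← Matrix.mulVec_mulVec, (Qp_mem α _).1 h4, Matrix.mulVec_mulVec, permT_mul_inv,
          Matrix.one_mulVec]
      · intro hv
        rw [← hv, ← Matrix.mulVec_mulVec, ← Matrix.mulVec_mulVec]
        apply permT_hw f α _ (tE_snd hm) _ (wtA_theta hm α)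
        · exact proj_mul_of_fix (Qp_idem α) (Qp_mem α) _
        · intro b b' h
          rw [hf, tE_fst, tE_fst] at h
          exact add_right_cancel h
  rw [key, Matrix.mul_assoc _ (permT n f⁻¹), permT_inv_mul, Matrix.mul_one]

lemma permT_Qp (hm : ∀ k, m (k + (d : ZMod e)) = m k) (α : ZMod e → Multiset ℕ) (i : ℕ) :
    permT n (tE e d m hm ^ i) * Qp e n m α = Qp e n m ((theta e d)^[i] α) * permT n (tE e d m hm ^ i) := by
  induction i generalizing α with
  | zero => simp [permT_one]
  | succ i ih =>
    rw [pow_succ, permT_mul, Matrix.mul_assoc, permT_Qp_one, ← Matrix.mul_assoc, ih, Matrix.mul_assoc]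
    rfl

lemma permT_unitary (f : Equiv.Perm (BIdx e m)) : (permT n f)ᴴ * permT n f = 1 := by
  rw [permT_conj, permT_inv_mul]

lemma theta_iter (α : ZMod e → Multiset ℕ) (i : ℕ) (k : ZMod e) :
    (theta e d)^[i] α k = α (k - ((i * d : ℕ) : ZMod e)) := by
  induction i generalizing α with
  | zero => simp
  | succ i ih =>
    rw [Function.iterate_succ_apply, ih]
    unfold theta
    congr 1; push_cast; ring

lemma IsEPartition.theta {α : ZMod e → Multiset ℕ} (hα : IsEPartition e n α) (i : ℕ) :
    IsEPartition e n ((theta e d)^[i] α) := by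
  constructor
  · intro k x hx
    rw [theta_iter] at hx
    exact hα.1 _ x hx
  · rw [← hα.2]
    simp only [theta_iter]
    exact Equiv.sum_comp (Equiv.subRight ((i * d : ℕ) : ZMod e)) fun k => (α k).sum
end
end GreenII

namespace GreenII
section Count
variable {P : Type*} {n : ℕ}

lemma ty_perm (F : Equiv.Perm P) (C : Fin n → P) (p : P) : ty (F ∘ C) (F p) = ty C p := by
  rw [ty_apply, ty_apply]
  congr 1
  ext s
  simp

lemma count_x (F : Equiv.Perm P) (C C0 : Fin n → P) (h0 : ty C = ty C0) (hF : ∀ p, ty C (F p) = ty C p) :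
    (Finset.univ.filter fun x : Equiv.Perm (Fin n) => C ∘ x = F ∘ C).card
      = (Finset.univ.filter fun x : Equiv.Perm (Fin n) => C0 ∘ x = C).card := by
  obtain ⟨u, hu⟩ := exists_perm_of_ty h0
  have h1 : ty (F ∘ C) = ty C := by
    ext p
    have := ty_perm F C (F.symm p)
    rw [Equiv.apply_symm_apply] at this
    rw [this, ← hF, Equiv.apply_symm_apply]
  obtain ⟨y, hy⟩ := exists_perm_of_ty h1
  refine Finset.card_bij (fun x _ => u * x * y⁻¹) ?_ ?_ ?_
  · intro x hx
    simp only [Finset.mem_filter, Finset.mem_univ, true_and] at hx ⊢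
    rw [Equiv.Perm.coe_mul, Equiv.Perm.coe_mul, Function.comp_assoc, ← Function.comp_assoc, hu,
      ← Function.comp_assoc, hx, ← hy, Function.comp_assoc]
    funext s; simp
  · intro x _ x' _ h
    simpa using h
  · intro x hx
    simp only [Finset.mem_filter, Finset.mem_univ, true_and] at hx
    refine ⟨u⁻¹ * x * y, ?_, by group⟩
    simp only [Finset.mem_filter, Finset.mem_univ, true_and]
    have hu' : C ∘ ⇑u⁻¹ = C0 := by rw [← hu]; funext s; simp
    rw [Equiv.Perm.coe_mul, Equiv.Perm.coe_mul, Function.comp_assoc, ← Function.comp_assoc, hu',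
      ← Function.comp_assoc, hx, hy]

variable [Fintype P]

lemma count_types (F : Equiv.Perm P) (Ψ : (P →₀ ℕ) → ℂ) :
    ∑ x : Equiv.Perm (Fin n), ∑ C : Fin n → P, (if C ∘ x = F ∘ C then Ψ (ty C) else 0)
      = (Nat.factorial n : ℂ) * ∑ N ∈ ((Finset.univ : Finset (Fin n → P)).image ty).filter
          (fun N => ∀ p, N (F p) = N p), Ψ N := by
  rw [Finset.sum_comm, ← Finset.sum_fiberwise_of_maps_to (s := Finset.univ) (t := (Finset.univ : Finset (Fin n → P)).image ty)
    (g := ty) (fun C _ => Finset.mem_image_of_mem _ (Finset.mem_univ C)), Finset.sum_filter, Finset.mul_sum]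
  refine Finset.sum_congr rfl fun N hN => ?_
  obtain ⟨C0, -, hC0⟩ := Finset.mem_image.1 hN
  split_ifs with hF
  · have h1 : ∀ C ∈ Finset.univ.filter (fun C : Fin n → P => ty C = N),
        ∑ x : Equiv.Perm (Fin n), (if C ∘ x = F ∘ C then Ψ (ty C) else 0)
        = ∑ x : Equiv.Perm (Fin n), (if C0 ∘ x = C then Ψ N else 0) := by
      intro C hC
      have hC' : ty C = N := (Finset.mem_filter.1 hC).2
      rw [hC', ← Finset.sum_filter, ← Finset.sum_filter, Finset.sum_const, Finset.sum_const,
        count_x F C C0 (hC'.trans hC0.symm) (by rw [hC']; exact hF)]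
    rw [Finset.sum_congr rfl h1, Finset.sum_comm]
    have h2 : ∀ x : Equiv.Perm (Fin n), ∑ C ∈ Finset.univ.filter (fun C : Fin n → P => ty C = N),
      (if C0 ∘ x = C then Ψ N else 0) = Ψ N := by
      intro x
      rw [Finset.sum_ite_eq, if_pos]
      rw [Finset.mem_filter]
      exact ⟨Finset.mem_univ _, by rw [ty_comp, hC0]⟩
    simp only [h2]
    rw [Finset.sum_const, Finset.card_univ, Fintype.card_perm, Fintype.card_fin, nsmul_eq_mul]
  · rw [mul_zero]
    refine Finset.sum_eq_zero fun C hC => Finset.sum_eq_zero fun x _ => ?_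
    rw [if_neg]
    intro h
    apply hF
    intro p
    have hC' : ty C = N := (Finset.mem_filter.1 hC).2
    have h3 := ty_perm F C p
    rw [← h, ty_comp, hC'] at h3
    exact h3
end Count

section
open Matrix
variable {e n d : ℕ} [NeZero e] {m : ZMod e → ℕ}

lemma card_Wt : Fintype.card (Wt e n) = e ^ n * Nat.factorial n := by
  have h : Fintype.card (Wt e n) = Fintype.card (NC e n × Equiv.Perm (Fin n)) :=
    Fintype.card_congr
    { toFun := fun x => (x.left, x.right)
      invFun := fun x => ⟨x.1, x.2⟩
      left_inv := fun _ => rfl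
      right_inv := fun _ => rfl }
  rw [h, Fintype.card_prod, Fintype.card_perm, Fintype.card_fin, Fintype.card_fun, Fintype.card_fin]
  congr 2
  rw [Fintype.card_multiplicative, ZMod.card]

lemma trace_diag (ζ : ℂ) (f : Equiv.Perm (BIdx e m)) (Φ : TIdx e n m → ℂ) (w : Wt e n) :
    Matrix.trace (Matrix.diagonal Φ * (rhoMat e n ζ m w * permT n f))
      = ∑ b : TIdx e n m, if b ∘ w.right = f ∘ b then Φ b * chi ζ w b else 0 := by
  rw [Matrix.trace]
  refine Finset.sum_congr rfl fun b _ => ?_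
  rw [Matrix.diag_apply, Matrix.diagonal_mul, rho_mul_apply]
  unfold permT
  split_ifs <;> simp

/-- the diagonal action on pairs -/
noncomputable def fP (f : Equiv.Perm (BIdx e m)) (hf : ∀ b b', (f b).1 = (f b').1 ↔ b.1 = b'.1) :
    Equiv.Perm (Pr e m) :=
  Equiv.subtypeEquiv (Equiv.prodCongr f f) (fun ab => (hf ab.1 ab.2).symm)

lemma ip_count {ζ : ℂ} (hζ : IsPrimitiveRoot ζ e) (f : Equiv.Perm (BIdx e m))
    (hf : ∀ b b', (f b).1 = (f b').1 ↔ b.1 = b'.1) (Φ Φ' : TIdx e n m → ℂ)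
    (Ψ : (Pr e m →₀ ℕ) → ℂ)
    (hΨ : ∀ C : Fin n → Pr e m, Φ (fun s => (C s).1.1) * star (Φ' (fun s => (C s).1.2)) = Ψ (ty C)) :
    ip (fun w : Wt e n => Matrix.trace (Matrix.diagonal Φ * (rhoMat e n ζ m w * permT n f)))
      (fun w => Matrix.trace (Matrix.diagonal Φ' * (rhoMat e n ζ m w * permT n f)))
    = (Fintype.card (Wt e n) : ℂ) * ∑ N ∈ ((Finset.univ : Finset (Fin n → Pr e m)).image ty).filter
          (fun N => ∀ p, N (fP f hf p) = N p), Ψ N := by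
  unfold ip
  simp only [trace_diag]
  rw [sum_wt, Finset.sum_comm, card_Wt]
  push_cast
  rw [mul_assoc]
  refine Eq.trans ?_ (congrArg (fun z => (e:ℂ) ^ n * z) ((count_types (n := n) (fP f hf) Ψ).trans (by congr!)))
  show _ = (e:ℂ) ^ n * _
  rw [Finset.mul_sum]
  refine Finset.sum_congr rfl fun x _ => ?_
  simp only [star_sum, Finset.sum_mul_sum]
  rw [Finset.sum_comm]
  have h1 : ∀ b : TIdx e n m, ∑ a : NC e n, ∑ c : TIdx e n m,
      (if b ∘ ⇑x = f ∘ b then Φ b * chi ζ (⟨a, x⟩ : Wt e n) b else 0) *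
        star (if c ∘ ⇑x = f ∘ c then Φ' c * chi ζ (⟨a, x⟩ : Wt e n) c else 0)
      = ∑ c : TIdx e n m, if b ∘ ⇑x = f ∘ b ∧ c ∘ ⇑x = f ∘ c ∧ ∀ s, (b s).1 = (c s).1 then
          Φ b * star (Φ' c) * (e:ℂ) ^ n else 0 := by
    intro b
    rw [Finset.sum_comm]
    refine Finset.sum_congr rfl fun c _ => ?_
    by_cases hb : b ∘ ⇑x = f ∘ b
    · by_cases hc : c ∘ ⇑x = f ∘ c
      · simp only [hb, hc, if_true, true_and]
        have h2 := chi_orth hζ x b c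
        have h3 : ∀ a : NC e n, Φ b * chi ζ (⟨a, x⟩ : Wt e n) b * star (Φ' c * chi ζ (⟨a, x⟩ : Wt e n) c)
          = Φ b * star (Φ' c) * (chi ζ (⟨a, x⟩ : Wt e n) b * star (chi ζ (⟨a, x⟩ : Wt e n) c)) := by
          intro a; rw [star_mul']; ring
        simp only [h3]
        rw [← Finset.mul_sum, h2]
        split_ifs <;> simp
      · simp [hc]
    · simp [hb]
  rw [Finset.sum_congr rfl fun b _ => h1 b, sum_pairs, Finset.mul_sum]
  · refine Finset.sum_congr rfl fun C _ => ?_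
    have h4 : (C ∘ ⇑x = ⇑(fP f hf) ∘ C) ↔ ((fun s => (C s).1.1) ∘ ⇑x = f ∘ (fun s => (C s).1.1) ∧
      (fun s => (C s).1.2) ∘ ⇑x = f ∘ (fun s => (C s).1.2) ∧ ∀ s, (C s).1.1.1 = (C s).1.2.1) := by
      simp only [funext_iff, Function.comp]
      constructor
      · intro h
        refine ⟨fun s => ?_, fun s => ?_, fun s => (C s).2⟩
        · rw [h s]; rfl
        · rw [h s]; rfl
      · rintro ⟨h5, h6, -⟩ s
        apply Subtype.ext
        exact Prod.ext (h5 s) (h6 s)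
    by_cases h5 : C ∘ ⇑x = ⇑(fP f hf) ∘ C
    · rw [if_pos (h4.1 h5), if_pos h5, hΨ C, mul_comm]
    · rw [if_neg (fun h => h5 (h4.2 h)), if_neg h5, mul_zero]
  · intro b c h
    rw [if_neg]
    exact fun h' => h h'.2.2
end
end GreenII

namespace GreenII
section JT
variable {R : Type*} [CommRing R] {N : ℕ}

/-- compositions of an integer (none for negative integers) -/
def adZ (N : ℕ) (z : ℤ) : Finset (Fin N → ℕ) := if 0 ≤ z then Finset.Nat.antidiagonalTuple N z.toNat else ∅

lemma mem_adZ (z : ℤ) (c : Fin N → ℕ) : c ∈ adZ N z ↔ ((∑ i, c i : ℕ) : ℤ) = z := by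
  unfold adZ
  split_ifs with h
  · rw [Finset.Nat.mem_antidiagonalTuple]; omega
  · constructor
    · intro h'; simp at h'
    · intro h'; omega

/-- complete homogeneous symmetric functions with integer index -/
noncomputable def hZ (N : ℕ) (z : ℤ) (x : Fin N → R) : R := ∑ c ∈ adZ N z, ∏ i, x i ^ c i

lemma hZ_neg (z : ℤ) (x : Fin N → R) (h : z < 0) : hZ N z x = 0 := by
  unfold hZ adZ
  rw [if_neg (not_le.2 h), Finset.sum_empty]

lemma hZ_zero (x : Fin N → R) : hZ N 0 x = 1 := by
  unfold hZ
  have : adZ N 0 = {fun _ => 0} := by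
    ext c
    rw [mem_adZ, Finset.mem_singleton]
    constructor
    · intro h
      have h1 : ∑ i, c i = 0 := by exact_mod_cast h
      rw [Finset.sum_eq_zero_iff] at h1
      funext i
      exact h1 i (Finset.mem_univ i)
    · rintro rfl; simp
  rw [this, Finset.sum_singleton]
  simp

noncomputable def Gs (a : R) : PowerSeries R := PowerSeries.mk fun r => a ^ r

lemma Gs_mul (a : R) : (1 - PowerSeries.C a * PowerSeries.X) * Gs a = 1 := by
  ext r
  cases r with
  | zero => simp [Gs, sub_mul, mul_assoc]
  | succ r =>
    rw [sub_mul, one_mul, map_sub, mul_assoc, PowerSeries.coeff_C_mul, PowerSeries.coeff_succ_X_mul]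
    simp [Gs, PowerSeries.coeff_one, pow_succ, mul_comm]

lemma mk_hZ (x : Fin N → R) : PowerSeries.mk (fun r => hZ N (r : ℤ) x) = ∏ i, Gs (x i) := by
  ext r
  rw [PowerSeries.coeff_mk, PowerSeries.coeff_prod]
  unfold hZ
  refine Finset.sum_bij' (fun c _ => Finsupp.equivFunOnFinite.symm c) (fun l _ => ⇑l) ?_ ?_ ?_ ?_ ?_
  · intro c hc
    rw [mem_adZ] at hc
    rw [Finset.mem_finsuppAntidiag]
    exact ⟨by simpa using (by exact_mod_cast hc : ∑ i, c i = r), Finset.subset_univ _⟩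
  · intro l hl
    rw [Finset.mem_finsuppAntidiag] at hl
    rw [mem_adZ]
    exact_mod_cast hl.1
  · intro c _; rfl
  · intro l _; simp
  · intro c _
    simp [Gs]

noncomputable def Pl (x : Fin N → R) (l : Fin N) : Polynomial R :=
  ∏ k ∈ Finset.univ.erase l, (1 - Polynomial.C (x k) * Polynomial.X)

lemma Pl_coeff (x : Fin N → R) (l : Fin N) (v : ℕ) (hv : N ≤ v) : (Pl x l).coeff v = 0 := by
  apply Polynomial.coeff_eq_zero_of_natDegree_lt
  refine lt_of_le_of_lt (Polynomial.natDegree_prod_le _ _) ?_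
  refine lt_of_le_of_lt (Finset.sum_le_card_nsmul _ _ 1 fun k _ => ?_) ?_
  · refine (Polynomial.natDegree_sub_le _ _).trans ?_
    rw [Polynomial.natDegree_one]
    exact max_le (Nat.zero_le _) (Polynomial.natDegree_C_mul_le _ _ |>.trans Polynomial.natDegree_X_le)
  · rw [Finset.card_erase_of_mem (Finset.mem_univ l), Finset.card_univ, Fintype.card_fin]
    have := l.2
    simp; omega

lemma Pl_mul (x : Fin N → R) (l : Fin N) :
    PowerSeries.mk (fun r => hZ N (r : ℤ) x) * (Pl x l : PowerSeries R) = Gs (x l) := by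
  rw [mk_hZ, ← Finset.mul_prod_erase Finset.univ _ (Finset.mem_univ l)]
  have : (Pl x l : PowerSeries R) = ∏ k ∈ Finset.univ.erase l, (1 - PowerSeries.C (x k) * PowerSeries.X) := by
    unfold Pl
    rw [← Polynomial.coeToPowerSeries.ringHom_apply, map_prod]
    refine Finset.prod_congr rfl fun k _ => ?_
    rw [map_sub, map_mul]
    simp
  rw [this, mul_assoc, ← Finset.prod_mul_distrib, Finset.prod_eq_one, mul_one]
  intro k _
  rw [mul_comm, Gs_mul]

lemma conv_h (x : Fin N → R) (l : Fin N) (D : ℕ) :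
    ∑ a : Fin N, hZ N ((D : ℤ) - (N - 1) + a) x * (Pl x l).coeff (N - 1 - a) = x l ^ D := by
  have h1 := congrArg (PowerSeries.coeff D) (Pl_mul x l)
  rw [PowerSeries.coeff_mul, Finset.Nat.sum_antidiagonal_eq_sum_range_succ_mk] at h1
  simp only [PowerSeries.coeff_mk, Polynomial.coeff_coe, Gs] at h1
  rw [← h1]
  have h2 : ∑ k ∈ Finset.range D.succ, hZ N (k : ℤ) x * (Pl x l).coeff (D - k)
      = ∑ v ∈ Finset.range D.succ, hZ N ((D : ℤ) - v) x * (Pl x l).coeff v := by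
    rw [← Finset.sum_range_reflect]
    refine Finset.sum_congr rfl fun v hv => ?_
    have := Finset.mem_range.1 hv
    congr 2
    · omega
    · omega
  have h3 : ∑ a : Fin N, hZ N ((D : ℤ) - (N - 1) + a) x * (Pl x l).coeff (N - 1 - a)
      = ∑ v ∈ Finset.range N, hZ N ((D : ℤ) - v) x * (Pl x l).coeff v := by
    rw [← Finset.sum_range_reflect, Finset.sum_range]
    refine Finset.sum_congr rfl fun a _ => ?_
    have := a.2
    congr 2
    omega
  rw [h2, h3]
  trans ∑ v ∈ Finset.range (N + D.succ), hZ N ((D : ℤ) - v) x * (Pl x l).coeff v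
  · refine Finset.sum_subset (Finset.range_mono (by omega)) fun v _ hv => ?_
    rw [Pl_coeff x l v (by simpa using hv), mul_zero]
  · refine (Finset.sum_subset (Finset.range_mono (by omega)) fun v _ hv => ?_).symm
    have : D < v := by simpa using hv
    rw [hZ_neg _ _ (by omega), zero_mul]

/-- Jacobi--Trudi matrix -/
noncomputable def HM (lam : Fin N → ℕ) (x : Fin N → R) : Matrix (Fin N) (Fin N) R :=
  Matrix.of fun i a => hZ N ((lam i : ℤ) - i + a) x

noncomputable def AM (lam : Fin N → ℕ) (x : Fin N → R) : Matrix (Fin N) (Fin N) R :=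
  Matrix.of fun i l => x l ^ (lam i + (N - 1 - i))

lemma HM_mul (lam : Fin N → ℕ) (x : Fin N → R) :
    HM lam x * (Matrix.of fun a l : Fin N => (Pl x l).coeff (N - 1 - a)) = AM lam x := by
  ext i l
  rw [Matrix.mul_apply]
  simp only [HM, AM, Matrix.of_apply]
  rw [← conv_h x l]
  refine Finset.sum_congr rfl fun a _ => ?_
  have := i.2
  congr 2
  push_cast [Nat.cast_sub (show (i:ℕ) ≤ N - 1 by omega), Nat.cast_sub (show 1 ≤ N by omega)]
  ring

lemma HM_zero (x : Fin N → R) : (HM (fun _ => 0) x).det = 1 := by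
  rw [Matrix.det_of_isUpperTriangular]
  · refine Finset.prod_eq_one fun i _ => ?_
    simp [HM, hZ_zero]
  · intro i a h
    have : a < i := h
    exact hZ_neg _ _ (by push_cast; omega)

lemma bialternant (lam : Fin N → ℕ) (x : Fin N → R) :
    (AM (fun _ => 0) x).det * (HM lam x).det = (AM lam x).det := by
  have h1 := congrArg Matrix.det (HM_mul lam x)
  have h2 := congrArg Matrix.det (HM_mul (fun _ => 0) x)
  rw [Matrix.det_mul] at h1 h2
  rw [HM_zero, one_mul] at h2
  rw [← h1, ← h2, mul_comm]

/-- the weights occurring in the Jacobi--Trudi determinant -/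
def nuZ (lam : Fin N → ℕ) (σ : Equiv.Perm (Fin N)) (i : Fin N) : ℤ := (lam i : ℤ) - i + σ i

lemma HM_det (lam : Fin N → ℕ) (x : Fin N → R) :
    (HM lam x).det = ∑ τ : Equiv.Perm (Fin N), ((Equiv.Perm.sign τ : ℤ) : R) * ∏ i, hZ N (nuZ lam τ i) x := by
  rw [← Matrix.det_transpose, Matrix.det_apply']
  rfl

lemma prod_hZ (ν : Fin N → ℤ) (x : Fin N → R) : ∏ i, hZ N (ν i) x
    = ∑ c ∈ Fintype.piFinset (fun i => adZ N (ν i)), ∏ l, x l ^ (∑ i, c i l) := by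
  unfold hZ
  rw [Finset.prod_univ_sum]
  refine Finset.sum_congr rfl fun c _ => ?_
  rw [Finset.prod_comm]
  refine Finset.prod_congr rfl fun l _ => ?_
  rw [Finset.prod_pow_eq_pow_sum]

lemma coeff_prodX (a κ : Fin N → ℕ) :
    MvPolynomial.coeff (Finsupp.equivFunOnFinite.symm κ) (∏ l, (MvPolynomial.X l : MvPolynomial (Fin N) ℂ) ^ a l)
      = if a = κ then 1 else 0 := by
  have h : (∏ l, (MvPolynomial.X l : MvPolynomial (Fin N) ℂ) ^ a l)
    = MvPolynomial.monomial (Finsupp.equivFunOnFinite.symm a) 1 := by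
    rw [MvPolynomial.monomial_eq, Finsupp.prod_fintype]
    · simp
    · simp
  rw [h, MvPolynomial.coeff_monomial]
  simp

/-- number of matrices with given column and row sums -/
noncomputable def nMat (κ ν : Fin N → ℤ) : ℂ :=
  ∑ c ∈ Fintype.piFinset (fun i => adZ N (ν i)), if ∀ l, ((∑ i, c i l : ℕ) : ℤ) = κ l then 1 else 0

lemma JT_coeff (lam : Fin N → ℕ) (hl : Antitone lam) :
    ∑ σ : Equiv.Perm (Fin N), ∑ τ : Equiv.Perm (Fin N),
      ((Equiv.Perm.sign σ : ℤ) : ℂ) * ((Equiv.Perm.sign τ : ℤ) : ℂ) * nMat (nuZ lam σ) (nuZ lam τ) = 1 := by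
  have h1 := bialternant lam (fun l : Fin N => (MvPolynomial.X l : MvPolynomial (Fin N) ℂ))
  have h2 := congrArg (MvPolynomial.coeff (Finsupp.equivFunOnFinite.symm (fun i : Fin N => lam i + (N - 1 - i)))) h1
  have hintc : ∀ s : ℤ, ((s : MvPolynomial (Fin N) ℂ)) = MvPolynomial.C (s : ℂ) := by intro s; simp
  have h3 : MvPolynomial.coeff (Finsupp.equivFunOnFinite.symm (fun i : Fin N => lam i + (N - 1 - i)))
      (AM lam (fun l : Fin N => (MvPolynomial.X l : MvPolynomial (Fin N) ℂ))).det = 1 := by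
    rw [Matrix.det_apply', MvPolynomial.coeff_sum, Finset.sum_eq_single 1]
    · simp only [AM, Matrix.of_apply, hintc, MvPolynomial.coeff_C_mul]
      rw [coeff_prodX (fun i => lam ((1 : Equiv.Perm (Fin N)) i) + (N - 1 - ((1 : Equiv.Perm (Fin N)) i : Fin N)))]
      simp
    · intro π _ hπ
      simp only [AM, Matrix.of_apply, hintc, MvPolynomial.coeff_C_mul]
      rw [coeff_prodX (fun i => lam (π i) + (N - 1 - (π i : Fin N))), if_neg, mul_zero]
      intro h
      apply hπ
      ext i
      have h4 := congrFun h i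
      have h5 := i.2
      have h6 := (π i).2
      rw [Equiv.Perm.one_apply]
      rcases lt_trichotomy (π i) i with h7 | h7 | h7
      · have := hl h7.le
        have : (π i).val < i.val := h7
        omega
      · rw [h7]
      · have := hl h7.le
        have : i.val < (π i).val := h7
        omega
    · simp
  rw [h3] at h2
  rw [← h2, HM_det, Matrix.det_apply', Finset.sum_mul_sum, MvPolynomial.coeff_sum]
  refine Finset.sum_congr rfl fun σ _ => ?_
  rw [MvPolynomial.coeff_sum]
  refine Finset.sum_congr rfl fun τ _ => ?_
  rw [hintc, hintc]
  simp only [AM, Matrix.of_apply]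
  rw [mul_mul_mul_comm, ← map_mul, MvPolynomial.coeff_C_mul]
  congr 1
  rw [prod_hZ, Finset.mul_sum, MvPolynomial.coeff_sum]
  unfold nMat
  refine Finset.sum_congr rfl fun c _ => ?_
  rw [← Finset.prod_mul_distrib]
  simp only [← pow_add]
  rw [coeff_prodX (fun i => 0 + (N - 1 - (σ i : Fin N)) + ∑ i_1, c i_1 i)]
  congr 1
  rw [funext_iff]
  apply propext
  refine forall_congr' fun l => ?_
  have h5 := l.2
  have h6 := (σ l).2
  simp only [nuZ]
  generalize (∑ i, c i l) = t
  omega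

end JT
end GreenII

namespace GreenII

/-! ### Part H: orbits of the shift -/
section Arith
variable {e p d : ℕ} [NeZero e]

lemma pd_eq (hp : p ∣ e) (hd : d = e / p) : p * d = e := by rw [hd, Nat.mul_div_cancel' hp]
lemma p_pos (hp : p ∣ e) : 0 < p := Nat.pos_of_dvd_of_pos hp (NeZero.pos e)

lemma hOrd_eq (hp : p ∣ e) (j : ℕ) : hOrd p j = p / Nat.gcd p j := by
  unfold hOrd
  exact ZMod.addOrderOf_coe j (p_pos hp).ne'

lemma hOrd_pos (hp : p ∣ e) (j : ℕ) : 0 < hOrd p j := by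
  rw [hOrd_eq hp]
  exact Nat.div_pos (Nat.gcd_le_left _ (p_pos hp)) (Nat.gcd_pos_of_pos_left _ (p_pos hp))

lemma Esys_eq (hp : p ∣ e) (j : ℕ) : Esys p d j = Nat.gcd p j * d := by
  unfold Esys
  rw [hOrd_eq hp, Nat.div_div_self (Nat.gcd_dvd_left p j) (p_pos hp).ne']

lemma E_mul_h (hp : p ∣ e) (hd : d = e / p) (j : ℕ) : Esys p d j * hOrd p j = e := by
  rw [Esys_eq hp, hOrd_eq hp, mul_right_comm, Nat.mul_div_cancel' (Nat.gcd_dvd_left p j), pd_eq hp hd]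

lemma E_pos (hp : p ∣ e) (hd : d = e / p) (j : ℕ) : 0 < Esys p d j := by
  apply Nat.pos_of_ne_zero
  intro h
  have := E_mul_h hp hd j
  rw [h, zero_mul] at this
  exact NeZero.ne e this.symm

lemma E_dvd_e (hp : p ∣ e) (hd : d = e / p) (j : ℕ) : Esys p d j ∣ e := ⟨_, (E_mul_h hp hd j).symm⟩

lemma E_dvd_J (hp : p ∣ e) (j : ℕ) : Esys p d j ∣ j * d := by
  rw [Esys_eq hp]
  exact Nat.mul_dvd_mul_right (Nat.gcd_dvd_right p j) d

lemma d_dvd_E (j : ℕ) : d ∣ Esys p d j := Dvd.intro_left _ rfl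

/-- `s J = 0` in `ℤ/e` iff `h ∣ s` -/
lemma sJ_zero (hp : p ∣ e) (hd : d = e / p) (j s : ℕ) : ((s * j * d : ℕ) : ZMod e) = 0 ↔ hOrd p j ∣ s := by
  have hd0 : 0 < d := Nat.pos_of_ne_zero (by
    intro h; have := pd_eq hp hd; rw [h, mul_zero] at this; exact NeZero.ne e this.symm)
  rw [ZMod.natCast_eq_zero_iff]
  unfold hOrd
  rw [addOrderOf_dvd_iff_nsmul_eq_zero, nsmul_eq_mul, ← Nat.cast_mul, ZMod.natCast_eq_zero_iff]
  conv_lhs => rw [← pd_eq hp hd]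
  exact Nat.mul_dvd_mul_iff_right hd0

lemma exists_s (hp : p ∣ e) (hd : d = e / p) (j : ℕ) (t : ℕ) :
    ∃ s : ℕ, ((s * j * d : ℕ) : ZMod e) = ((Esys p d j * t : ℕ) : ZMod e) := by
  have hb := Nat.gcd_eq_gcd_ab p j
  have hp0 := p_pos hp
  refine ⟨((Nat.gcdB p j) % (p:ℤ)).toNat * t, ?_⟩
  have h1 : 0 ≤ (Nat.gcdB p j) % (p:ℤ) := Int.emod_nonneg _ (by exact_mod_cast hp0.ne')
  have h2 : ((((Nat.gcdB p j) % (p:ℤ)).toNat * t * j * d : ℕ) : ℤ) = ((Nat.gcdB p j) % (p:ℤ)) * t * j * d := by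
    push_cast; rw [Int.toNat_of_nonneg h1]
  rw [← Int.cast_natCast (R := ZMod e), ← Int.cast_natCast (R := ZMod e) (Esys p d j * t), h2, ZMod.intCast_eq_intCast_iff_dvd_sub,
    Esys_eq hp]
  have h3 := Int.emod_add_mul_ediv (Nat.gcdB p j) p
  have h4 : (e : ℤ) = p * d := by exact_mod_cast (pd_eq hp hd).symm
  rw [h4]
  push_cast
  rw [hb]
  refine ⟨Nat.gcdA p j * t + (Nat.gcdB p j / (p:ℤ)) * t * j, ?_⟩
  have h5 : (Nat.gcdB p j) % (p:ℤ) = Nat.gcdB p j - p * (Nat.gcdB p j / (p:ℤ)) := by linarith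
  rw [h5]; ring

end Arith

section Orb
open Matrix
variable {e n d p : ℕ} [NeZero e] {m : ZMod e → ℕ} 

lemma m_add (hm : ∀ k, m (k + (d : ZMod e)) = m k) (k : ZMod e) (i : ℕ) : m (k + ((i * d : ℕ) : ZMod e)) = m k := by
  induction i with
  | zero => simp
  | succ i ih => rw [← ih, ← hm (k + ((i*d:ℕ):ZMod e))]; congr 1; push_cast; ring

lemma val_mod_add (hp : p ∣ e) (hd : d = e / p) (j : ℕ) (k : ZMod e) (t : ℕ) (ht : Esys p d j ∣ t) :
    (k + (t : ZMod e)).val % Esys p d j = k.val % Esys p d j := by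
  rw [ZMod.val_add, Nat.mod_mod_of_dvd _ (E_dvd_e hp hd j), Nat.add_mod, ZMod.val_natCast,
    Nat.mod_mod_of_dvd _ (E_dvd_e hp hd j), Nat.mod_eq_zero_of_dvd ht, add_zero, Nat.mod_mod]

lemma m_red (hm : ∀ k, m (k + (d : ZMod e)) = m k) (j : ℕ) (k : ZMod e) :
    m k = m ((k.val % Esys p d j : ℕ) : ZMod e) := by
  obtain ⟨t, ht⟩ := d_dvd_E (p := p) (d := d) j
  have h := m_add hm ((k.val % Esys p d j : ℕ) : ZMod e) (t * (k.val / Esys p d j))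
  rw [← h]
  congr 1
  have h2 := Nat.mod_add_div k.val (Esys p d j)
  conv_lhs => rw [← ZMod.natCast_zmod_val k, ← h2]
  rw [Nat.cast_add]
  congr 2
  rw [show Esys p d j * (k.val / Esys p d j) = (d * t) * (k.val / Esys p d j) by rw [← ht]]
  ring

/-- representatives of orbits -/
abbrev Bq (m : ZMod e → ℕ) (E : ℕ) := Σ k : Fin E, Fin (m ((k : ℕ) : ZMod e))

variable (hp : p ∣ e) (hd : d = e / p) (hm : ∀ k, m (k + (d : ZMod e)) = m k) (j : ℕ)

include hp hd hm in
noncomputable def rB (b : BIdx e m) : Bq m (Esys p d j) :=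
  ⟨⟨b.1.val % Esys p d j, Nat.mod_lt _ (E_pos hp hd j)⟩, Fin.cast (m_red hm j b.1) b.2⟩

def iB {E : ℕ} (b : Bq m E) : BIdx e m := ⟨((b.1 : ℕ) : ZMod e), b.2⟩

lemma bq_ext {E : ℕ} {b b' : Bq m E} (h1 : b.1.val = b'.1.val) (h2 : b.2.val = b'.2.val) : b = b' := by
  obtain ⟨k, i⟩ := b
  obtain ⟨k', i'⟩ := b'
  have h3 : k = k' := Fin.ext h1
  subst h3
  have h4 : i = i' := Fin.ext h2
  rw [h4]

lemma rB_iB (b : Bq m (Esys p d j)) : rB hp hd hm j (iB b) = b := by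
  apply bq_ext
  · show ((b.1.val : ZMod e)).val % Esys p d j = b.1.val
    rw [ZMod.val_natCast, Nat.mod_mod_of_dvd _ (E_dvd_e hp hd j), Nat.mod_eq_of_lt b.1.2]
  · rfl

lemma f_pow (s : ℕ) (b : BIdx e m) : ((tE e d m hm ^ j) ^ s) b = (tE e d m hm ^ (s * j)) b := by
  rw [← pow_mul, mul_comm]

lemma rB_f_pow (s : ℕ) (b : BIdx e m) : rB hp hd hm j (((tE e d m hm ^ j) ^ s) b) = rB hp hd hm j b := by
  apply bq_ext
  · show (((tE e d m hm ^ j) ^ s) b).1.val % Esys p d j = b.1.val % Esys p d j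
    rw [f_pow, tE_pow_fst, val_mod_add hp hd]
    rw [mul_assoc]
    exact (E_dvd_J hp j).mul_left s
  · show (((tE e d m hm ^ j) ^ s) b).2.val = b.2.val
    rw [f_pow, tE_pow_snd]

lemma rB_f (b : BIdx e m) : rB hp hd hm j ((tE e d m hm ^ j) b) = rB hp hd hm j b := by
  have := rB_f_pow hp hd hm j 1 b
  rwa [pow_one] at this

lemma exists_orb (k : ZMod e) : ∃ s < hOrd p j, ∀ b : BIdx e m, b.1 = k → ((tE e d m hm ^ j) ^ s) (iB (rB hp hd hm j b)) = b := by
  obtain ⟨s, hs⟩ := exists_s hp hd j (k.val / Esys p d j)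
  refine ⟨s % hOrd p j, Nat.mod_lt _ (hOrd_pos hp j), fun b hb => ?_⟩
  have hs' : (((s % hOrd p j) * j * d : ℕ) : ZMod e) = ((s * j * d : ℕ) : ZMod e) := by
    have h1 := (sJ_zero hp hd j (hOrd p j * (s / hOrd p j))).2 (Dvd.intro _ rfl)
    conv_rhs => rw [← Nat.mod_add_div s (hOrd p j)]
    rw [add_mul, add_mul, Nat.cast_add, h1, add_zero]
  apply bidx_ext
  · rw [f_pow, tE_pow_fst, hs', hs]
    show ((b.1.val % Esys p d j : ℕ) : ZMod e) + _ = b.1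
    rw [← Nat.cast_add, hb, Nat.mod_add_div, ZMod.natCast_zmod_val]
  · rw [f_pow, tE_pow_snd]; rfl

/-- orbit decomposition of the basis -/
noncomputable def orbE : Bq m (Esys p d j) × Fin (hOrd p j) ≃ BIdx e m :=
  Equiv.ofBijective (fun z => ((tE e d m hm ^ j) ^ (z.2 : ℕ)) (iB z.1)) (by
    constructor
    · rintro ⟨b, s⟩ ⟨b', s'⟩ h
      simp only at h
      have h1 := congrArg (rB hp hd hm j) h
      rw [rB_f_pow, rB_f_pow, rB_iB, rB_iB] at h1
      subst h1
      have key : ∀ s s' : Fin (hOrd p j), s.val ≤ s'.val → ((tE e d m hm ^ j) ^ (s : ℕ)) (iB b) = ((tE e d m hm ^ j) ^ (s' : ℕ)) (iB b) → s = s' := by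
        intro s s' hle h
        have h2 := congrArg Sigma.fst h
        rw [f_pow, f_pow, tE_pow_fst, tE_pow_fst] at h2
        have h3 := add_left_cancel h2
        have h4 : (((s'.val - s.val) * j * d : ℕ) : ZMod e) = 0 := by
          rw [Nat.sub_mul, Nat.sub_mul, Nat.cast_sub (by gcongr), h3, sub_self]
        rw [sJ_zero hp hd] at h4
        have h5 := Nat.eq_zero_of_dvd_of_lt h4 (by have := s'.2; omega)
        apply Fin.ext; omega
      rcases le_total s.val s'.val with h2 | h2
      · rw [key s s' h2 h]
      · rw [key s' s h2 h.symm]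
    · intro b
      obtain ⟨s, hs, h⟩ := exists_orb hp hd hm j b.1
      exact ⟨(rB hp hd hm j b, ⟨s, hs⟩), h b rfl⟩)

lemma orbE_apply (z) : orbE hp hd hm j z = ((tE e d m hm ^ j) ^ (z.2 : ℕ)) (iB z.1) := rfl

lemma sum_orb {M : Type*} [AddCommMonoid M] (g : Bq m (Esys p d j) → M) :
    ∑ b, g (rB hp hd hm j b) = hOrd p j • ∑ b', g b' := by
  rw [← Equiv.sum_comp (orbE hp hd hm j), Fintype.sum_prod_type]
  simp only [orbE_apply, rB_f_pow, rB_iB, Finset.sum_const, Finset.card_univ, Fintype.card_fin]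
  rw [← Finset.smul_sum]

lemma prod_orb (xv : BIdx e m → ℂ) (g : Bq m (Esys p d j) → ℕ) :
    ∏ b, xv b ^ g (rB hp hd hm j b) = ∏ b' : Bq m (Esys p d j), (Xvar e p d m xv j b'.1 b'.2) ^ g b' := by
  rw [← Equiv.prod_comp (orbE hp hd hm j), Fintype.prod_prod_type]
  refine Finset.prod_congr rfl fun b _ => ?_
  simp only [orbE_apply, rB_f_pow, rB_iB]
  rw [Finset.prod_pow]
  congr 1
  unfold Xvar
  rw [Finset.prod_range]
  refine Finset.prod_congr rfl fun s _ => ?_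
  have h1 : ((tE e d m hm ^ j) ^ (s : ℕ) : Equiv.Perm _) (iB b)
    = ⟨(((b.1 : ℕ) + s * j * d : ℕ) : ZMod e), ⟨b.2, by
      rw [Nat.cast_add, m_add hm]; exact b.2.2⟩⟩ := by
    apply bidx_ext
    · rw [f_pow, tE_pow_fst]; simp [iB]
    · rw [f_pow, tE_pow_snd]; rfl
  rw [h1]
  unfold xval
  rw [dif_pos]

lemma f_col (b b' : BIdx e m) : ((tE e d m hm ^ j) b).1 = ((tE e d m hm ^ j) b').1 ↔ b.1 = b'.1 := by
  rw [tE_pow_fst, tE_pow_fst, add_left_inj]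

end Orb
end GreenII

namespace GreenII

/-! ### Part I: counting -/
section TyGen
variable {P Q : Type*} [Fintype P] {n : ℕ}

lemma ty_map (g : P → Q) (C : Fin n → P) (a : Q) :
    ty (fun s => g (C s)) a = ∑ p, if g p = a then ty C p else 0 := by
  simp only [ty_apply]
  rw [Finset.card_filter, ← Finset.sum_fiberwise_of_maps_to (s := Finset.univ) (t := Finset.univ) (g := C) (fun _ _ => Finset.mem_univ _)]
  refine Finset.sum_congr rfl fun p _ => ?_
  rw [Finset.sum_congr rfl (g := fun _ => if g p = a then 1 else 0)]
  · split_ifs <;> simp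
  · intro s hs
    rw [(Finset.mem_filter.1 hs).2]

lemma exists_ty (N : P →₀ ℕ) (h : ∑ p, N p = n) : ∃ C : Fin n → P, ty C = N := by
  have h1 : Fintype.card (Σ p, Fin (N p)) = n := by simp [h]
  let φ := Fintype.equivFinOfCardEq h1
  refine ⟨fun s => (φ.symm s).1, ?_⟩
  ext p
  rw [ty_apply, ← Fintype.card_subtype]
  have h2 : {s : Fin n // (φ.symm s).1 = p} ≃ {z : Σ p, Fin (N p) // z.1 = p} :=
    Equiv.subtypeEquiv φ.symm (fun s => Iff.rfl)
  rw [Fintype.card_congr (h2.trans (Equiv.sigmaSubtype p)), Fintype.card_fin]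

end TyGen

section CountB
open Matrix
variable {e n d p : ℕ} [NeZero e] {m : ZMod e → ℕ}

lemma sum_snd (N : Pr e m → ℕ) (a : BIdx e m) :
    ∑ p : Pr e m, (if p.1.2 = a then N p else 0) = ∑ i : Fin (m a.1), N ⟨(⟨a.1, i⟩, a), rfl⟩ := by
  symm
  apply Fintype.sum_of_injective (fun i : Fin (m a.1) => (⟨(⟨a.1, i⟩, a), rfl⟩ : Pr e m))
  · intro i i' h
    have h1 := congrArg (fun p : Pr e m => p.1.1.2.val) h
    exact Fin.ext h1
  · rintro ⟨⟨b, b'⟩, h⟩ hi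
    rw [if_neg]
    rintro rfl
    apply hi
    obtain ⟨k, i⟩ := b
    obtain ⟨k', i'⟩ := b'
    simp only at h
    subst h
    exact ⟨i, rfl⟩
  · intro i
    rw [if_pos rfl]

lemma sum_fst (N : Pr e m → ℕ) (a : BIdx e m) :
    ∑ p : Pr e m, (if p.1.1 = a then N p else 0) = ∑ i : Fin (m a.1), N ⟨(a, ⟨a.1, i⟩), rfl⟩ := by
  symm
  apply Fintype.sum_of_injective (fun i : Fin (m a.1) => (⟨(a, ⟨a.1, i⟩), rfl⟩ : Pr e m))
  · intro i i' h
    have h1 := congrArg (fun p : Pr e m => p.1.2.2.val) h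
    exact Fin.ext h1
  · rintro ⟨⟨b, b'⟩, h⟩ hi
    rw [if_neg]
    rintro rfl
    apply hi
    obtain ⟨k, i⟩ := b
    obtain ⟨k', i'⟩ := b'
    simp only at h
    subst h
    exact ⟨i', rfl⟩
  · intro i
    rw [if_pos rfl]

/-- extension by zero -/
def cN {E : ℕ} (c : ∀ b : Bq m E, Fin (m ((b.1 : ℕ) : ZMod e)) → ℕ) (b : Bq m E) (i : ℕ) : ℕ :=
  if h : i < m ((b.1 : ℕ) : ZMod e) then c b ⟨i, h⟩ else 0

lemma cN_val {E : ℕ} (c : ∀ b : Bq m E, Fin (m ((b.1 : ℕ) : ZMod e)) → ℕ) (b : Bq m E) (i : Fin (m ((b.1 : ℕ) : ZMod e))) :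
    cN c b i.val = c b i := by
  unfold cN
  rw [dif_pos i.2]

lemma sum_fin_eq {a b : ℕ} (h : a = b) (g : ℕ → ℕ) : ∑ i : Fin a, g i.val = ∑ i : Fin b, g i.val := by
  subst h; rfl

variable (hp : p ∣ e) (hd : d = e / p) (hm : ∀ k, m (k + (d : ZMod e)) = m k) (j : ℕ)

/-- the type attached to a matrix of multiplicities -/
noncomputable def tyOf (c : ∀ b : Bq m (Esys p d j), Fin (m ((b.1 : ℕ) : ZMod e)) → ℕ) : Pr e m →₀ ℕ :=
  Finsupp.equivFunOnFinite.symm (fun p => cN c (rB hp hd hm j p.1.2) p.1.1.2.val)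

lemma tyOf_apply (c : ∀ b : Bq m (Esys p d j), Fin (m ((b.1 : ℕ) : ZMod e)) → ℕ) (p) :
    tyOf hp hd hm j c p = cN c (rB hp hd hm j p.1.2) p.1.1.2.val := rfl

lemma tyOf_col (c : ∀ b : Bq m (Esys p d j), Fin (m ((b.1 : ℕ) : ZMod e)) → ℕ) (a : BIdx e m) :
    ∑ p : Pr e m, (if p.1.2 = a then tyOf hp hd hm j c p else 0) = ∑ i, c (rB hp hd hm j a) i := by
  rw [sum_snd]
  simp only [tyOf_apply]
  rw [sum_fin_eq (m_red (p := p) hm j a.1) (fun i => cN c (rB hp hd hm j a) i)]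
  exact Finset.sum_congr rfl fun i _ => cN_val c (rB hp hd hm j a) i

lemma tyOf_row (c : ∀ b : Bq m (Esys p d j), Fin (m ((b.1 : ℕ) : ZMod e)) → ℕ) (a : BIdx e m) :
    ∑ p : Pr e m, (if p.1.1 = a then tyOf hp hd hm j c p else 0)
      = ∑ i, c ⟨(rB hp hd hm j a).1, i⟩ (rB hp hd hm j a).2 := by
  rw [sum_fst]
  simp only [tyOf_apply]
  refine Fintype.sum_equiv (finCongr (m_red (p := p) hm j a.1)) _ _ fun i => ?_
  exact cN_val c (⟨(rB hp hd hm j a).1, Fin.cast (m_red (p := p) hm j a.1) i⟩ : Bq m (Esys p d j)) (rB hp hd hm j a).2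

lemma fP_pow (f : Equiv.Perm (BIdx e m)) (hf : ∀ b b', (f b).1 = (f b').1 ↔ b.1 = b'.1) (N : Pr e m →₀ ℕ)
    (hN : ∀ p, N (fP f hf p) = N p) (s : ℕ) (p p' : Pr e m) (h1 : (f ^ s) p'.1.1 = p.1.1) (h2 : (f ^ s) p'.1.2 = p.1.2) :
    N p = N p' := by
  have h3 : ∀ s : ℕ, ∀ p : Pr e m, N ((fP f hf ^ s) p) = N p ∧ ((fP f hf ^ s) p).1 = ((f ^ s) p.1.1, (f ^ s) p.1.2) := by
    intro s
    induction s with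
    | zero => intro p; simp
    | succ s ih =>
      intro p
      rw [pow_succ', Equiv.Perm.mul_apply, hN, pow_succ', Equiv.Perm.mul_apply, Equiv.Perm.mul_apply]
      refine ⟨(ih p).1, ?_⟩
      have h4 := (ih p).2
      show (f ((fP f hf ^ s) p).1.1, f ((fP f hf ^ s) p).1.2) = _
      rw [h4]
  rw [← (h3 s p').1]
  congr 1
  apply Subtype.ext
  rw [(h3 s p').2, h1, h2]

lemma f_snd (b : BIdx e m) : ((tE e d m hm ^ j) b).2.val = b.2.val := tE_pow_snd hm j b

lemma tE_col (b b' : BIdx e m) : ((tE e d m hm ^ j) b).1 = ((tE e d m hm ^ j) b').1 ↔ b.1 = b'.1 := f_col hm j b b'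

lemma count_bij (μ : Bq m (Esys p d j) → ℤ) (hμ : (hOrd p j : ℤ) * ∑ b, μ b = n) (Φ : (BIdx e m → ℕ) → ℂ) :
    ∑ N ∈ ((Finset.univ : Finset (Fin n → Pr e m)).image ty).filter
          (fun N => ∀ p, N (fP (tE e d m hm ^ j) (tE_col hm j) p) = N p),
      Φ (fun a => ∑ p : Pr e m, if p.1.1 = a then N p else 0) *
       (if ∀ a, ((∑ p : Pr e m, if p.1.2 = a then N p else 0 : ℕ) : ℤ) = μ (rB hp hd hm j a) then 1 else 0)
    = ∑ c ∈ Fintype.piFinset (fun b : Bq m (Esys p d j) => adZ (m ((b.1 : ℕ) : ZMod e)) (μ b)),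
       Φ (fun a => ∑ i, c ⟨(rB hp hd hm j a).1, i⟩ (rB hp hd hm j a).2) := by
  simp only [mul_ite, mul_one, mul_zero]
  rw [← Finset.sum_filter]
  symm
  refine Finset.sum_bij' (fun c _ => tyOf hp hd hm j c)
    (fun N _ b i => N ⟨(⟨((b.1 : ℕ) : ZMod e), i⟩, iB b), rfl⟩) ?_ ?_ ?_ ?_ ?_
  · intro c hc
    rw [Fintype.mem_piFinset] at hc
    have hcol : ∀ a, ((∑ p : Pr e m, if p.1.2 = a then tyOf hp hd hm j c p else 0 : ℕ) : ℤ) = μ (rB hp hd hm j a) := by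
      intro a
      rw [tyOf_col]
      exact (mem_adZ _ _).1 (hc _)
    rw [Finset.mem_filter, Finset.mem_filter, Finset.mem_image]
    refine ⟨⟨?_, ?_⟩, hcol⟩
    · have h1 : ∑ p, tyOf hp hd hm j c p = n := by
        have h2 : ∑ p, tyOf hp hd hm j c p = ∑ a, ∑ p : Pr e m, if p.1.2 = a then tyOf hp hd hm j c p else 0 := by
          rw [Finset.sum_comm]
          refine Finset.sum_congr rfl fun p _ => ?_
          rw [Finset.sum_ite_eq, if_pos (Finset.mem_univ _)]
        have h3 : ((∑ p, tyOf hp hd hm j c p : ℕ) : ℤ) = n := by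
          rw [h2, Nat.cast_sum, Finset.sum_congr rfl fun a _ => hcol a, sum_orb, nsmul_eq_mul, hμ]
        exact_mod_cast h3
      obtain ⟨C, hC⟩ := exists_ty _ h1
      exact ⟨C, Finset.mem_univ _, hC⟩
    · intro p
      rw [tyOf_apply, tyOf_apply]
      show cN c (rB hp hd hm j ((tE e d m hm ^ j) p.1.2)) ((tE e d m hm ^ j) p.1.1).2.val = _
      rw [rB_f, f_snd]
  · intro N hN
    rw [Finset.mem_filter] at hN
    rw [Fintype.mem_piFinset]
    intro b
    rw [mem_adZ]
    have h1 := hN.2 (iB b)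
    rw [sum_snd, rB_iB] at h1
    exact h1
  · intro c hc
    funext b i
    show tyOf hp hd hm j c _ = _
    rw [tyOf_apply]
    show cN c (rB hp hd hm j (iB b)) i.val = _
    rw [rB_iB, cN_val]
  · intro N hN
    rw [Finset.mem_filter, Finset.mem_filter] at hN
    ext p
    rw [tyOf_apply]
    obtain ⟨s, -, hs⟩ := exists_orb hp hd hm j p.1.1.1
    let p' : Pr e m := ⟨(iB (rB hp hd hm j p.1.1), iB (rB hp hd hm j p.1.2)), by
      show ((p.1.1.1.val % Esys _ d j : ℕ) : ZMod e) = ((p.1.2.1.val % Esys _ d j : ℕ) : ZMod e)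
      rw [p.2]⟩
    rw [fP_pow _ (tE_col hm j) N hN.1.2 s p p' (hs _ rfl) (hs _ p.2.symm)]
    have h1 : p.1.1.2.val < m (((rB hp hd hm j p.1.2).1 : ℕ) : ZMod e) := by
      have := (rB hp hd hm j p.1.1).2.2
      have h2 : (rB hp hd hm j p.1.2).1 = (rB hp hd hm j p.1.1).1 := by
        apply Fin.ext
        show p.1.2.1.val % _ = p.1.1.1.val % _
        rw [p.2]
      rw [h2]
      exact this
    unfold cN
    rw [dif_pos h1]
    show N _ = N _
    congr 1
    apply Subtype.ext
    refine Prod.ext (bidx_ext ?_ rfl) rfl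
    show ((p.1.2.1.val % Esys _ d j : ℕ) : ZMod e) = ((p.1.1.1.val % Esys _ d j : ℕ) : ZMod e)
    rw [p.2]
  · intro c hc
    congr 1
    funext a
    exact (tyOf_row hp hd hm j c a).symm

lemma ip_diag_f {ζ : ℂ} (hζ : IsPrimitiveRoot ζ e) (μ : Bq m (Esys p d j) → ℤ) (hμ : (hOrd p j : ℤ) * ∑ b, μ b = n) (Φ : (BIdx e m → ℕ) → ℂ) :
    ip (fun w : Wt e n => Matrix.trace (Matrix.diagonal (fun b => Φ (ty b)) * (rhoMat e n ζ m w * permT n (tE e d m hm ^ j))))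
      (fW ζ (permT n (tE e d m hm ^ j)) (fun a => μ (rB hp hd hm j a)))
    = (Fintype.card (Wt e n) : ℂ) * ∑ c ∈ Fintype.piFinset (fun b : Bq m (Esys p d j) => adZ (m ((b.1 : ℕ) : ZMod e)) (μ b)),
       Φ (fun a => ∑ i, c ⟨(rB hp hd hm j a).1, i⟩ (rB hp hd hm j a).2) := by
  rw [← count_bij (n := n) hp hd hm j μ hμ Φ]
  refine Eq.trans (ip_count (n := n) hζ (tE e d m hm ^ j) (tE_col hm j) (fun b => Φ (ty b)) (fun b => if ∀ a, (ty b a : ℤ) = μ (rB hp hd hm j a) then 1 else 0) _ ?_) rfl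
  intro C
  have h1 : (⇑(ty (fun s => (C s).1.1)) : BIdx e m → ℕ) = fun a => ∑ p : Pr e m, if p.1.1 = a then ty C p else 0 := by
    funext a
    exact (ty_map (fun p : Pr e m => p.1.1) C a).trans (by congr!)
  have h2 : ∀ a, ty (fun s => (C s).1.2) a = ∑ p : Pr e m, if p.1.2 = a then ty C p else 0 :=
    fun a => (ty_map (fun p : Pr e m => p.1.2) C a).trans (by congr!)
  simp only [h1, h2]
  congr 1
  split_ifs <;> simp
end CountB
end GreenII

namespace GreenII

/-! ### Part J: Jacobi--Trudi combinations -/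
section ipl
variable {e n : ℕ} [NeZero e]
lemma ip_sum_left {ι : Type*} (s : Finset ι) (c : ι → ℂ) (φ : ι → Wt e n → ℂ) (ψ : Wt e n → ℂ) :
    ip (fun w => ∑ i ∈ s, c i * φ i w) ψ = ∑ i ∈ s, c i * ip (φ i) ψ := by
  unfold ip
  simp only [Finset.sum_mul, Finset.mul_sum]
  rw [Finset.sum_comm]
  refine Finset.sum_congr rfl fun i _ => Finset.sum_congr rfl fun w _ => by ring

lemma ip_sum_right {ι : Type*} (s : Finset ι) (c : ι → ℂ) (φ : ι → Wt e n → ℂ) (ψ : Wt e n → ℂ) :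
    ip ψ (fun w => ∑ i ∈ s, c i * φ i w) = ∑ i ∈ s, star (c i) * ip ψ (φ i) := by
  unfold ip
  simp only [star_sum, star_mul', Finset.mul_sum]
  rw [Finset.sum_comm]
  refine Finset.sum_congr rfl fun i _ => Finset.sum_congr rfl fun w _ => by ring

lemma ip_star (φ ψ : Wt e n → ℂ) : star (ip φ ψ) = ip ψ φ := by
  unfold ip
  rw [star_sum]
  refine Finset.sum_congr rfl fun w _ => by rw [star_mul', star_star, mul_comm]

lemma eq_of_ip (φ ψ : Wt e n → ℂ) (C : ℝ) (h1 : ip φ φ = C) (h2 : ip φ ψ = C) (h3 : ip ψ ψ = C) : φ = ψ := by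
  have h4 : ip ψ φ = C := by rw [← ip_star, h2]; simp
  have h5 : ∑ w, (‖φ w - ψ w‖ ^ 2 : ℝ) = 0 := by
    have h6 : ((∑ w, (‖φ w - ψ w‖ ^ 2 : ℝ) : ℝ) : ℂ) = ip φ φ - ip φ ψ - ip ψ φ + ip ψ ψ := by
      unfold ip
      rw [← Finset.sum_sub_distrib, ← Finset.sum_sub_distrib, ← Finset.sum_add_distrib, Complex.ofReal_sum]
      refine Finset.sum_congr rfl fun w _ => ?_
      rw [Complex.ofReal_pow, ← Complex.mul_conj']
      simp only [map_sub, Complex.star_def]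
      ring
    rw [h1, h2, h3, h4] at h6
    have h7 : ((∑ w, (‖φ w - ψ w‖ ^ 2 : ℝ) : ℝ) : ℂ) = 0 := by rw [h6]; ring
    exact_mod_cast h7
  funext w
  have h6 := (Finset.sum_eq_zero_iff_of_nonneg (fun w _ => sq_nonneg _)).1 h5 w (Finset.mem_univ w)
  have h7 : ‖φ w - ψ w‖ = 0 := by simpa using h6
  exact sub_eq_zero.1 (norm_eq_zero.1 h7)
end ipl

section JTB
open Matrix
variable {e n d p : ℕ} [NeZero e] {m : ZMod e → ℕ}

lemma sum_pi_sigma {E : ℕ} (t : ∀ b : Bq m E, Finset (Fin (m ((b.1 : ℕ) : ZMod e)) → ℕ))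
    (G : ∀ k : Fin E, (Fin (m ((k : ℕ) : ZMod e)) → Fin (m ((k : ℕ) : ZMod e)) → ℕ) → ℂ) :
    ∑ c ∈ Fintype.piFinset t, ∏ k, G k (fun i => c ⟨k, i⟩)
      = ∏ k, ∑ c ∈ Fintype.piFinset (fun i => t ⟨k, i⟩), G k c := by
  rw [Finset.prod_univ_sum]
  refine Finset.sum_bij' (fun c _ k i => c ⟨k, i⟩) (fun c _ b => c b.1 b.2) ?_ ?_ ?_ ?_ ?_
  · intro c hc
    simp only [Fintype.mem_piFinset] at hc ⊢
    intro k i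
    exact hc ⟨k, i⟩
  · intro c hc
    simp only [Fintype.mem_piFinset] at hc ⊢
    intro b
    exact hc b.1 b.2
  · intro c _; rfl
  · intro c _; rfl
  · intro c _; rfl

lemma prod_sum_sum {ι : Type*} [Fintype ι] [DecidableEq ι] {A : ι → Type*} [∀ i, Fintype (A i)] (G : ∀ i, A i → ℂ) :
    ∏ i, ∑ a, G i a = ∑ a : ∀ i, A i, ∏ i, G i (a i) := by
  rw [Finset.prod_univ_sum, Fintype.piFinset_univ]

variable (hp : p ∣ e) (hd : d = e / p) (hm : ∀ k, m (k + (d : ZMod e)) = m k) (j : ℕ)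

lemma sum_pi_nMat (μ κ : Bq m (Esys p d j) → ℤ) :
    ∑ c ∈ Fintype.piFinset (fun b : Bq m (Esys p d j) => adZ (m ((b.1 : ℕ) : ZMod e)) (μ b)),
       (if ∀ a, ((∑ i, c ⟨(rB hp hd hm j a).1, i⟩ (rB hp hd hm j a).2 : ℕ) : ℤ) = κ (rB hp hd hm j a) then (1:ℂ) else 0)
    = ∏ k, nMat (fun i => κ ⟨k, i⟩) (fun i => μ ⟨k, i⟩) := by
  unfold nMat
  rw [← sum_pi_sigma (fun b : Bq m (Esys p d j) => adZ (m ((b.1 : ℕ) : ZMod e)) (μ b))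
    (fun k c => if ∀ l, ((∑ i, c i l : ℕ) : ℤ) = κ ⟨k, l⟩ then (1:ℂ) else 0)]
  refine Finset.sum_congr rfl fun c _ => ?_
  rw [Finset.prod_ite_zero]
  simp only [Finset.prod_const_one]
  congr 1
  apply propext
  constructor
  · intro h k _ l
    have := h (iB ⟨k, l⟩)
    rw [rB_iB] at this
    exact this
  · intro h a
    exact h _ (Finset.mem_univ _) _

lemma sum_pi_hZ (xv : BIdx e m → ℂ) (μ : Bq m (Esys p d j) → ℤ) :
    ∑ c ∈ Fintype.piFinset (fun b : Bq m (Esys p d j) => adZ (m ((b.1 : ℕ) : ZMod e)) (μ b)),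
       ∏ a, xv a ^ (∑ i, c ⟨(rB hp hd hm j a).1, i⟩ (rB hp hd hm j a).2)
    = ∏ k : Fin (Esys p d j), ∏ i, hZ (m ((k : ℕ) : ZMod e)) (μ ⟨k, i⟩) (fun i => Xvar e p d m xv j k i) := by
  have h1 : ∀ k : Fin (Esys p d j), ∏ i, hZ (m ((k : ℕ) : ZMod e)) (μ ⟨k, i⟩) (fun i => Xvar e p d m xv j k i)
      = ∑ c ∈ Fintype.piFinset (fun i => adZ (m ((k : ℕ) : ZMod e)) (μ ⟨k, i⟩)), ∏ l : Fin (m ((k : ℕ) : ZMod e)), (Xvar e p d m xv j k l) ^ (∑ i, c i l) :=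
    fun k => prod_hZ _ _
  simp only [h1]
  rw [← sum_pi_sigma (fun b : Bq m (Esys p d j) => adZ (m ((b.1 : ℕ) : ZMod e)) (μ b))
    (fun k c => ∏ l : Fin (m ((k : ℕ) : ZMod e)), (Xvar e p d m xv j k l) ^ (∑ i, c i l))]
  refine Finset.sum_congr rfl fun c _ => ?_
  rw [prod_orb hp hd hm j xv (fun b => ∑ i, c ⟨b.1, i⟩ b.2), Fintype.prod_sigma]

/-- Jacobi--Trudi weights on orbit representatives -/
noncomputable def nuS {E : ℕ} (m : ZMod e → ℕ) (α : ZMod e → Multiset ℕ) (σ : ∀ k : Fin E, Equiv.Perm (Fin (m ((k : ℕ) : ZMod e)))) (b : Bq m E) : ℤ :=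
  nuZ (fun i : Fin (m ((b.1 : ℕ) : ZMod e)) => lamOf (α ((b.1 : ℕ) : ZMod e)) i) (σ b.1) b.2

noncomputable def sgS {E : ℕ} (m : ZMod e → ℕ) (σ : ∀ k : Fin E, Equiv.Perm (Fin (m ((k : ℕ) : ZMod e)))) : ℂ :=
  ∏ k, ((Equiv.Perm.sign (σ k) : ℤ) : ℂ)

lemma sgS_star {E : ℕ} (σ : ∀ k : Fin E, Equiv.Perm (Fin (m ((k : ℕ) : ZMod e)))) : star (sgS m σ) = sgS m σ := by
  unfold sgS
  rw [star_prod]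
  refine Finset.prod_congr rfl fun k _ => ?_
  simp

lemma theta_fix_wt (α : ZMod e → Multiset ℕ) (hα : (theta e d)^[j] α = α) (a : BIdx e m) :
    wtA m α a = wtA m α (iB (rB hp hd hm j a)) := by
  obtain ⟨s, -, hs⟩ := exists_orb hp hd hm j a.1
  have h := hs a rfl
  have h1 : ∀ s : ℕ, ∀ b : BIdx e m, wtA m α (((tE e d m hm ^ j) ^ s) b) = wtA m α b := by
    intro s
    induction s with
    | zero => intro b; rfl
    | succ s ih =>
      intro b
      rw [pow_succ', Equiv.Perm.mul_apply]
      refine Eq.trans ?_ (ih b)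
      unfold wtA
      rw [tE_pow_snd, tE_pow_fst]
      congr 1
      conv_lhs => rw [← hα]
      rw [theta_iter, add_sub_cancel_right]
  conv_lhs => rw [← h]
  exact h1 s _

include hp hd hm in
lemma nuS_sum (hmn : ∀ k, n ≤ m k) (α : ZMod e → Multiset ℕ) (hα : (theta e d)^[j] α = α) (hα2 : IsEPartition e n α)
    (σ : ∀ k : Fin (Esys p d j), Equiv.Perm (Fin (m ((k : ℕ) : ZMod e)))) :
    (hOrd p j : ℤ) * ∑ b, nuS m α σ b = n := by
  have h1 : ∑ b, nuS m α σ b = ∑ b : Bq m (Esys p d j), (wtA m α (iB b) : ℤ) := by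
    rw [Fintype.sum_sigma, Fintype.sum_sigma]
    refine Finset.sum_congr rfl fun k _ => ?_
    unfold nuS nuZ
    simp only
    rw [Finset.sum_add_distrib, Equiv.sum_comp (σ k) (fun i => ((i : ℕ) : ℤ)), Finset.sum_sub_distrib, sub_add_cancel]
    rfl
  have h2 := sum_orb hp hd hm j (fun b => (wtA m α (iB b) : ℤ))
  rw [h1, ← nsmul_eq_mul, ← h2]
  have h3 := wtA_sum hmn hα2
  rw [← h3, Nat.cast_sum]
  exact Finset.sum_congr rfl fun a _ => by rw [theta_fix_wt hp hd hm j α hα a]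

/-- Jacobi--Trudi combination -/
noncomputable def FW (ζ : ℂ) (α : ZMod e → Multiset ℕ) : Wt e n → ℂ := fun w =>
  ∑ σ : ∀ k : Fin (Esys p d j), Equiv.Perm (Fin (m ((k : ℕ) : ZMod e))),
    sgS m σ * fW ζ (permT n (tE e d m hm ^ j)) (fun a => nuS m α σ (rB hp hd hm j a)) w

noncomputable def GW (ζ : ℂ) (xv : BIdx e m → ℂ) : Wt e n → ℂ := fun w =>
  Matrix.trace (Matrix.diagonal (fun b : TIdx e n m => ∏ a, xv a ^ ty b a) * (rhoMat e n ζ m w * permT n (tE e d m hm ^ j)))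

lemma ip_FF {ζ : ℂ} (hζ : IsPrimitiveRoot ζ e) (hmn : ∀ k, n ≤ m k) (α : ZMod e → Multiset ℕ) (hα : (theta e d)^[j] α = α) (hα2 : IsEPartition e n α) :
    ip (FW (n := n) hp hd hm j ζ α) (FW hp hd hm j ζ α) = (Fintype.card (Wt e n) : ℂ) := by
  have h1 : ∀ σ τ : ∀ k : Fin (Esys p d j), Equiv.Perm (Fin (m ((k : ℕ) : ZMod e))),
      ip (fW ζ (permT n (tE e d m hm ^ j)) (fun a => nuS m α σ (rB hp hd hm j a)))
         (fW ζ (permT n (tE e d m hm ^ j)) (fun a => nuS m α τ (rB hp hd hm j a)))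
      = (Fintype.card (Wt e n) : ℂ) * ∏ k, nMat (fun i => nuS m α σ ⟨k, i⟩) (fun i => nuS m α τ ⟨k, i⟩) := by
    intro σ τ
    rw [← sum_pi_nMat hp hd hm j]
    exact ip_diag_f hp hd hm j hζ (nuS m α τ) (nuS_sum hp hd hm j hmn α hα hα2 τ)
      (fun N => if ∀ a, (N a : ℤ) = nuS m α σ (rB hp hd hm j a) then 1 else 0)
  have h2 : ip (FW (n := n) hp hd hm j ζ α) (FW hp hd hm j ζ α)
    = ∑ σ : ∀ k : Fin (Esys p d j), Equiv.Perm (Fin (m ((k : ℕ) : ZMod e))), sgS m σ *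
       ∑ τ : ∀ k : Fin (Esys p d j), Equiv.Perm (Fin (m ((k : ℕ) : ZMod e))), star (sgS m τ) *
      ((Fintype.card (Wt e n) : ℂ) * ∏ k, nMat (fun i => nuS m α σ ⟨k, i⟩) (fun i => nuS m α τ ⟨k, i⟩)) := by
    refine (ip_sum_left _ _ _ _).trans ?_
    refine Finset.sum_congr rfl fun σ _ => ?_
    congr 1
    refine (ip_sum_right _ _ _ _).trans ?_
    refine Finset.sum_congr rfl fun τ _ => ?_
    rw [h1]
  rw [h2]
  have h3 : ∏ k : Fin (Esys p d j), ∑ σ : Equiv.Perm (Fin (m ((k : ℕ) : ZMod e))), ∑ τ : Equiv.Perm (Fin (m ((k : ℕ) : ZMod e))),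
      ((Equiv.Perm.sign σ : ℤ) : ℂ) * ((Equiv.Perm.sign τ : ℤ) : ℂ) *
        nMat (nuZ (fun i => lamOf (α ((k : ℕ) : ZMod e)) i) σ) (nuZ (fun i => lamOf (α ((k : ℕ) : ZMod e)) i) τ) = 1 := by
    refine Finset.prod_eq_one fun k _ => JT_coeff _ ?_
    intro i i' h
    exact lamOf_antitone _ h
  rw [prod_sum_sum] at h3
  simp only [prod_sum_sum] at h3
  calc _ = (Fintype.card (Wt e n) : ℂ) * 1 := ?_
    _ = _ := mul_one _
  rw [← h3, Finset.mul_sum]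
  refine Finset.sum_congr rfl fun σ _ => ?_
  rw [Finset.mul_sum, Finset.mul_sum]
  refine Finset.sum_congr rfl fun τ _ => ?_
  rw [sgS_star, Finset.prod_mul_distrib, Finset.prod_mul_distrib]
  unfold sgS nuS
  ring_nf

lemma schurFin_eq (N : ℕ) (μ : Multiset ℕ) (v : ℕ → ℂ) :
    schurFin N μ v = (HM (fun i : Fin N => lamOf μ i) (fun i : Fin N => v i)).det := by
  unfold schurFin HM
  congr 1
  ext i l
  simp only [Matrix.of_apply]
  unfold hZ adZ
  have h : ((lamOf μ i : ℤ) + l) - i = (lamOf μ i : ℤ) - i + l := by ring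
  split_ifs with h1 h2 h2
  · unfold hcomp; rw [h]
  · exact absurd (h ▸ h1) h2
  · exact absurd (h ▸ h2) h1
  · simp

lemma ip_GF {ζ : ℂ} (hζ : IsPrimitiveRoot ζ e) (hmn : ∀ k, n ≤ m k) (xv : BIdx e m → ℂ) (α : ZMod e → Multiset ℕ) (hα : (theta e d)^[j] α = α) (hα2 : IsEPartition e n α) :
    ip (GW (n := n) hm j ζ xv) (FW hp hd hm j ζ α) = (Fintype.card (Wt e n) : ℂ) * schurBrace e p d m xv j α := by
  have h1 : ∀ τ : ∀ k : Fin (Esys p d j), Equiv.Perm (Fin (m ((k : ℕ) : ZMod e))),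
      ip (GW (n := n) hm j ζ xv)
         (fW ζ (permT n (tE e d m hm ^ j)) (fun a => nuS m α τ (rB hp hd hm j a)))
      = (Fintype.card (Wt e n) : ℂ) * ∏ k : Fin (Esys p d j), ∏ i, hZ (m ((k : ℕ) : ZMod e)) (nuS m α τ ⟨k, i⟩) (fun i => Xvar e p d m xv j k i) := by
    intro τ
    rw [← sum_pi_hZ hp hd hm j]
    exact ip_diag_f hp hd hm j hζ (nuS m α τ) (nuS_sum hp hd hm j hmn α hα hα2 τ) (fun N => ∏ a, xv a ^ N a)
  refine (ip_sum_right _ _ _ _).trans ?_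
  simp only [h1, sgS_star]
  have h2 : schurBrace e p d m xv j α = ∏ k : Fin (Esys p d j), (HM (fun i : Fin (m ((k : ℕ) : ZMod e)) => lamOf (α ((k : ℕ) : ZMod e)) i)
      (fun i : Fin (m ((k : ℕ) : ZMod e)) => Xvar e p d m xv j k i)).det := by
    unfold schurBrace sAlphaSys
    rw [Finset.prod_range]
    refine Finset.prod_congr rfl fun k _ => ?_
    rw [schurFin_eq]
    unfold braceF
    rw [if_pos k.2]
    rfl
  rw [h2]
  simp only [HM_det]
  rw [prod_sum_sum, Finset.mul_sum]
  refine Finset.sum_congr rfl fun σ _ => ?_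
  rw [Finset.prod_mul_distrib]
  unfold sgS nuS
  ring_nf
end JTB
end GreenII

namespace GreenII

lemma perm_sum_le {N : ℕ} (σ : Equiv.Perm (Fin N)) : ∑ i : Fin N, (i : ℤ) * ((σ i : Fin N) : ℤ) ≤ ∑ i : Fin N, (i : ℤ) * (i : ℤ) := by
  have h1 : 0 ≤ ∑ i : Fin N, ((i : ℤ) - ((σ i : Fin N) : ℤ)) ^ 2 := Finset.sum_nonneg fun i _ => sq_nonneg _
  have h2 := Equiv.sum_comp σ (fun i : Fin N => (i : ℤ) * (i : ℤ))
  have h3 : ∑ i : Fin N, ((i : ℤ) - ((σ i : Fin N) : ℤ)) ^ 2 = ∑ i : Fin N, (i : ℤ) * (i : ℤ) - 2 * ∑ i : Fin N, (i : ℤ) * ((σ i : Fin N) : ℤ)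
     + ∑ i : Fin N, ((σ i : Fin N) : ℤ) * ((σ i : Fin N) : ℤ) := by
    rw [Finset.mul_sum, ← Finset.sum_sub_distrib, ← Finset.sum_add_distrib]
    exact Finset.sum_congr rfl fun i _ => by ring
  linarith

lemma perm_sum_lt {N : ℕ} (σ : Equiv.Perm (Fin N)) (hσ : σ ≠ 1) : ∑ i : Fin N, (i : ℤ) * ((σ i : Fin N) : ℤ) < ∑ i : Fin N, (i : ℤ) * (i : ℤ) := by
  have h1 : 0 < ∑ i : Fin N, ((i : ℤ) - ((σ i : Fin N) : ℤ)) ^ 2 := by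
    refine Finset.sum_pos' (fun i _ => sq_nonneg _) ?_
    by_contra h
    push Not at h
    apply hσ
    ext i
    have h4 := h i (Finset.mem_univ i)
    have h5 : (i : ℤ) - ((σ i : Fin N) : ℤ) = 0 := by
      have := le_antisymm h4 (sq_nonneg _)
      exact pow_eq_zero_iff (two_ne_zero) |>.1 this
    rw [Equiv.Perm.one_apply]
    omega
  have h2 := Equiv.sum_comp σ (fun i : Fin N => (i : ℤ) * (i : ℤ))
  have h3 : ∑ i : Fin N, ((i : ℤ) - ((σ i : Fin N) : ℤ)) ^ 2 = ∑ i : Fin N, (i : ℤ) * (i : ℤ) - 2 * ∑ i : Fin N, (i : ℤ) * ((σ i : Fin N) : ℤ)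
     + ∑ i : Fin N, ((σ i : Fin N) : ℤ) * ((σ i : Fin N) : ℤ) := by
    rw [Finset.mul_sum, ← Finset.sum_sub_distrib, ← Finset.sum_add_distrib]
    exact Finset.sum_congr rfl fun i _ => by ring
  linarith

section
open Matrix
variable {e n d p : ℕ} [NeZero e] {m : ZMod e → ℕ}
variable (hp : p ∣ e) (hd : d = e / p) (hm : ∀ k, m (k + (d : ZMod e)) = m k) (j : ℕ)

lemma height_orb (ν : Bq m (Esys p d j) → ℤ) :
    height (fun a => ν (rB hp hd hm j a)) = (hOrd p j : ℤ) * ∑ k : Fin (Esys p d j), ∑ i : Fin (m ((k : ℕ) : ZMod e)), ((i : ℕ) : ℤ) * ν ⟨k, i⟩ := by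
  unfold height
  have := sum_orb hp hd hm j (fun b => (b.2.val : ℤ) * ν b)
  rw [nsmul_eq_mul] at this
  refine Eq.trans ?_ (this.trans (congrArg _ (Fintype.sum_sigma _)))
  rfl

lemma height_lt (α : ZMod e → Multiset ℕ) (hα : (theta e d)^[j] α = α)
    (σ : ∀ k : Fin (Esys p d j), Equiv.Perm (Fin (m ((k : ℕ) : ZMod e)))) (hσ : σ ≠ 1) :
    height (fun a => nuS m α σ (rB hp hd hm j a)) < height (fun a => (wtA m α a : ℤ)) := by
  have h1 : (fun a => (wtA m α a : ℤ)) = fun a => (fun b => (wtA m α (iB b) : ℤ)) (rB hp hd hm j a) := by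
    funext a
    rw [theta_fix_wt hp hd hm j α hα a]
  rw [h1, height_orb hp hd hm j (nuS m α σ), height_orb hp hd hm j (fun b => (wtA m α (iB b) : ℤ))]
  refine mul_lt_mul_of_pos_left ?_ (by exact_mod_cast hOrd_pos hp j)
  have h2 : ∀ k : Fin (Esys p d j), ∑ i : Fin (m ((k : ℕ) : ZMod e)), ((i : ℕ) : ℤ) * nuS m α σ ⟨k, i⟩
     = ∑ i : Fin (m ((k : ℕ) : ZMod e)), ((i : ℕ) : ℤ) * (wtA m α (iB (⟨k, i⟩ : Bq m (Esys p d j))) : ℤ) + (∑ i : Fin (m ((k : ℕ) : ZMod e)), ((i : ℕ) : ℤ) * ((σ k i : Fin _) : ℤ) -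
       ∑ i : Fin (m ((k : ℕ) : ZMod e)), ((i : ℕ) : ℤ) * (i : ℤ)) := by
    intro k
    rw [← Finset.sum_sub_distrib, ← Finset.sum_add_distrib]
    refine Finset.sum_congr rfl fun i _ => ?_
    show _ * ((lamOf (α ((k : ℕ) : ZMod e)) i : ℤ) - i + σ k i) = _ * ((lamOf (α ((k : ℕ) : ZMod e)) i : ℤ)) + _
    ring
  obtain ⟨k, hk⟩ : ∃ k, σ k ≠ 1 := by
    by_contra h
    push Not at h
    exact hσ (funext h)
  refine Finset.sum_lt_sum (fun k _ => ?_) ⟨k, Finset.mem_univ k, ?_⟩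
  · rw [h2]; have := perm_sum_le (σ k); linarith
  · rw [h2]; have := perm_sum_lt (σ k) hk; linarith

lemma FW_eq {ζ : ℂ} (hζ : IsPrimitiveRoot ζ e) (hmn : ∀ k, n ≤ m k) (α : ZMod e → Multiset ℕ) (hα : (theta e d)^[j] α = α) (hα2 : IsEPartition e n α) :
    FW (n := n) hp hd hm j ζ α = zW ζ (permT n (tE e d m hm ^ j)) α := by
  have hTQ : permT n (tE e d m hm ^ j) * Qp e n m α = Qp e n m α * permT n (tE e d m hm ^ j) := by
    have := permT_Qp (n := n) hm α j
    rwa [hα] at this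
  refine eq_of_ip _ _ (Fintype.card (Wt e n) : ℝ) ?_ ?_ ?_
  · rw [ip_FF hp hd hm j hζ hmn α hα hα2]; simp
  · refine (ip_sum_left _ _ _ _).trans ?_
    rw [Finset.sum_eq_single 1]
    · have h1 : (fun a => nuS m α 1 (rB hp hd hm j a)) = fun a => (wtA m α a : ℤ) := by
        funext a
        rw [theta_fix_wt hp hd hm j α hα a]
        unfold nuS nuZ wtA iB
        simp
      rw [h1, ip_f_z_one hζ _ α (trace_Qp_ne hmn hα2) hTQ (permT_unitary _)]
      simp [sgS]
    · intro σ _ hσ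
      rw [ip_f_z_zero hζ _ α _ (height_lt hp hd hm j α hα σ hσ), mul_zero]
    · intro h; exact absurd (Finset.mem_univ _) h
  · rw [ip_z_z_one hζ _ α (trace_Qp_ne hmn hα2) hTQ (permT_unitary _)]; simp

lemma epart_finite (hmn : ∀ k, n ≤ m k) : {α : ZMod e → Multiset ℕ | IsEPartition e n α}.Finite := by
  refine Set.Finite.of_finite_image (f := wtA m) ((Set.finite_Icc (0 : BIdx e m → ℕ) (fun _ => n)).subset ?_) ?_
  · rintro _ ⟨α, hα, rfl⟩
    exact ⟨fun b => Nat.zero_le _, fun b => wtA_le hmn hα b⟩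
  · intro α hα β hβ h
    exact wtA_inj hmn hα hβ h

/-! ### the span argument -/

lemma fW_apply (ζ : ℂ) (f : Equiv.Perm (BIdx e m)) (ν : BIdx e m → ℤ) (w : Wt e n) :
    fW ζ (permT n f) ν w = ∑ b : TIdx e n m, if b ∘ w.right = f ∘ b then
      (if ∀ a, (ty b a : ℤ) = ν a then 1 else 0) * chi ζ w b else 0 := by
  unfold fW Pw
  rw [trace_diag]

lemma fW_zero_of_not_inv (ζ : ℂ) (f : Equiv.Perm (BIdx e m)) (ν : BIdx e m → ℤ) (h : ¬ ∀ a, ν (f a) = ν a) :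
    (fW ζ (permT n f) ν : Wt e n → ℂ) = 0 := by
  funext w
  rw [fW_apply]
  refine Finset.sum_eq_zero fun b _ => ?_
  split_ifs with h1 h2
  · exfalso
    apply h
    intro a
    rw [← h2, ← h2, ← ty_perm f b a, ← h1, ty_comp]
  · rw [zero_mul]
  · rfl

lemma fW_zero_of_not_ty (ζ : ℂ) (f : Equiv.Perm (BIdx e m)) (ν : BIdx e m → ℤ) (h : ¬ ∃ b : TIdx e n m, ∀ a, (ty b a : ℤ) = ν a) :
    (fW ζ (permT n f) ν : Wt e n → ℂ) = 0 := by
  funext w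
  rw [fW_apply]
  refine Finset.sum_eq_zero fun b _ => ?_
  split_ifs with h1 h2
  · exact absurd ⟨b, h2⟩ h
  · rw [zero_mul]
  · rfl

lemma fW_reindex (ζ : ℂ) (f g : Equiv.Perm (BIdx e m)) (hg : ∀ a, (g a).1 = a.1) (hc : ∀ a, g (f a) = f (g a)) (ν ν' : BIdx e m → ℤ)
    (h : ∀ a, ν' a = ν (g a)) : (fW ζ (permT n f) ν' : Wt e n → ℂ) = fW ζ (permT n f) ν := by
  funext w
  rw [fW_apply, fW_apply]
  refine Fintype.sum_equiv (Equiv.piCongrRight fun _ => g) _ _ fun b => ?_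
  have hb : ((Equiv.piCongrRight fun _ => g) b : TIdx e n m) = g ∘ b := rfl
  rw [hb]
  have h1 : (b ∘ ⇑w.right = ⇑f ∘ b) ↔ ((⇑g ∘ b) ∘ ⇑w.right = ⇑f ∘ ⇑g ∘ b) := by
    simp only [funext_iff, Function.comp]
    refine forall_congr' fun s => ?_
    rw [← hc]
    exact g.injective.eq_iff.symm
  have h2 : (∀ a, (ty b a : ℤ) = ν' a) ↔ (∀ a, (ty (g ∘ b) a : ℤ) = ν a) := by
    constructor
    · intro h3 a
      have h4 := h3 (g.symm a)
      rw [h, Equiv.apply_symm_apply, ← ty_perm g, Equiv.apply_symm_apply] at h4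
      exact h4
    · intro h3 a
      rw [h, ← h3, ty_perm]
  have h3 : chi ζ w b = chi ζ w (g ∘ b) := by
    unfold chi
    simp only [Function.comp, hg]
  rw [h3]
  congr 1
  · exact propext h1
  · congr 2
    exact propext h2

lemma sum_ty_apply (b : TIdx e n m) : ∑ a, ty b a = n := by
  unfold ty
  simp only [Finsupp.finsetSum_apply, Finsupp.single_apply]
  rw [Finset.sum_comm]
  simp

lemma exists_perm_of_map {N : ℕ} (u v : Fin N → ℕ) (h : (Finset.univ : Finset (Fin N)).val.map u = (Finset.univ : Finset (Fin N)).val.map v) :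
    ∃ π : Equiv.Perm (Fin N), ∀ i, u i = v (π i) := by
  have h1 : ty u = ty v := by
    ext x
    have h2 := congrArg (Multiset.count x) h
    rw [Multiset.count_map, Multiset.count_map] at h2
    rw [ty_apply, ty_apply]
    have h3 : ∀ u : Fin N → ℕ, (Finset.univ.filter fun s => u s = x).card = (Multiset.filter (fun a => x = u a) (Finset.univ : Finset (Fin N)).val).card := by
      intro u
      rw [← Finset.filter_val, Finset.card_val]
      simp only [eq_comm]
    have h4 := h3 u
    have h5 := h3 v
    calc _ = _ := by convert h4
      _ = _ := by convert h2
      _ = _ := by convert h5.symm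
  obtain ⟨π, hπ⟩ := exists_perm_of_ty h1
  exact ⟨π, fun i => (congrFun hπ i).symm⟩

lemma finv_red {A : Type*} (ν : BIdx e m → A) (hν : ∀ a, ν ((tE e d m hm ^ j) a) = ν a) (a : BIdx e m) :
    ν a = ν (iB (rB hp hd hm j a)) := by
  obtain ⟨s, -, hs⟩ := exists_orb hp hd hm j a.1
  have h := hs a rfl
  have h1 : ∀ s : ℕ, ∀ b : BIdx e m, ν (((tE e d m hm ^ j) ^ s) b) = ν b := by
    intro s
    induction s with
    | zero => intro b; rfl
    | succ s ih =>
      intro b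
      rw [pow_succ', Equiv.Perm.mul_apply, hν, ih]
  conv_lhs => rw [← h]
  exact h1 s _

/-- a colour preserving permutation built from permutations on representatives -/
noncomputable def gB (π : ∀ k : Fin (Esys p d j), Equiv.Perm (Fin (m ((k : ℕ) : ZMod e)))) : Equiv.Perm (BIdx e m) :=
  Equiv.sigmaCongrRight fun k => ((finCongr (m_red (p := p) hm j k)).trans
    (π ⟨k.val % Esys p d j, Nat.mod_lt _ (E_pos hp hd j)⟩)).trans (finCongr (m_red (p := p) hm j k)).symm

lemma gB_fst (π : ∀ k : Fin (Esys p d j), Equiv.Perm (Fin (m ((k : ℕ) : ZMod e)))) (a : BIdx e m) : (gB hp hd hm j π a).1 = a.1 := rfl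

lemma gB_snd (π : ∀ k : Fin (Esys p d j), Equiv.Perm (Fin (m ((k : ℕ) : ZMod e)))) (a : BIdx e m) :
    (gB hp hd hm j π a).2.val = (π (rB hp hd hm j a).1 (rB hp hd hm j a).2).val := rfl

lemma rB_gB (π : ∀ k : Fin (Esys p d j), Equiv.Perm (Fin (m ((k : ℕ) : ZMod e)))) (a : BIdx e m) :
    rB hp hd hm j (gB hp hd hm j π a) = ⟨(rB hp hd hm j a).1, π (rB hp hd hm j a).1 (rB hp hd hm j a).2⟩ := by
  apply bq_ext <;> rfl

lemma gB_comm (π : ∀ k : Fin (Esys p d j), Equiv.Perm (Fin (m ((k : ℕ) : ZMod e)))) (a : BIdx e m) :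
    gB hp hd hm j π ((tE e d m hm ^ j) a) = (tE e d m hm ^ j) (gB hp hd hm j π a) := by
  apply bidx_ext
  · rw [gB_fst, tE_pow_fst, tE_pow_fst, gB_fst]
  · rw [tE_pow_snd, gB_snd, gB_snd]
    have h : ∀ b b' : Bq m (Esys p d j), b = b' → (π b.1 b.2).val = (π b'.1 b'.2).val := by rintro b _ rfl; rfl
    exact h _ _ (rB_f hp hd hm j a)

/-- the multipartition attached to a weight -/
noncomputable def alphaOf (ν : BIdx e m → ℕ) (k : ZMod e) : Multiset ℕ :=
  ((Finset.univ : Finset (Fin (m k))).val.map fun i => ν ⟨k, i⟩).filter (fun x => 0 < x)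

lemma ms_filter (M : Multiset ℕ) : M.filter (fun x => 0 < x) + Multiset.replicate (M.card - (M.filter (fun x => 0 < x)).card) 0 = M := by
  have h1 := Multiset.filter_add_not (fun x => 0 < x) M
  have h2 : M.filter (fun x => ¬ 0 < x) = Multiset.replicate (M.filter (fun x => ¬ 0 < x)).card 0 := by
    rw [Multiset.eq_replicate]
    refine ⟨rfl, fun b hb => ?_⟩
    have := (Multiset.mem_filter.1 hb).2
    omega
  have h3 : M.card - (M.filter (fun x => 0 < x)).card = (M.filter (fun x => ¬ 0 < x)).card := by
    conv_lhs => rw [← h1]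
    rw [Multiset.filter_add_not, ← congrArg Multiset.card h1, Multiset.card_add, Nat.add_sub_cancel_left]
  rw [h3, ← h2, h1]

lemma alphaOf_lam (ν : BIdx e m → ℕ) (k : ZMod e) : (Finset.univ : Finset (Fin (m k))).val.map (fun i : Fin (m k) => lamOf (alphaOf ν k) i)
    = (Finset.univ : Finset (Fin (m k))).val.map fun i => ν ⟨k, i⟩ := by
  have h1 : (alphaOf ν k).card ≤ m k := by
    unfold alphaOf
    refine (Multiset.card_le_card (Multiset.filter_le _ _)).trans ?_
    simp
  rw [lam_map _ _ h1]
  have h2 := ms_filter ((Finset.univ : Finset (Fin (m k))).val.map fun i => ν ⟨k, i⟩)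
  simp only [Multiset.card_map, Finset.card_val, Finset.card_univ, Fintype.card_fin] at h2
  exact h2

lemma alphaOf_part (ν : BIdx e m → ℕ) (h : ∑ a, ν a = n) : IsEPartition e n (alphaOf ν) := by
  constructor
  · intro k x hx
    exact (Multiset.mem_filter.1 hx).2
  · rw [← h, Fintype.sum_sigma]
    refine Finset.sum_congr rfl fun k _ => ?_
    have h2 := congrArg Multiset.sum (ms_filter ((Finset.univ : Finset (Fin (m k))).val.map fun i => ν ⟨k, i⟩))
    rw [Multiset.sum_add, Multiset.sum_replicate, smul_zero, add_zero] at h2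
    exact h2

lemma alphaOf_theta (ν : BIdx e m → ℕ) (hν : ∀ a, ν ((tE e d m hm ^ j) a) = ν a) : (theta e d)^[j] (alphaOf ν) = alphaOf ν := by
  funext k
  rw [theta_iter]
  unfold alphaOf
  congr 1
  have h1 : m (k - ((j * d : ℕ) : ZMod e)) = m k := by
    have := m_add hm (k - ((j * d : ℕ) : ZMod e)) j
    rw [sub_add_cancel] at this
    exact this.symm
  have h2 : ∀ i : Fin (m (k - ((j * d : ℕ) : ZMod e))), ν ⟨_, i⟩ = ν ⟨k, Fin.cast h1 i⟩ := by
    intro i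
    rw [← hν]
    congr 1
    apply bidx_ext
    · rw [tE_pow_fst]; exact sub_add_cancel _ _
    · rw [tE_pow_snd]; rfl
  simp only [h2]
  have h3 : ∀ (a b : ℕ) (h : a = b) (g : Fin b → ℕ), (Finset.univ : Finset (Fin a)).val.map (fun i => g (Fin.cast h i)) = (Finset.univ : Finset (Fin b)).val.map g := by
    rintro a _ rfl g; rfl
  exact h3 _ _ h1 (fun i => ν ⟨k, i⟩)

include hp hd in
lemma fW_eq_part (ζ : ℂ) (ν : BIdx e m → ℕ) (hν : ∀ a, ν ((tE e d m hm ^ j) a) = ν a) :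
    (fW ζ (permT n (tE e d m hm ^ j)) (fun a => (wtA m (alphaOf ν) a : ℤ)) : Wt e n → ℂ) = fW ζ (permT n (tE e d m hm ^ j)) (fun a => (ν a : ℤ)) := by
  have h1 : ∀ k : Fin (Esys p d j), ∃ π : Equiv.Perm (Fin (m ((k : ℕ) : ZMod e))), ∀ i : Fin (m ((k : ℕ) : ZMod e)), lamOf (alphaOf ν ((k : ℕ) : ZMod e)) i = ν ⟨((k : ℕ) : ZMod e), π i⟩ :=
    fun k => exists_perm_of_map _ _ (alphaOf_lam ν _)
  choose π hπ using h1
  refine fW_reindex ζ _ (gB hp hd hm j π) (gB_fst hp hd hm j π) (gB_comm hp hd hm j π) _ _ fun a => ?_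
  rw [theta_fix_wt hp hd hm j _ (alphaOf_theta hm j ν hν) a, finv_red hp hd hm j ν hν (gB hp hd hm j π a), rB_gB]
  exact congrArg _ (hπ _ _)

include hp hd in
lemma fW_mem (ζ : ℂ) (S : Submodule ℂ (Wt e n → ℂ))
    (hS : ∀ α : ZMod e → Multiset ℕ, IsEPartition e n α → (theta e d)^[j] α = α → fW ζ (permT n (tE e d m hm ^ j)) (fun a => (wtA m α a : ℤ)) ∈ S)
    (ν : BIdx e m → ℤ) : fW ζ (permT n (tE e d m hm ^ j)) ν ∈ S := by
  by_cases h1 : ∀ a, ν ((tE e d m hm ^ j) a) = ν a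
  · by_cases h2 : ∃ b : TIdx e n m, ∀ a, (ty b a : ℤ) = ν a
    · obtain ⟨b, hb⟩ := h2
      have h3 : ν = fun a => ((ty b a : ℕ) : ℤ) := funext fun a => (hb a).symm
      have h4 : ∀ a, ty b ((tE e d m hm ^ j) a) = ty b a := by
        intro a
        have := h1 a
        rw [← hb, ← hb] at this
        exact_mod_cast this
      rw [h3, ← fW_eq_part hp hd hm j ζ (fun a => ty b a) h4]
      refine hS _ (alphaOf_part _ ?_) (alphaOf_theta hm j _ h4)
      exact sum_ty_apply b
    · rw [fW_zero_of_not_ty ζ _ ν h2]; exact S.zero_mem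
  · rw [fW_zero_of_not_inv ζ _ ν h1]; exact S.zero_mem

lemma GW_eq_sum (ζ : ℂ) (xv : BIdx e m → ℂ) : (GW (n := n) hm j ζ xv) = 
    ∑ N ∈ (Finset.univ : Finset (TIdx e n m)).image ty, (∏ a, xv a ^ N a) • fW ζ (permT n (tE e d m hm ^ j)) (fun a => (N a : ℤ)) := by
  funext w
  unfold GW
  rw [trace_diag, Finset.sum_apply]
  simp only [Pi.smul_apply, fW_apply, smul_eq_mul, Finset.mul_sum]
  rw [Finset.sum_comm]
  refine Finset.sum_congr rfl fun b _ => ?_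
  rw [Finset.sum_eq_single (ty b)]
  · rw [if_pos (fun a => rfl)]; split_ifs <;> simp
  · intro N _ hN
    split_ifs with h1 h2
    · exfalso
      apply hN
      ext a
      exact_mod_cast (h2 a).symm
    · simp
    · simp
  · intro h
    exact absurd (Finset.mem_image_of_mem _ (Finset.mem_univ _)) h

include hp hd in
/-- the key expansion -/
theorem GW_expand {ζ : ℂ} (hζ : IsPrimitiveRoot ζ e) (hmn : ∀ k, n ≤ m k) (xv : BIdx e m → ℂ) (A : Finset (ZMod e → Multiset ℕ))
    (hA : ∀ α, α ∈ A ↔ IsEPartition e n α ∧ (theta e d)^[j] α = α) (w : Wt e n) :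
    GW (n := n) hm j ζ xv w = ∑ α ∈ A, schurBrace e p d m xv j α * zW ζ (permT n (tE e d m hm ^ j)) α w := by
  set T := permT n (tE e d m hm ^ j) with hT
  have hcard : (Fintype.card (Wt e n) : ℂ) ≠ 0 := by exact_mod_cast Fintype.card_ne_zero
  have hTQ : ∀ α ∈ A, T * Qp e n m α = Qp e n m α * T := by
    intro α hα
    have := permT_Qp (n := n) hm α j
    rwa [((hA α).1 hα).2] at this
  have horth : ∀ α ∈ A, ∀ β ∈ A, ip (zW ζ T β) (zW ζ T α) = if β = α then (Fintype.card (Wt e n) : ℂ) else 0 := by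
    intro α hα β hβ
    split_ifs with h
    · subst h
      exact ip_z_z_one hζ _ β (trace_Qp_ne hmn ((hA β).1 hα).1) (hTQ β hα) (permT_unitary _)
    · refine ip_z_z_zero hζ _ α β fun h' => h ?_
      exact (wtA_inj hmn ((hA α).1 hα).1 ((hA β).1 hβ).1 h').symm
  let zf : A → (Wt e n → ℂ) := fun α => zW ζ T α.1
  let ff : A → (Wt e n → ℂ) := fun α => fW ζ T (fun a => (wtA m α.1 a : ℤ))
  let S := Submodule.span ℂ (Set.range ff)
  have hS : ∀ ν, fW ζ T ν ∈ S := fW_mem hp hd hm j ζ S (fun α h1 h2 => Submodule.subset_span ⟨⟨α, (hA α).2 ⟨h1, h2⟩⟩, rfl⟩)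
  have hzS : ∀ α, zf α ∈ S := by
    intro α
    have h1 := (hA α.1).1 α.2
    show zW ζ T α.1 ∈ S
    rw [hT, ← FW_eq hp hd hm j hζ hmn α.1 h1.2 h1.1]
    have h2 : FW (n := n) hp hd hm j ζ α.1 = ∑ σ : ∀ k : Fin (Esys p d j), Equiv.Perm (Fin (m ((k : ℕ) : ZMod e))),
       sgS m σ • fW ζ T (fun a => nuS m α.1 σ (rB hp hd hm j a)) := by
      funext w
      rw [Finset.sum_apply]
      rfl
    rw [h2]
    exact S.sum_mem fun σ _ => S.smul_mem _ (hS _)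
  have hG : GW (n := n) hm j ζ xv ∈ S := by
    rw [GW_eq_sum]
    exact S.sum_mem fun N _ => S.smul_mem _ (hS _)
  have hcoef : ∀ (c : A → ℂ) (α : A), ip (∑ β, c β • zf β) (zf α) = c α * Fintype.card (Wt e n) := by
    intro c α
    have h1 : (∑ β, c β • zf β) = fun w => ∑ β, c β * zf β w := by
      funext w; rw [Finset.sum_apply]; rfl
    rw [h1, ip_sum_left, Finset.sum_eq_single α]
    · rw [horth α.1 α.2 α.1 α.2, if_pos rfl]
    · intro β _ hβ
      rw [horth α.1 α.2 β.1 β.2, if_neg (fun h => hβ (Subtype.ext h)), mul_zero]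
    · intro h; exact absurd (Finset.mem_univ _) h
  have hli : LinearIndependent ℂ zf := by
    rw [Fintype.linearIndependent_iff]
    intro c hc α
    have h1 := hcoef c α
    rw [hc] at h1
    have h2 : ip (0 : Wt e n → ℂ) (zf α) = 0 := by unfold ip; simp
    rw [h2] at h1
    exact (mul_eq_zero.1 h1.symm).resolve_right hcard
  have hspan : Submodule.span ℂ (Set.range zf) = S := by
    refine Submodule.eq_of_le_of_finrank_le (Submodule.span_le.2 ?_) ?_
    · rintro _ ⟨α, rfl⟩; exact hzS α
    · rw [finrank_span_eq_card hli]
      exact finrank_range_le_card ff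
  rw [← hspan, Submodule.mem_span_range_iff_exists_fun] at hG
  obtain ⟨c, hc⟩ := hG
  have hc2 : ∀ α : A, c α = schurBrace e p d m xv j α.1 := by
    intro α
    have h1 := hcoef c α
    have h2 := (hA α.1).1 α.2
    rw [hc] at h1
    have h3 := ip_GF hp hd hm j hζ hmn xv α.1 h2.2 h2.1
    rw [FW_eq hp hd hm j hζ hmn α.1 h2.2 h2.1] at h3
    have h4 : c α * Fintype.card (Wt e n) = (Fintype.card (Wt e n) : ℂ) * schurBrace e p d m xv j α.1 := h1.symm.trans h3
    rw [mul_comm] at h4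
    exact mul_left_cancel₀ hcard h4
  rw [← hc, Finset.sum_apply, ← Finset.sum_coe_sort A]
  refine Finset.sum_congr rfl fun α _ => ?_
  rw [← hc2]
  rfl
end
end GreenII

namespace GreenII

section Cyc
variable {e n d p : ℕ} [NeZero e] {m : ZMod e → ℕ}

lemma cyc_pow {B : Type*} (f : Equiv.Perm B) (t : ℕ) (y : B) : (f ^ (t + 1)) y = f ((f ^ t) y) := by
  rw [pow_succ', Equiv.Perm.mul_apply]

/-- sum over cyclic sequences -/
lemma cyc_sum {B : Type*} [Fintype B] [DecidableEq B] (f : Equiv.Perm B) (l : ℕ) (hl : 0 < l) (g : Fin l → B → ℂ) :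
    ∑ c : Fin l → B, ∏ t, (if c (finRotate l t) = f (c t) then g t (c t) else 0)
      = ∑ y : B, if (f ^ l) y = y then ∏ t : Fin l, g t ((f ^ (t : ℕ)) y) else 0 := by
  obtain ⟨l, rfl⟩ : ∃ l', l = l' + 1 := ⟨l - 1, by omega⟩
  have h1 : ∀ c : Fin (l + 1) → B, ∏ t, (if c (finRotate (l+1) t) = f (c t) then g t (c t) else 0)
     = ∑ y : B, if c 0 = y then ∏ t, (if c (finRotate (l+1) t) = f (c t) then g t (c t) else 0) else 0 := by
    intro c; rw [Finset.sum_ite_eq]; simp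
  rw [Finset.sum_congr rfl fun c _ => h1 c, Finset.sum_comm]
  refine Finset.sum_congr rfl fun y _ => ?_
  rw [Finset.sum_eq_single (fun t : Fin (l + 1) => (f ^ (t : ℕ)) y)]
  · rw [if_pos (by simp)]
    split_ifs with h
    · refine Finset.prod_congr rfl fun t _ => ?_
      rw [if_pos]
      by_cases ht : (t : ℕ) = l
      · have : t = Fin.last l := Fin.ext ht
        subst this
        rw [finRotate_last, ← cyc_pow]
        simpa using h.symm
      · have h2 : t ≠ Fin.last l := fun h => ht (by rw [h]; rfl)
        rw [← cyc_pow]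
        show (f ^ ((finRotate (l + 1) t : Fin (l + 1)) : ℕ)) y = _
        rw [coe_finRotate_of_ne_last h2]
    · refine Finset.prod_eq_zero (Finset.mem_univ (Fin.last l)) ?_
      rw [if_neg]
      rw [finRotate_last, ← cyc_pow]
      intro h2; exact h (by simpa using h2.symm)
  · intro c _ hc
    split_ifs with h0
    · by_contra h
      apply hc
      have h2 : ∀ t, c (finRotate (l+1) t) = f (c t) := by
        intro t
        by_contra h3
        exact h (Finset.prod_eq_zero (Finset.mem_univ t) (if_neg h3))
      funext t
      obtain ⟨t, ht⟩ := t
      induction t with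
      | zero => exact h0
      | succ t ih =>
        have h3 := h2 ⟨t, by omega⟩
        have h4 : finRotate (l+1) ⟨t, by omega⟩ = ⟨t+1, ht⟩ := finRotate_of_lt (by omega)
        rw [h4, ih (by omega), ← cyc_pow] at h3
        exact h3
    · rfl
  · intro h; exact absurd (Finset.mem_univ _) h

lemma zm_add {ζ : ℂ} (hζ : IsPrimitiveRoot ζ e) (a b : ZMod e) : zmpow e ζ (a + b) = zmpow e ζ a * zmpow e ζ b := by
  unfold zmpow
  rw [← pow_add]
  apply root_pow_congr hζ
  simp

lemma zm_zero (ζ : ℂ) : zmpow e ζ 0 = 1 := by unfold zmpow; simp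

lemma zm_nat {ζ : ℂ} (hζ : IsPrimitiveRoot ζ e) (a : ℕ) : zmpow e ζ (a : ZMod e) = ζ ^ a := by
  unfold zmpow
  apply root_pow_congr hζ
  simp

lemma zm_mul {ζ : ℂ} (hζ : IsPrimitiveRoot ζ e) (a b : ZMod e) : ζ ^ (a.val * b.val) = zmpow e ζ (a * b) := by
  unfold zmpow
  apply root_pow_congr hζ
  simp

lemma zm_sum {ζ : ℂ} (hζ : IsPrimitiveRoot ζ e) {ι : Type*} (s : Finset ι) (a : ι → ZMod e) : zmpow e ζ (∑ i ∈ s, a i) = ∏ i ∈ s, zmpow e ζ (a i) := by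
  induction s using Finset.induction_on with
  | empty => simp [zm_zero]
  | insert i s hi ih => rw [Finset.sum_insert hi, Finset.prod_insert hi, zm_add hζ, ih]

lemma zm_nsmul {ζ : ℂ} (hζ : IsPrimitiveRoot ζ e) (a : ZMod e) (s : ℕ) : zmpow e ζ (s * a) = zmpow e ζ a ^ s := by
  induction s with
  | zero => simp [zm_zero]
  | succ s ih => rw [Nat.cast_succ, add_mul, one_mul, zm_add hζ, ih, pow_succ]

lemma zm_eq_one {ζ : ℂ} (hζ : IsPrimitiveRoot ζ e) (a : ZMod e) : zmpow e ζ a = 1 ↔ a = 0 := by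
  unfold zmpow
  rw [hζ.pow_eq_one_iff_dvd]
  constructor
  · intro h
    have := Nat.eq_zero_of_dvd_of_lt h (ZMod.val_lt a)
    exact (ZMod.val_eq_zero a).1 this
  · rintro rfl; simp

variable (hp : p ∣ e) (hd : d = e / p) (hm : ∀ k, m (k + (d : ZMod e)) = m k) (j : ℕ)

lemma f_pow_fst (s : ℕ) (y : BIdx e m) : (((tE e d m hm ^ j) ^ s) y).1 = y.1 + ((s * j * d : ℕ) : ZMod e) := by
  rw [f_pow, tE_pow_fst]

include hp hd in
lemma f_pow_fix (s : ℕ) (y : BIdx e m) : ((tE e d m hm ^ j) ^ s) y = y ↔ hOrd p j ∣ s := by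
  rw [← sJ_zero hp hd j s]
  constructor
  · intro h
    have := congrArg Sigma.fst h
    rw [f_pow_fst] at this
    simpa using this
  · intro h
    apply bidx_ext
    · rw [f_pow_fst, h, add_zero]
    · rw [f_pow, tE_pow_snd]

include hp hd in
lemma root_sum {ζ : ℂ} (hζ : IsPrimitiveRoot ζ e) (k : ZMod e) :
    ∑ s : Fin (hOrd p j), zmpow e ζ (k * (((s : ℕ) * j * d : ℕ) : ZMod e)) = if hOrd p j ∣ k.val then (hOrd p j : ℂ) else 0 := by
  have h1 : ∀ s : ℕ, zmpow e ζ (k * ((s * j * d : ℕ) : ZMod e)) = zmpow e ζ (k * ((j * d : ℕ) : ZMod e)) ^ s := by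
    intro s
    rw [← zm_nsmul hζ]
    congr 1; push_cast; ring
  have h2 : zmpow e ζ (k * ((j * d : ℕ) : ZMod e)) = 1 ↔ hOrd p j ∣ k.val := by
    rw [zm_eq_one hζ, ← sJ_zero hp hd j k.val]
    push_cast
    rw [ZMod.natCast_zmod_val, mul_assoc]
  simp only [h1]
  rw [← Finset.sum_range (fun s => zmpow e ζ (k * ((j * d : ℕ) : ZMod e)) ^ s)]
  split_ifs with h
  · rw [h2.2 h]; simp
  · have h3 : zmpow e ζ (k * ((j * d : ℕ) : ZMod e)) ≠ 1 := fun h4 => h (h2.1 h4)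
    rw [geom_sum_eq h3, ← h1, (sJ_zero hp hd j _).2 dvd_rfl, mul_zero, zm_zero, sub_self, zero_div]

include hp hd in
lemma prod_periodic (xv : BIdx e m → ℂ) (l : ℕ) (y : BIdx e m) :
    ∏ t ∈ Finset.range (hOrd p j * l), xv (((tE e d m hm ^ j) ^ t) y) = (∏ t ∈ Finset.range (hOrd p j), xv (((tE e d m hm ^ j) ^ t) y)) ^ l := by
  induction l with
  | zero => simp
  | succ l ih =>
    rw [mul_add, mul_one, Finset.prod_range_add, ih, pow_succ]
    congr 1
    refine Finset.prod_congr rfl fun t _ => ?_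
    rw [add_comm, pow_add, Equiv.Perm.mul_apply, (f_pow_fix hp hd hm j _ y).2 (Dvd.intro _ rfl)]

lemma prod_shift {B : Type*} (f : Equiv.Perm B) (x : B → ℂ) (h : ℕ) (y : B) (hy : (f ^ h) y = y) (s : ℕ) :
    ∏ t ∈ Finset.range h, x ((f ^ t) ((f ^ s) y)) = ∏ t ∈ Finset.range h, x ((f ^ t) y) := by
  induction s with
  | zero => rfl
  | succ s ih =>
    rw [← ih]
    have h1 : ∀ t, (f ^ t) ((f ^ (s + 1)) y) = (f ^ (t+1)) ((f ^ s) y) := by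
      intro t; rw [← Equiv.Perm.mul_apply, ← Equiv.Perm.mul_apply, ← pow_add, ← pow_add]; congr 2; ring
    simp only [h1]
    have h2 := Finset.prod_range_succ' (fun t => x ((f ^ t) ((f ^ s) y))) h
    rw [Finset.prod_range_succ] at h2
    have h3 : (f ^ h) ((f ^ s) y) = (f ^ s) y := by
      rw [← Equiv.Perm.mul_apply, ← pow_add, add_comm, pow_add, Equiv.Perm.mul_apply, hy]
    rw [h3] at h2
    by_cases h0 : h = 0
    · subst h0; simp
    simp only [pow_zero, Equiv.Perm.one_apply] at h2
    by_cases hx : x ((f ^ s) y) = 0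
    · rw [Finset.prod_eq_zero (i := h - 1) (by simp; omega), Finset.prod_eq_zero (i := 0) (by simp; omega)]
      · simpa using hx
      · rw [Nat.sub_add_cancel (by omega), h3]; exact hx
    · exact (mul_right_cancel₀ hx h2).symm

include hp hd hm in
lemma Xvar_orb (xv : BIdx e m → ℂ) (b : Bq m (Esys p d j)) :
    ∏ t ∈ Finset.range (hOrd p j), xv (((tE e d m hm ^ j) ^ t) (iB b)) = Xvar e p d m xv j b.1 b.2 := by
  unfold Xvar
  refine Finset.prod_congr rfl fun s _ => ?_
  have hlt : b.2.val < m (((b.1 : ℕ) + s * j * d : ℕ) : ZMod e) := by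
    rw [Nat.cast_add, m_add hm]; exact b.2.2
  unfold xval
  rw [dif_pos hlt]
  congr 1
  apply bidx_ext
  · rw [f_pow_fst]; simp [iB]
  · rw [f_pow, tE_pow_snd]; rfl

/-- the value of one (part, colour) pair -/
noncomputable def Cyc (e p d : ℕ) [NeZero e] (m : ZMod e → ℕ) (j : ℕ) (ζ : ℂ) (xv : BIdx e m → ℂ) (l : ℕ) (k : ZMod e) : ℂ :=
  if hOrd p j ∣ l ∧ hOrd p j ∣ k.val then (hOrd p j : ℂ) * pGenSys (ζ ^ hOrd p j) (Esys p d j) (mmX e m) (vvX e p d m xv j) (k.val / hOrd p j) (l / hOrd p j) else 0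

lemma cyc_expo {l : ℕ} (hl : 0 < l) (k b : ZMod e) (c : Fin l → ZMod e) (J : ZMod e) (hc : ∀ t : Fin l, c t = c ⟨0, hl⟩ + (t : ℕ) * J) (hJ : (l : ZMod e) * J = 0) :
    ∑ t : Fin l, ((if (t : ℕ) = 0 then k - b else 0) + (if (t : ℕ) = l - 1 then b else 0)) * c t = k * c ⟨0, hl⟩ - b * J := by
  simp only [add_mul, Finset.sum_add_distrib]
  rw [Finset.sum_eq_single (⟨0, hl⟩ : Fin l), Finset.sum_eq_single (⟨l - 1, by omega⟩ : Fin l)]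
  · simp only [if_true]
    rw [hc ⟨l - 1, by omega⟩]
    have : ((l - 1 : ℕ) : ZMod e) * J = - J := by
      rw [Nat.cast_sub (by omega), sub_mul, hJ]; simp
    rw [this]; ring
  · intro t _ ht
    rw [if_neg (fun h => ht (Fin.ext h)), zero_mul]
  · intro h; exact absurd (Finset.mem_univ _) h
  · intro t _ ht
    rw [if_neg (fun h => ht (Fin.ext h)), zero_mul]
  · intro h; exact absurd (Finset.mem_univ _) h

include hp hd in
lemma cyc_eval {ζ : ℂ} (hζ : IsPrimitiveRoot ζ e) (xv : BIdx e m → ℂ) {l : ℕ} (hl : 0 < l) (k b : ZMod e) :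
    ∑ y : BIdx e m, (if ((tE e d m hm ^ j) ^ l) y = y then ∏ t : Fin l, (xv (((tE e d m hm ^ j) ^ (t : ℕ)) y) *
       ζ ^ (((if (t : ℕ) = 0 then k - b else 0) + (if (t : ℕ) = l - 1 then b else 0) : ZMod e).val * (((tE e d m hm ^ j) ^ (t : ℕ)) y).1.val)) else 0)
      = zmpow e ζ (- b * ((j * d : ℕ) : ZMod e)) * Cyc e p d m j ζ xv l k := by
  unfold Cyc
  simp only [f_pow_fix hp hd]
  by_cases h1 : hOrd p j ∣ l
  swap
  · simp [h1]
  obtain ⟨l', rfl⟩ := h1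
  have hh := hOrd_pos hp j
  have hl' : l' ≠ 0 := by rintro rfl; simp at hl
  simp only [dvd_mul_right, if_true, true_and]
  have h2 : ∀ y : BIdx e m, ∏ t : Fin (hOrd p j * l'), (xv (((tE e d m hm ^ j) ^ (t : ℕ)) y) *
       ζ ^ (((if (t : ℕ) = 0 then k - b else 0) + (if (t : ℕ) = hOrd p j * l' - 1 then b else 0) : ZMod e).val * (((tE e d m hm ^ j) ^ (t : ℕ)) y).1.val))
      = (∏ t ∈ Finset.range (hOrd p j), xv (((tE e d m hm ^ j) ^ t) y)) ^ l' * (zmpow e ζ (k * y.1) * zmpow e ζ (- b * ((j * d : ℕ) : ZMod e))) := by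
    intro y
    rw [Finset.prod_mul_distrib, ← prod_periodic hp hd hm j xv l' y, Finset.prod_range]
    congr 1
    simp only [zm_mul hζ]
    rw [← zm_sum hζ, cyc_expo hl k b (fun t => (((tE e d m hm ^ j) ^ (t : ℕ)) y).1) ((j * d : ℕ) : ZMod e), ← zm_add hζ]
    · congr 1
      simp only [pow_zero, Equiv.Perm.one_apply]; ring
    · intro t
      simp only [f_pow_fst]
      push_cast
      ring
    · have := (sJ_zero hp hd j (hOrd p j * l')).2 (Dvd.intro _ rfl)
      rw [mul_assoc, Nat.cast_mul] at this
      exact this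
  simp only [h2]
  rw [← Equiv.sum_comp (orbE hp hd hm j), Fintype.sum_prod_type]
  have h3 : ∀ (z : Bq m (Esys p d j)), ∑ s : Fin (hOrd p j), (∏ t ∈ Finset.range (hOrd p j), xv (((tE e d m hm ^ j) ^ t) (orbE hp hd hm j (z, s)))) ^ l' *
      (zmpow e ζ (k * (orbE hp hd hm j (z, s)).1) * zmpow e ζ (- b * ((j * d : ℕ) : ZMod e)))
      = zmpow e ζ (- b * ((j * d : ℕ) : ZMod e)) * ((if hOrd p j ∣ k.val then (hOrd p j : ℂ) else 0) * (zmpow e ζ (k * ((z.1 : ℕ) : ZMod e)) * (Xvar e p d m xv j z.1 z.2) ^ l')) := by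
    intro z
    rw [← root_sum hp hd j hζ k, Finset.sum_mul, Finset.mul_sum]
    refine Finset.sum_congr rfl fun s _ => ?_
    rw [orbE_apply, prod_shift _ _ _ _ ((f_pow_fix hp hd hm j _ _).2 dvd_rfl), Xvar_orb hp hd hm, f_pow_fst]
    show _ * (zmpow e ζ (k * (((z.1 : ℕ) : ZMod e) + _)) * _) = _
    rw [mul_add, zm_add hζ]
    ring
  simp only [h3]
  rw [← Finset.mul_sum, ← Finset.mul_sum]
  congr 1
  split_ifs with h4
  · congr 1
    unfold pGenSys
    rw [Nat.mul_div_cancel_left _ hh, if_neg hl', Fintype.sum_sigma, Finset.sum_range]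
    refine Finset.sum_congr rfl fun κ _ => ?_
    rw [Finset.mul_sum, Finset.sum_range]
    refine Finset.sum_congr rfl fun i _ => ?_
    congr 1
    rw [← pow_mul, ← mul_assoc, Nat.mul_div_cancel' h4, ← zm_nat hζ]
    congr 1
    push_cast
    rw [ZMod.natCast_zmod_val]
  · simp
end Cyc
end GreenII

namespace GreenII

section Tr
variable {e n d p : ℕ} [NeZero e] {m : ZMod e → ℕ}

@[to_additive]
lemma partsList_prod {M : Type*} [CommMonoid M] (β : ZMod e → Multiset ℕ) (g : ℕ × ZMod e → M) :
    ((partsList e β).map g).prod = ∏ k : ZMod e, ((β k).map fun r => g (r, k)).prod := by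
  unfold partsList
  rw [List.map_flatMap, List.flatMap_def, List.prod_flatten, List.map_map]
  have h1 : ∀ k : ZMod e, (List.map g ((β k).toList.map fun r => (r, k))).prod = ((β k).map fun r => g (r, k)).prod := by
    intro k
    rw [List.map_map]
    conv_rhs => rw [← Multiset.coe_toList (β k), Multiset.map_coe, Multiset.prod_coe]
    rfl
  rw [← Finset.prod_map_toList]
  congr 1
  exact List.map_congr_left fun k _ => h1 k

@[to_additive]
lemma prod_get {M A : Type*} [CommMonoid M] (L : List A) (g : A → M) : ∏ i : Fin L.length, g (L.get i) = (L.map g).prod := by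
  rw [← List.prod_ofFn]
  congr 1
  apply List.ext_getElem <;> simp

lemma partsList_card (β : ZMod e → Multiset ℕ) (hβ : IsEPartition e n β) :
    Fintype.card (Σ i : Fin (partsList e β).length, Fin ((partsList e β).get i).1) = n := by
  rw [Fintype.card_sigma]
  simp only [Fintype.card_fin]
  rw [sum_get (partsList e β) (fun x => x.1), partsList_sum, ← hβ.2]
  simp

lemma mem_partsList (β : ZMod e → Multiset ℕ) (x : ℕ × ZMod e) : x ∈ partsList e β ↔ x.1 ∈ β x.2 := by
  unfold partsList
  simp only [List.mem_flatMap, Finset.mem_toList, Finset.mem_univ, true_and, List.mem_map, Multiset.mem_toList]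
  constructor
  · rintro ⟨k, r, h, rfl⟩; exact h
  · intro h; exact ⟨x.2, x.1, h, rfl⟩

lemma aexc_eq (L : List (ℕ × ZMod e)) (b : ZMod e) (x : Σ i : Fin L.length, Fin (L.get i).1) :
    aexc e L b x = (if (x.2 : ℕ) = 0 then (L.get x.1).2 - (if (x.1 : ℕ) = 0 then b else 0) else 0)
      + (if (x.2 : ℕ) = (L.get x.1).1 - 1 then (if (x.1 : ℕ) = 0 then b else 0) else 0) := by
  unfold aexc
  split_ifs <;> simp

variable (hp : p ∣ e) (hd : d = e / p) (hm : ∀ k, m (k + (d : ZMod e)) = m k) (j : ℕ)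

include hp hd in
lemma GW_cyc_aux {ζ : ℂ} (hζ : IsPrimitiveRoot ζ e) (xv : BIdx e m → ℂ) (L : List (ℕ × ZMod e)) (hpos : ∀ i : Fin L.length, 0 < (L.get i).1)
    (φ : (Σ i : Fin L.length, Fin (L.get i).1) ≃ Fin n) (b : ZMod e) :
    GW (n := n) hm j ζ xv ⟨fun t => Multiplicative.ofAdd (aexc e L b (φ.symm t)),
      φ.symm.trans ((Equiv.sigmaCongrRight fun _ => finRotate _).trans φ)⟩ = ∏ i : Fin L.length,
      (zmpow e ζ (- (if (i : ℕ) = 0 then b else 0) * ((j * d : ℕ) : ZMod e)) * Cyc e p d m j ζ xv (L.get i).1 (L.get i).2) := by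
  unfold GW
  rw [trace_diag]
  simp only [← prod_ty]
  set f := tE e d m hm ^ j with hf
  let g : ∀ (i : Fin L.length) (t : Fin (L.get i).1), BIdx e m → ℂ := fun i t y => xv y *
    ζ ^ (((if (t : ℕ) = 0 then (L.get i).2 - (if (i : ℕ) = 0 then b else 0) else 0) +
      (if (t : ℕ) = (L.get i).1 - 1 then (if (i : ℕ) = 0 then b else 0) else 0) : ZMod e).val * y.1.val)
  have h1 : ∀ i : Fin L.length, ∑ c : Fin (L.get i).1 → BIdx e m, ∏ t, (if c (finRotate _ t) = f (c t) then g i t (c t) else 0)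
     = zmpow e ζ (- (if (i : ℕ) = 0 then b else 0) * ((j * d : ℕ) : ZMod e)) * Cyc e p d m j ζ xv (L.get i).1 (L.get i).2 := by
    intro i
    rw [cyc_sum f _ (hpos i), ← cyc_eval hp hd hm j hζ xv (hpos i)]
  rw [← Finset.prod_congr rfl fun i _ => h1 i]
  rw [Finset.prod_univ_sum]
  rw [Fintype.piFinset_univ]
  symm
  refine Fintype.sum_equiv ((Equiv.piCurry fun _ _ => BIdx e m).symm.trans (Equiv.arrowCongr φ (Equiv.refl _))) _ _ fun c => ?_
  have h2 : ∀ (s : Fin n), ((Equiv.piCurry fun _ _ => BIdx e m).symm.trans (Equiv.arrowCongr φ (Equiv.refl _))) c s = c (φ.symm s).1 (φ.symm s).2 := fun s => rfl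
  generalize ((Equiv.piCurry fun _ _ => BIdx e m).symm.trans (Equiv.arrowCongr φ (Equiv.refl _))) c = c' at h2
  have h3 : ∀ x, c' (φ x) = c x.1 x.2 := by intro x; rw [h2, Equiv.symm_apply_apply]
  rw [← Fintype.prod_sigma' (fun i t => if c i (finRotate _ t) = f (c i t) then g i t (c i t) else 0), Finset.prod_ite_zero]
  have h4 : (∀ x ∈ (Finset.univ : Finset (Σ i : Fin L.length, Fin (L.get i).1)), c x.1 (finRotate _ x.2) = f (c x.1 x.2)) ↔
     c' ∘ (φ.symm.trans ((Equiv.sigmaCongrRight fun _ => finRotate _).trans φ)) = f ∘ c' := by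
    rw [funext_iff]
    constructor
    · intro h s
      obtain ⟨x, rfl⟩ := φ.surjective s
      simp only [Function.comp, Equiv.trans_apply, Equiv.symm_apply_apply, h3]
      exact h x (Finset.mem_univ _)
    · intro h x _
      have := h (φ x)
      simp only [Function.comp, Equiv.trans_apply, Equiv.symm_apply_apply, h3] at this
      exact this
  by_cases h5 : c' ∘ (φ.symm.trans ((Equiv.sigmaCongrRight fun _ => finRotate _).trans φ)) = f ∘ c'
  · rw [if_pos (h4.2 h5), if_pos h5]
    unfold chi
    rw [← Finset.prod_mul_distrib, ← Equiv.prod_comp φ]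
    refine Finset.prod_congr rfl fun x _ => ?_
    simp only [g]
    rw [h3, toAdd_ofAdd, Equiv.symm_apply_apply, aexc_eq]
  · rw [if_neg (fun h => h5 (h4.1 h)), if_neg h5]

include hp hd in
lemma GW_cyc {ζ : ℂ} (hζ : IsPrimitiveRoot ζ e) (xv : BIdx e m → ℂ) (β : ZMod e → Multiset ℕ) (hβ : IsEPartition e n β) (b : ZMod e) :
    GW (n := n) hm j ζ xv (wrep e n β b) = ∏ i : Fin (partsList e β).length,
      (zmpow e ζ (- (if (i : ℕ) = 0 then b else 0) * ((j * d : ℕ) : ZMod e)) * Cyc e p d m j ζ xv ((partsList e β).get i).1 ((partsList e β).get i).2) := by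
  unfold wrep
  rw [dif_pos (partsList_card β hβ)]
  refine GW_cyc_aux hp hd hm j hζ xv (partsList e β) (fun i => ?_) _ b
  exact hβ.1 _ _ ((mem_partsList β _).1 (List.get_mem (partsList e β) i))

lemma Delta_zero (hp : p ∣ e) (hd : d = e / p) (j : ℕ) (β : ZMod e → Multiset ℕ) (h : Cond261 e p j β) : (Delta e β : ZMod e) * ((j * d : ℕ) : ZMod e) = 0 := by
  rw [← Nat.cast_mul, ← mul_assoc, sJ_zero hp hd]
  unfold Delta
  refine Finset.dvd_sum fun k _ => ?_
  by_cases h1 : β k = 0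
  · simp [h1]
  · exact (h.2 k h1).mul_right _

include hp hd in
lemma prod_h {M : Type*} [CommMonoid M] (F : ZMod e → M) (hF : ∀ k : ZMod e, ¬ hOrd p j ∣ k.val → F k = 1) :
    ∏ k, F k = ∏ k' ∈ Finset.range (Esys p d j), F ((hOrd p j * k' : ℕ) : ZMod e) := by
  have hE := E_mul_h hp hd j
  have hh := hOrd_pos hp j
  have hval : ∀ a < Esys p d j, (((hOrd p j * a : ℕ) : ZMod e)).val = hOrd p j * a := by
    intro a ha
    rw [ZMod.val_natCast, Nat.mod_eq_of_lt]
    calc hOrd p j * a < hOrd p j * Esys p d j := by gcongr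
      _ = e := by rw [mul_comm, hE]
  rw [← Finset.prod_filter_mul_prod_filter_not Finset.univ (fun k : ZMod e => hOrd p j ∣ k.val)]
  rw [Finset.prod_eq_one (s := Finset.univ.filter fun k : ZMod e => ¬ hOrd p j ∣ k.val) (fun k hk => hF k (Finset.mem_filter.1 hk).2), mul_one]
  symm
  refine Finset.prod_bij (fun k' _ => ((hOrd p j * k' : ℕ) : ZMod e)) ?_ ?_ ?_ ?_
  · intro a ha
    rw [Finset.mem_filter, hval a (Finset.mem_range.1 ha)]
    exact ⟨Finset.mem_univ _, Dvd.intro _ rfl⟩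
  · intro a ha a' ha' h
    have := congrArg ZMod.val h
    rw [hval a (Finset.mem_range.1 ha), hval a' (Finset.mem_range.1 ha')] at this
    exact Nat.eq_of_mul_eq_mul_left hh this
  · intro k hk
    obtain ⟨a, ha⟩ := (Finset.mem_filter.1 hk).2
    refine ⟨a, ?_, ?_⟩
    · rw [Finset.mem_range]
      have := ZMod.val_lt k
      rw [ha, ← hE, mul_comm] at this
      exact lt_of_mul_lt_mul_right this (Nat.zero_le _)
    · rw [← ha, ZMod.natCast_zmod_val]
  · intro a ha; rfl

include hp hd in
theorem GW_wrep [NeZero n] {ζ : ℂ} (hζ : IsPrimitiveRoot ζ e) (xv : BIdx e m → ℂ) (β : ZMod e → Multiset ℕ) (hβ : IsEPartition e n β) (b : ZMod e) :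
    GW (n := n) hm j ζ xv (wrep e n β b) = pTuple e p d ζ m xv β b j := by
  rw [GW_cyc hp hd hm j hζ xv β hβ b, Finset.prod_mul_distrib]
  rw [prod_get (partsList e β) (fun x => Cyc e p d m j ζ xv x.1 x.2), partsList_prod]
  have hlen : 0 < (partsList e β).length := by
    rw [List.length_pos_iff]
    intro h
    have := partsList_card β hβ
    rw [Fintype.card_sigma] at this
    simp only [Fintype.card_fin] at this
    rw [sum_get (partsList e β) (fun x => x.1), h] at this
    exact NeZero.ne n this.symm
  have h1 : ∏ i : Fin (partsList e β).length, zmpow e ζ (- (if (i : ℕ) = 0 then b else 0) * ((j * d : ℕ) : ZMod e)) = zmpow e ζ (- b * ((j * d : ℕ) : ZMod e)) := by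
    rw [Finset.prod_eq_single (⟨0, hlen⟩ : Fin _)]
    · simp
    · intro i _ hi
      rw [if_neg (fun h => hi (Fin.ext h))]
      simp [zm_zero]
    · intro h; exact absurd (Finset.mem_univ _) h
  rw [h1]
  unfold pTuple
  have hh := hOrd_pos hp j
  split_ifs with hC
  · rw [add_mul, Delta_zero hp hd j β hC, zero_add, ← neg_mul]
    have h2 : ∀ k : ZMod e, ((β k).map fun r => Cyc e p d m j ζ xv r k).prod = (hOrd p j : ℂ) ^ (β k).card *
       (((β k).map (fun r => r / hOrd p j)).map fun r => pGenSys (ζ ^ hOrd p j) (Esys p d j) (mmX e m) (vvX e p d m xv j) (k.val / hOrd p j) r).prod := by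
      intro k
      rw [Multiset.map_map, ← Multiset.prod_replicate, ← Multiset.map_const', ← Multiset.prod_map_mul]
      congr 1
      refine Multiset.map_congr rfl fun r hr => ?_
      unfold Cyc
      rw [if_pos ⟨hC.1 k r hr, hC.2 k (fun h => by rw [h] at hr; simp at hr)⟩]
      rfl
    have h3 : ∀ k : ZMod e, ¬ hOrd p j ∣ k.val → β k = 0 := by
      intro k hk
      by_contra h
      exact hk (hC.2 k h)
    rw [prod_h hp hd j _ (fun k hk => by rw [h3 k hk]; simp)]
    simp only [h2]
    rw [Finset.prod_mul_distrib, mul_comm ((hOrd p j : ℂ) ^ _), mul_assoc]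
    congr 1
    unfold lenBracket pBracket pAlphaSys
    rw [Finset.prod_pow_eq_pow_sum]
    congr 1
    · congr 1
      refine Finset.sum_congr rfl fun k hk => ?_
      unfold bracketF
      rw [if_pos (Finset.mem_range.1 hk), Multiset.card_map]
    · refine Finset.prod_congr rfl fun k hk => ?_
      unfold bracketF
      rw [if_pos (Finset.mem_range.1 hk)]
      have hval : (((hOrd p j * k : ℕ) : ZMod e)).val = hOrd p j * k := by
        rw [ZMod.val_natCast, Nat.mod_eq_of_lt]
        calc hOrd p j * k < hOrd p j * Esys p d j := by gcongr; exact Finset.mem_range.1 hk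
          _ = e := by rw [mul_comm, E_mul_h hp hd j]
      rw [hval, Nat.mul_div_cancel_left _ hh]
  · have : ∃ k, ∃ r ∈ β k, ¬ (hOrd p j ∣ r ∧ hOrd p j ∣ k.val) := by
      by_contra h
      push Not at h
      apply hC
      refine ⟨fun k r hr => (h k r hr).1, fun k hk => ?_⟩
      obtain ⟨r, hr⟩ := Multiset.exists_mem_of_ne_zero hk
      exact (h k r hr).2
    obtain ⟨k, r, hr, hkr⟩ := this
    rw [Finset.prod_eq_zero (Finset.mem_univ k), mul_zero]
    refine Multiset.prod_eq_zero (Multiset.mem_map.2 ⟨r, hr, ?_⟩)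
    unfold Cyc
    rw [if_neg hkr]

/-- the total colour of the representative modulo `p` -/
lemma tot_wrep (hp : p ∣ e) (β : ZMod e → Multiset ℕ) (hβ : IsEPartition e n β) (b : ZMod e) :
    (tot (wrep e n β b) : ZMod p) = (Delta e β : ZMod p) := by
  have h0 : (tot (wrep e n β b) : ZMod e) = (Delta e β : ZMod e) := by
    have hcard := partsList_card β hβ
    have hpos : ∀ i : Fin (partsList e β).length, 0 < ((partsList e β).get i).1 := by
      intro i
      have := (mem_partsList β _).1 (List.get_mem (partsList e β) i)
      exact hβ.1 _ _ this
    unfold tot wrep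
    rw [dif_pos hcard]
    push_cast
    simp only [ZMod.natCast_zmod_val, toAdd_ofAdd]
    rw [Equiv.sum_comp (Fintype.equivFinOfCardEq hcard).symm (fun x => aexc e (partsList e β) b x), Fintype.sum_sigma]
    have h1 : ∀ i : Fin (partsList e β).length, ∑ t, aexc e (partsList e β) b ⟨i, t⟩ = ((partsList e β).get i).2 := by
      intro i
      have := cyc_expo (hpos i) ((partsList e β).get i).2 (if (i : ℕ) = 0 then b else 0) (fun _ => 1) 0 (by simp) (by simp)
      simp only [mul_one, mul_zero, sub_zero] at this
      rw [← this]
      refine Finset.sum_congr rfl fun t _ => ?_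
      rw [aexc_eq]
    simp only [h1]
    rw [sum_get (partsList e β) (fun x => x.2), partsList_sum]
    unfold Delta
    push_cast
    refine Finset.sum_congr rfl fun k _ => ?_
    simp [mul_comm]
  have := congrArg (ZMod.castHom hp (ZMod p)) h0
  simpa using this
end Tr
end GreenII

namespace GreenII

section Proj
variable {X : Type*} [Fintype X] [DecidableEq X]
open Matrix

lemma avg_proj {Q H : Matrix X X ℂ} {N : ℕ} (hN : 0 < N) (hH : H ^ N = 1) (hQ : Q * Q = Q)
    (hHQ : H * Q = Q * H) :
    (∀ v : X → ℂ, (Q * ((N : ℂ)⁻¹ • ∑ l ∈ Finset.range N, H ^ l)) *ᵥ v = v ↔ Q *ᵥ v = v ∧ H *ᵥ v = v) ∧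
    (Q * ((N : ℂ)⁻¹ • ∑ l ∈ Finset.range N, H ^ l)) * (Q * ((N : ℂ)⁻¹ • ∑ l ∈ Finset.range N, H ^ l))
      = Q * ((N : ℂ)⁻¹ • ∑ l ∈ Finset.range N, H ^ l) := by
  set A := (N : ℂ)⁻¹ • ∑ l ∈ Finset.range N, H ^ l with hA
  have hN0 : (N : ℂ) ≠ 0 := by exact_mod_cast hN.ne'
  have hHA : H * A = A := by
    have h1 := mul_geom_sum H N
    rw [hH, sub_self, sub_mul, one_mul, sub_eq_zero] at h1
    rw [hA, mul_smul_comm, h1]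
  have hfix : ∀ v : X → ℂ, Q *ᵥ v = v → H *ᵥ v = v → (Q * A) *ᵥ v = v := by
    intro v h1 h2
    have h3 : ∀ l : ℕ, H ^ l *ᵥ v = v := by
      intro l
      induction l with
      | zero => simp
      | succ l ih => rw [pow_succ, ← Matrix.mulVec_mulVec, h2, ih]
    have h4 : A *ᵥ v = v := by
      rw [hA, Matrix.smul_mulVec, Matrix.sum_mulVec, Finset.sum_congr rfl fun l _ => h3 l,
        Finset.sum_const, Finset.card_range, ← Nat.cast_smul_eq_nsmul ℂ, smul_smul,
        inv_mul_cancel₀ hN0, one_smul]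
    rw [← Matrix.mulVec_mulVec, h4, h1]
  have hq : Q * (Q * A) = Q * A := by rw [← mul_assoc, hQ]
  have hh : H * (Q * A) = Q * A := by rw [← mul_assoc, hHQ, mul_assoc, hHA]
  constructor
  · intro v
    constructor
    · intro h
      constructor
      · rw [← h, Matrix.mulVec_mulVec, hq]
      · rw [← h, Matrix.mulVec_mulVec, hh]
    · exact fun h => hfix v h.1 h.2
  · apply mat_ext_mulVec
    intro v
    rw [← Matrix.mulVec_mulVec]
    exact hfix _ (by rw [Matrix.mulVec_mulVec, hq]) (by rw [Matrix.mulVec_mulVec, hh])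

end Proj

section Fin
open Matrix
variable {e n d p q : ℕ} [NeZero e] {m : ZMod e → ℕ}
variable (hp : p ∣ e) (hd : d = e / p) (hm : ∀ k, m (k + (d : ZMod e)) = m k)

include hp hd in
lemma theta_p (α : ZMod e → Multiset ℕ) : (theta e d)^[p] α = α := by
  funext k
  rw [theta_iter, pd_eq hp hd]
  simp

include hp hd in
lemma csize_dvd (α : ZMod e → Multiset ℕ) : csize e d α ∣ p :=
  Function.IsPeriodicPt.minimalPeriod_dvd (theta_p hp hd α)

include hp hd in
lemma csize_pos (α : ZMod e → Multiset ℕ) : 0 < csize e d α :=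
  Nat.pos_of_dvd_of_pos (csize_dvd hp hd α) (p_pos hp)

lemma csize_dvd_iff (α : ZMod e → Multiset ℕ) (j : ℕ) :
    csize e d α ∣ j ↔ (theta e d)^[j] α = α :=
  (Function.isPeriodicPt_iff_minimalPeriod_dvd (f := theta e d) (x := α) (n := j)).symm

include hp hd in
lemma csize_theta (α : ZMod e → Multiset ℕ) (i : ℕ) :
    csize e d ((theta e d)^[i] α) = csize e d α :=
  Function.minimalPeriod_apply_iterate ⟨p, p_pos hp, theta_p hp hd α⟩ i

include hp hd in
lemma tE_p : tE e d m hm ^ p = 1 := by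
  ext1 b
  apply bidx_ext
  · rw [tE_pow_fst, pd_eq hp hd]; simp
  · rw [tE_pow_snd]; rfl

variable {ζ : ℂ} (hζ : IsPrimitiveRoot ζ e) (w : Wt e n) (hw : (tot w : ZMod p) = (q : ZMod p))

include hp hd hζ hw in
lemma rho_P (i : ℕ) : rhoMat e n ζ m w * permT n (tE e d m hm ^ i)
      = ζ ^ (q * i * d) • (permT n (tE e d m hm ^ i) * rhoMat e n ζ m w) := by
  rw [rho_tau hζ hm w i]
  congr 1
  apply root_pow_congr hζ
  rw [ZMod.natCast_eq_natCast_iff] at hw ⊢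
  have h1 : tot w * i * d ≡ q * i * d [MOD p * d] := (hw.mul_right i).mul_right' d
  rw [pd_eq hp hd] at h1
  rw [← mul_assoc]; exact h1

include hp hd hζ hw in
lemma zW_theta (α : ZMod e → Multiset ℕ) (i l : ℕ) :
    zW ζ (permT n (tE e d m hm ^ l)) ((theta e d)^[i] α) w
      = ζ ^ (q * i * d) * zW ζ (permT n (tE e d m hm ^ l)) α w := by
  set P := permT n (tE e d m hm ^ i) with hP
  set P' := permT n (tE e d m hm ^ i)⁻¹ with hP'
  have h1 : P' * P = 1 := permT_inv_mul _
  have h1' : P * P' = 1 := permT_mul_inv _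
  have h2 := permT_Qp (n := n) hm α i
  rw [← hP] at h2
  have h3 := rho_P (m := m) hp hd hm hζ w hw i
  rw [← hP] at h3
  have h4 : Qp e n m ((theta e d)^[i] α) = P * Qp e n m α * P' := by
    rw [h2, Matrix.mul_assoc, h1', Matrix.mul_one]
  have h5 : permT n (tE e d m hm ^ l) * P = P * permT n (tE e d m hm ^ l) := by
    rw [hP, ← permT_mul, ← permT_mul, ← pow_add, ← pow_add, add_comm]
  unfold zW
  set T := permT n (tE e d m hm ^ l)
  set U := rhoMat e n ζ m w
  set Q := Qp e n m α
  rw [h4]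
  calc Matrix.trace (P * Q * P' * (U * T)) = Matrix.trace (P * (Q * P' * (U * T))) := by
        simp only [Matrix.mul_assoc]
    _ = Matrix.trace (Q * P' * (U * (T * P))) := by rw [Matrix.trace_mul_comm]; simp only [Matrix.mul_assoc]
    _ = Matrix.trace (Q * P' * ((U * P) * T)) := by rw [h5]; simp only [Matrix.mul_assoc]
    _ = ζ ^ (q * i * d) * Matrix.trace (Q * ((P' * P) * (U * T))) := by
        rw [h3]
        simp only [Matrix.smul_mul, Matrix.mul_smul, Matrix.trace_smul, smul_eq_mul, Matrix.mul_assoc]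
    _ = _ := by rw [h1, Matrix.one_mul]

include hp hd hζ hw in
lemma zW_zero (α : ZMod e → Multiset ℕ) (l : ℕ) (h : ¬ p ∣ q * csize e d α) :
    zW ζ (permT n (tE e d m hm ^ l)) α w = 0 := by
  have h1 := zW_theta (m := m) hp hd hm hζ w hw α (csize e d α) l
  rw [(csize_dvd_iff α _).1 dvd_rfl] at h1
  by_contra h0
  have h2 : ζ ^ (q * csize e d α * d) = 1 := mul_right_cancel₀ h0 (by rw [one_mul]; exact h1.symm)
  have h3 := (hζ.pow_eq_one_iff_dvd _).1 h2
  have hd0 : 0 < d := Nat.pos_of_ne_zero (by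
    intro h; have := pd_eq hp hd; rw [h, mul_zero] at this; exact NeZero.ne e this.symm)
  have h4 : p * d ∣ q * csize e d α * d := by
    have h5 := pd_eq hp hd
    exact h5.dvd.trans h3
  exact h (Nat.dvd_of_mul_dvd_mul_right hd0 h4)

include hp hd hζ hw in
lemma charExt_eq (α : ZMod e → Multiset ℕ) (r : ℕ) (h : p ∣ q * csize e d α) :
    charExt e n d m hm ζ α r w = ((p / csize e d α : ℕ) : ℂ)⁻¹ *
      ∑ l ∈ Finset.range (p / csize e d α), (ζ ^ (csize e d α * d * r))⁻¹ ^ l *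
        zW ζ (permT n (tE e d m hm ^ (csize e d α * l))) α w := by
  set c := csize e d α with hc
  set N := p / c with hN
  set u := ζ ^ (c * d * r) with hu
  set G := permT n (tE e d m hm ^ c) with hG
  set Q := Qp e n m α with hQ
  set U := rhoMat e n ζ m w with hU
  have hcN : c * N = p := Nat.mul_div_cancel' (csize_dvd hp hd α)
  have hN0 : 0 < N := Nat.div_pos (Nat.le_of_dvd (p_pos hp) (csize_dvd hp hd α)) (csize_pos hp hd α)
  have hu0 : u ≠ 0 := pow_ne_zero _ (hζ.ne_zero (NeZero.ne e))
  have huN : u ^ N = 1 := by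
    rw [hu, ← pow_mul, hζ.pow_eq_one_iff_dvd]
    refine ⟨r, ?_⟩
    rw [← pd_eq hp hd, ← hcN]; ring
  have hGl : ∀ l, G ^ l = permT n (tE e d m hm ^ (c * l)) := fun l => by
    rw [hG, ← permT_pow, pow_mul]
  have hGN : G ^ N = 1 := by rw [hGl, hcN, tE_p hp hd hm, permT_one]
  have hGQ : G * Q = Q * G := by
    rw [hG, hQ, permT_Qp, (csize_dvd_iff α _).1 dvd_rfl]
  have hUG : U * G = G * U := by
    rw [hU, hG, rho_P (m := m) hp hd hm hζ w hw c]
    have : ζ ^ (q * c * d) = 1 := by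
      rw [hζ.pow_eq_one_iff_dvd, ← pd_eq hp hd]
      exact Nat.mul_dvd_mul_right h d
    rw [this, one_smul]
  obtain ⟨k1, k2⟩ := avg_proj (Q := Q) (H := u⁻¹ • G) hN0 (by rw [smul_pow, hGN, inv_pow, huN, inv_one, one_smul])
    (Qp_idem α) (by rw [Matrix.smul_mul, Matrix.mul_smul, hGQ])
  have hS : ∀ v, v ∈ ZSub e n d m hm ζ α r ↔ Q *ᵥ v = v ∧ G *ᵥ v = u • v := by
    intro v
    unfold ZSub
    rw [Submodule.mem_inf, Qp_mem, Module.End.mem_eigenspace_iff, tauMat_eq, Matrix.mulVecLin_apply, hG, permT_pow]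
  have hS' : ∀ v, v ∈ ZSub e n d m hm ζ α r ↔
      (Q * ((N : ℂ)⁻¹ • ∑ l ∈ Finset.range N, (u⁻¹ • G) ^ l)) *ᵥ v = v := by
    intro v
    rw [hS, k1 v, Matrix.smul_mulVec, inv_smul_eq_iff₀ hu0]
  have hinv : ∀ v ∈ ZSub e n d m hm ζ α r, U *ᵥ v ∈ ZSub e n d m hm ζ α r := by
    intro v hv
    rw [hS] at hv ⊢
    constructor
    · rw [Matrix.mulVec_mulVec, hQ, hU, ← Qp_rho hζ, ← Matrix.mulVec_mulVec, hv.1]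
    · rw [Matrix.mulVec_mulVec, ← hUG, ← Matrix.mulVec_mulVec, hv.2, Matrix.mulVec_smul]
  have key := traceOn_eq k2 hS' hinv
  unfold charExt
  rw [key]
  have hUQ : U * Q = Q * U := Qp_rho hζ α w
  rw [Matrix.mul_smul, Matrix.mul_smul, Matrix.trace_smul, smul_eq_mul, Matrix.mul_sum, Matrix.mul_sum, Matrix.trace_sum]
  congr 1
  refine Finset.sum_congr rfl fun l _ => ?_
  rw [smul_pow, Matrix.mul_smul, Matrix.mul_smul, Matrix.trace_smul, smul_eq_mul, hGl, ← Matrix.mul_assoc, hUQ,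
    Matrix.mul_assoc]
  rfl

include hp hd hζ hw in
lemma charExt_theta (α : ZMod e → Multiset ℕ) (r i : ℕ) (h : p ∣ q * csize e d α) :
    charExt e n d m hm ζ ((theta e d)^[i] α) r w = ζ ^ (q * i * d) * charExt e n d m hm ζ α r w := by
  rw [charExt_eq (m := m) hp hd hm hζ w hw α r h,
    charExt_eq (m := m) hp hd hm hζ w hw _ r (by rw [csize_theta hp hd]; exact h), csize_theta hp hd,
    mul_left_comm]
  congr 1
  rw [Finset.mul_sum]
  refine Finset.sum_congr rfl fun l _ => ?_
  rw [zW_theta (m := m) hp hd hm hζ w hw, mul_left_comm]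

include hp hd hζ hw in
lemma charExt_sum (α : ZMod e → Multiset ℕ) (j : ℕ) (hj : j < p) (h : p ∣ q * csize e d α)
    (hcj : csize e d α ∣ j) :
    ∑ r ∈ Finset.range (p / csize e d α), ζ ^ (d * r * j) * charExt e n d m hm ζ α r w
      = zW ζ (permT n (tE e d m hm ^ j)) α w := by
  have hcN' : csize e d α * (p / csize e d α) = p := Nat.mul_div_cancel' (csize_dvd hp hd α)
  have hc0 := csize_pos hp hd α
  simp_rw [charExt_eq (m := m) hp hd hm hζ w hw α _ h]
  obtain ⟨l0, rfl⟩ := hcj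
  generalize hc : csize e d α = c at *
  generalize hN : p / c = N at *
  have hN0 : 0 < N := by
    rcases Nat.eq_zero_or_pos N with h0 | h0
    · rw [h0, mul_zero] at hcN'; have := p_pos hp; omega
    · exact h0
  have hl0 : l0 < N := by
    rw [← hcN'] at hj; exact Nat.lt_of_mul_lt_mul_left hj
  have hNC : (N : ℂ) ≠ 0 := by exact_mod_cast hN0.ne'
  have hω : IsPrimitiveRoot (ζ ^ (c * d)) N := hζ.pow (NeZero.pos e) (by
    rw [← pd_eq hp hd, ← hcN']; ring)
  set ω := ζ ^ (c * d) with hωd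
  have hω0 : ω ≠ 0 := hω.ne_zero hN0.ne'
  have hgeo : ∀ l ∈ Finset.range N, ∑ r ∈ Finset.range N, ζ ^ (d * r * (c * l0)) * (ζ ^ (c * d * r))⁻¹ ^ l
      = if l = l0 then (N : ℂ) else 0 := by
    intro l hl
    rw [Finset.mem_range] at hl
    have hx : ∀ r, ζ ^ (d * r * (c * l0)) * (ζ ^ (c * d * r))⁻¹ ^ l = (ω ^ l0 * (ω ^ l)⁻¹) ^ r := by
      intro r
      rw [hωd, mul_pow, inv_pow, inv_pow]
      simp only [← pow_mul]
      congr 2 <;> [skip; congr 1] <;> ring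
    rw [Finset.sum_congr rfl fun r _ => hx r]
    split_ifs with hll
    · subst hll
      rw [mul_inv_cancel₀ (pow_ne_zero _ hω0)]
      simp
    · have h1 : ω ^ l0 * (ω ^ l)⁻¹ ≠ 1 := by
        intro h1
        rw [mul_inv_eq_one₀ (pow_ne_zero _ hω0)] at h1
        exact hll (hω.pow_inj hl0 hl h1).symm
      have h2 : (ω ^ l0 * (ω ^ l)⁻¹) ^ N = 1 := by
        rw [mul_pow, inv_pow, pow_right_comm, pow_right_comm ω l, hω.pow_eq_one]
        simp
      rw [geom_sum_eq h1, h2, sub_self, zero_div]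
  calc ∑ r ∈ Finset.range N, ζ ^ (d * r * (c * l0)) * ((N : ℂ)⁻¹ * ∑ l ∈ Finset.range N,
          (ζ ^ (c * d * r))⁻¹ ^ l * zW ζ (permT n (tE e d m hm ^ (c * l))) α w)
      = (N : ℂ)⁻¹ * ∑ l ∈ Finset.range N, (∑ r ∈ Finset.range N, ζ ^ (d * r * (c * l0)) * (ζ ^ (c * d * r))⁻¹ ^ l) *
          zW ζ (permT n (tE e d m hm ^ (c * l))) α w := by
        simp_rw [Finset.mul_sum, Finset.sum_mul, Finset.mul_sum]
        rw [Finset.sum_comm]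
        refine Finset.sum_congr rfl fun l _ => Finset.sum_congr rfl fun r _ => ?_
        ring
    _ = (N : ℂ)⁻¹ * ∑ l ∈ Finset.range N, (if l = l0 then (N : ℂ) else 0) *
          zW ζ (permT n (tE e d m hm ^ (c * l))) α w := by
        congr 1
        exact Finset.sum_congr rfl fun l hl => by rw [hgeo l hl]
    _ = _ := by
        simp_rw [ite_mul, zero_mul]
        rw [Finset.sum_ite_eq' , if_pos (Finset.mem_range.2 hl0), inv_mul_cancel_left₀ hNC]

end Fin
end GreenII

namespace GreenII

theorem statement6 (e p d n q : ℕ) [NeZero e] [NeZero n] (hp : p ∣ e) (hd : d = e / p)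
    (hq : q ∣ e) (hqp : Nat.Coprime (e / q) (e / p))
    (ζ : ℂ) (hζ : IsPrimitiveRoot ζ e)
    (m : ZMod e → ℕ) (hmn : ∀ k, n ≤ m k) (hm : ∀ k, m (k + (d : ZMod e)) = m k)
    (xv : BIdx e m → ℂ)
    (R : Finset ((ZMod e → Multiset ℕ) × ℕ))
    (hR1 : ∀ z ∈ R, IsEPartition e n z.1 ∧ z.2 < p / csize e d z.1 ∧ p ∣ q * csize e d z.1)
    (hR2 : ∀ α, IsEPartition e n α → p ∣ q * csize e d α →
      ∀ r, r < p / csize e d α → ∃! z, z ∈ R ∧ SameOrbit e d z.1 α ∧ z.2 = r)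
    (β : ZMod e → Multiset ℕ) (hβ : IsEPartition e n β) (b : ZMod e)
    (hΔ : (Delta e β : ZMod p) = (q : ZMod p))
    (j : ℕ) (hj : j < p) :
    pTuple e p d ζ m xv β b j =
      ∑ z ∈ R, charExt e n d m hm ζ z.1 z.2 (wrep e n β b) *
        sTuple e p d q ζ m xv z.1 z.2 j := by
  have hw : (tot (wrep e n β b) : ZMod p) = (q : ZMod p) := (tot_wrep hp β hβ b).trans hΔ
  rw [← GW_wrep hp hd hm j hζ xv β hβ b]
  generalize wrep e n β b = w at hw ⊢
  let A : Finset (ZMod e → Multiset ℕ) :=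
    (epart_finite hmn).toFinset.filter fun α => (theta e d)^[j] α = α
  have hA : ∀ α, α ∈ A ↔ IsEPartition e n α ∧ (theta e d)^[j] α = α := by
    intro α
    simp only [A, Finset.mem_filter, Set.Finite.mem_toFinset]
    rfl
  rw [GW_expand hp hd hm j hζ hmn xv A hA w]
  let V : (ZMod e → Multiset ℕ) → ℕ → ℂ := fun α r =>
    ζ ^ (d * r * j) * charExt e n d m hm ζ α r w * schurBrace e p d m xv j α
  let A' := A.filter fun α => p ∣ q * csize e d α
  have hA' : ∀ α, α ∈ A' ↔ IsEPartition e n α ∧ csize e d α ∣ j ∧ p ∣ q * csize e d α := by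
    intro α
    simp only [A', Finset.mem_filter, hA, csize_dvd_iff, and_assoc]
  have hL : ∑ α ∈ A, schurBrace e p d m xv j α * zW ζ (permT n (tE e d m hm ^ j)) α w
      = ∑ α ∈ A', ∑ r ∈ Finset.range (p / csize e d α), V α r := by
    simp only [A']
    rw [Finset.sum_filter (s := A)]
    refine Finset.sum_congr rfl fun α hα => ?_
    split_ifs with h
    · rw [← charExt_sum (m := m) hp hd hm hζ w hw α j hj h ((csize_dvd_iff α j).2 ((hA α).1 hα).2), Finset.mul_sum]
      refine Finset.sum_congr rfl fun r _ => ?_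
      simp only [V]
      ring
    · rw [zW_zero (m := m) hp hd hm hζ w hw α j h, mul_zero]
  let R' := R.filter fun z => csize e d z.1 ∣ j
  have hRR : ∑ z ∈ R, charExt e n d m hm ζ z.1 z.2 w * sTuple e p d q ζ m xv z.1 z.2 j
      = ∑ z ∈ R', ∑ i ∈ Finset.range (csize e d z.1), V ((theta e d)^[i] z.1) z.2 := by
    simp only [R']
    rw [Finset.sum_filter (s := R)]
    refine Finset.sum_congr rfl fun z hz => ?_
    unfold sTuple
    split_ifs with h
    · rw [Finset.mul_sum, Finset.mul_sum]
      refine Finset.sum_congr rfl fun i _ => ?_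
      simp only [V]
      rw [charExt_theta (m := m) hp hd hm hζ w hw z.1 z.2 i (hR1 z hz).2.2]
      ring
    · rw [mul_zero]
  rw [hL, hRR, Finset.sum_sigma', Finset.sum_sigma']
  symm
  refine Finset.sum_bij (fun x _ => ⟨(theta e d)^[x.2] x.1.1, x.1.2⟩) ?_ ?_ ?_ ?_
  · rintro ⟨z, i⟩ hx
    simp only [Finset.mem_sigma, R', Finset.mem_filter, Finset.mem_range, hA', csize_theta hp hd] at hx ⊢
    obtain ⟨⟨hz, hc⟩, hi⟩ := hx
    obtain ⟨h1, h2, h3⟩ := hR1 z hz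
    exact ⟨⟨h1.theta i, hc, h3⟩, h2⟩
  · rintro ⟨z, i⟩ hx ⟨z', i'⟩ hx' heq
    simp only [Finset.mem_sigma, R', Finset.mem_filter, Finset.mem_range] at hx hx'
    obtain ⟨⟨hz, hc⟩, hi⟩ := hx
    obtain ⟨⟨hz', hc'⟩, hi'⟩ := hx'
    simp only [Sigma.mk.injEq, heq_eq_eq] at heq
    obtain ⟨e1, e2⟩ := heq
    obtain ⟨h1, h2, h3⟩ := hR1 z hz
    have hu := hR2 ((theta e d)^[i] z.1) (h1.theta i) (by rw [csize_theta hp hd]; exact h3) z.2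
      (by rw [csize_theta hp hd]; exact h2)
    have hzz : z = z' := hu.unique ⟨hz, ⟨i, rfl⟩, rfl⟩ ⟨hz', ⟨i', e1.symm⟩, e2.symm⟩
    subst hzz
    have : i = i' := Function.iterate_injOn_Iio_minimalPeriod (f := theta e d) (x := z.1) hi hi' e1
    rw [this]
  · rintro ⟨α, r⟩ hx
    simp only [Finset.mem_sigma, Finset.mem_range, hA'] at hx
    obtain ⟨⟨h1, hc, h3⟩, h2⟩ := hx
    obtain ⟨z, ⟨hz, ⟨i, hi⟩, hr⟩, -⟩ := hR2 α h1 h3 r h2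
    have hcs : csize e d z.1 = csize e d α := by rw [← hi, csize_theta hp hd]
    refine ⟨⟨z, i % csize e d z.1⟩, ?_, ?_⟩
    · simp only [Finset.mem_sigma, R', Finset.mem_filter, Finset.mem_range]
      exact ⟨⟨hz, hcs ▸ hc⟩, Nat.mod_lt _ (csize_pos hp hd _)⟩
    · have : (theta e d)^[i % csize e d z.1] z.1 = α := by
        rw [← hi]; exact Function.iterate_mod_minimalPeriod_eq
      simp only [this, hr]
  · intro x hx
    rfl

end GreenII
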